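/- Let n ≥ 4 and let ρ be an injective group endomorphism of B_n/Z(B_n). Then ρ is almost half-twist preserving: there exists a positive integer k such that for every half-twist b in B_n/Z(B_n) (i.e., every conjugate of σ̄_1, the image of σ_1), there exist a nonzero integer m and an element c ∈ B_n/Z(B_n) with ρ(b^k) = c·σ̄_1^{2m}·c^{−1} (a nonzero power of a Dehn twist about a 2-curve). -/

import Mathlib

/-- Relators for the braid group with generators `σ_0, …, σ_{m-1}`:
the braid relations `σ_i σ_j σ_i = σ_j σ_i σ_j` for `j = i+1`, and the
commutation relations `σ_i σ_j = σ_j σ_i` for `j ≥ i+2`. -/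
def braidRels (m : ℕ) : Set (FreeGroup (Fin m)) :=
  { r | ∃ i j : Fin m,
      ((i : ℕ) + 1 = (j : ℕ) ∧
        r = FreeGroup.of i * FreeGroup.of j * FreeGroup.of i *
            (FreeGroup.of j * FreeGroup.of i * FreeGroup.of j)⁻¹) ∨
      ((i : ℕ) + 2 ≤ (j : ℕ) ∧
        r = FreeGroup.of i * FreeGroup.of j * (FreeGroup.of j * FreeGroup.of i)⁻¹) }

/-- The braid group on `n` strands: the presented group with generators
`σ_1, …, σ_{n-1}` (indexed by `Fin (n-1)`) and the braid relators. -/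
abbrev BraidGroup (n : ℕ) : Type := PresentedGroup (braidRels (n - 1))

/-- The standard generator `σ_{i+1}` of the braid group (0-indexed). -/
def braidσ (n : ℕ) (i : Fin (n - 1)) : BraidGroup n := PresentedGroup.of i

/-- The element `δ = σ_1 σ_2 ⋯ σ_{n-1}` of the braid group. -/
def braidδ (n : ℕ) : BraidGroup n := (List.ofFn (braidσ n)).prod

/-- The full twist `z = (σ_1 σ_2 ⋯ σ_{n-1})^n`. -/
def fullTwist (n : ℕ) : BraidGroup n := braidδ n ^ n

set_option linter.unusedSimpArgs false

section

namespace FG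

open FreeGroup (of lift)

section Commuting
variable {α : Type*}

/-- Commuting elements of a free group are powers of a common element. -/
theorem exists_zpow_of_commute {x y : FreeGroup α} (h : Commute x y) :
    ∃ (z : FreeGroup α) (m n : ℤ), x = z ^ m ∧ y = z ^ n := by
  classical
  let H : Subgroup (FreeGroup α) := Subgroup.closure {x, y}
  have hcomm : ∀ a b : H, a * b = b * a := by
    have : ∀ a ∈ ({x, y} : Set (FreeGroup α)), ∀ b ∈ ({x, y} : Set (FreeGroup α)),
        a * b = b * a := by
      rintro a (rfl | rfl) b (rfl | rfl)
      · rfl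
      · exact h
      · exact h.symm
      · rfl
    have := Subgroup.isMulCommutative_closure this
    intro a b
    exact this.is_comm.comm a b
  let e := IsFreeGroup.toFreeGroup H
  have hsub : Subsingleton (IsFreeGroup.Generators H) := by
    refine ⟨fun a b => ?_⟩
    by_contra hab
    have h1 : (of a * of b : FreeGroup (IsFreeGroup.Generators H)) = of b * of a := by
      apply e.symm.injective
      rw [map_mul, map_mul, hcomm]
    let f : FreeGroup (IsFreeGroup.Generators H) →* Equiv.Perm (Fin 3) :=
      lift fun c => if c = a then Equiv.swap 0 1 else Equiv.swap 1 2
    have h2 := congrArg f h1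
    simp only [map_mul, f, FreeGroup.lift_apply_of, if_true, if_neg (Ne.symm hab)] at h2
    exact absurd h2 (by decide)
  have hz : ∃ z : H, ∀ w : H, ∃ m : ℤ, w = z ^ m := by
    rcases isEmpty_or_nonempty (IsFreeGroup.Generators H) with he | ⟨⟨a⟩⟩
    · refine ⟨1, fun w => ⟨0, e.injective ?_⟩⟩
      exact Subsingleton.elim _ _
    · refine ⟨e.symm (of a), fun w => ?_⟩
      have : e w ∈ Subgroup.zpowers (of a) := by
        induction e w using FreeGroup.induction_on with
        | C1 => exact one_mem _
        | of c => rw [Subsingleton.elim c a]; exact Subgroup.mem_zpowers _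
        | inv_of c hc => exact inv_mem hc
        | mul u v hu hv => exact mul_mem hu hv
      obtain ⟨m, hm⟩ := this
      refine ⟨m, e.injective ?_⟩
      rw [map_zpow, MulEquiv.apply_symm_apply]
      exact hm.symm
  obtain ⟨z, hz⟩ := hz
  obtain ⟨m, hm⟩ := hz ⟨x, Subgroup.subset_closure (by simp)⟩
  obtain ⟨n, hn⟩ := hz ⟨y, Subgroup.subset_closure (by simp)⟩
  exact ⟨z, m, n, by simpa using congrArg Subtype.val hm, by simpa using congrArg Subtype.val hn⟩

theorem commute_of_zpow_commute {x y : FreeGroup α} {k : ℤ} (hk : k ≠ 0)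
    (h : Commute (x ^ k) y) : Commute x y := by
  have h1 : (y * x * y⁻¹) ^ k = x ^ k := by
    rw [conj_zpow, ← h.eq, mul_inv_cancel_right]
  have h2 := zpow_left_injective hk h1
  have : y * x = x * y := mul_inv_eq_iff_eq_mul.1 h2
  exact this.symm

end Commuting

section Exponent
variable {α : Type*} [DecidableEq α]

/-- The exponent sum of the generator `j`. -/
def expSum (j : α) : FreeGroup α →* Multiplicative ℤ :=
  lift fun i => Multiplicative.ofAdd (if i = j then 1 else 0)

/-- The exponent sum of the generator `j`, as an integer. -/
def ex (j : α) (w : FreeGroup α) : ℤ := (expSum j w).toAdd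

@[simp] theorem ex_one (j : α) : ex j 1 = 0 := by simp [ex]
@[simp] theorem ex_mul (j : α) (v w : FreeGroup α) : ex j (v * w) = ex j v + ex j w := by simp [ex]
@[simp] theorem ex_inv (j : α) (v : FreeGroup α) : ex j v⁻¹ = - ex j v := by simp [ex]
@[simp] theorem ex_zpow (j : α) (v : FreeGroup α) (k : ℤ) : ex j (v ^ k) = k * ex j v := by
  simp [ex]
@[simp] theorem ex_of (j i : α) : ex j (of i) = if i = j then 1 else 0 := by simp [ex, expSum]
theorem ex_of_self (j : α) : ex j (of j) = 1 := by simp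

theorem exists_zpow_of_commute_of {w : FreeGroup α} {v : α} (h : Commute w (of v)) :
    ∃ k : ℤ, w = of v ^ k := by
  obtain ⟨z, m, n, hm, hn⟩ := exists_zpow_of_commute h
  have h1 : n * ex v z = 1 := by rw [← ex_zpow, ← hn, ex_of_self]
  rcases Int.eq_one_or_neg_one_of_mul_eq_one h1 with rfl | rfl
  · exact ⟨m, by rw [hm, hn, zpow_one]⟩
  · refine ⟨-m, ?_⟩
    rw [hm, hn]; simp

end Exponent

section Retract
variable {α : Type*}

open Classical in
/-- The retraction killing the generators outside `A`. -/
noncomputable def retract (A : Set α) : FreeGroup α →* FreeGroup α :=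
  lift fun i => if i ∈ A then of i else 1

theorem retract_of_mem {A : Set α} {i : α} (h : i ∈ A) : retract A (of i) = of i := by
  simp [retract, h]

theorem retract_of_notMem {A : Set α} {i : α} (h : i ∉ A) : retract A (of i) = 1 := by
  simp [retract, h]

theorem retract_retract (A B : Set α) (w : FreeGroup α) :
    retract A (retract B w) = retract (A ∩ B) w := by
  have : (retract A).comp (retract B) = retract (A ∩ B) := by
    ext i
    by_cases hB : i ∈ B <;> by_cases hA : i ∈ A <;> simp [retract, hA, hB]
  exact DFunLike.congr_fun this w

theorem exists_finset_retract (w : FreeGroup α) :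
    ∃ T : Finset α, ∀ A : Set α, (T : Set α) ⊆ A → retract A w = w := by
  classical
  induction w using FreeGroup.induction_on with
  | C1 => exact ⟨∅, fun A _ => map_one _⟩
  | of c => exact ⟨{c}, fun A h => retract_of_mem (h (by simp))⟩
  | inv_of c hc => 
    obtain ⟨T, hT⟩ := hc
    exact ⟨T, fun A h => by rw [map_inv, hT A h]⟩
  | mul u v hu hv =>
    obtain ⟨T, hT⟩ := hu
    obtain ⟨S, hS⟩ := hv
    refine ⟨T ∪ S, fun A h => ?_⟩
    rw [Finset.coe_union, Set.union_subset_iff] at h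
    rw [map_mul, hT A h.1, hS A h.2]

theorem retract_empty (w : FreeGroup α) : retract (∅ : Set α) w = 1 := by
  have : retract (∅ : Set α) = 1 := by ext i; simp [retract]
  rw [this]; rfl

theorem retract_singleton (v : α) (w : FreeGroup α) : ∃ k : ℤ, retract {v} w = of v ^ k := by
  have : retract {v} w ∈ Subgroup.zpowers (of v) := by
    induction w using FreeGroup.induction_on with
    | C1 => rw [map_one]; exact one_mem _
    | of c => 
      by_cases h : c = v
      · subst h; rw [retract_of_mem (Set.mem_singleton c)]; exact Subgroup.mem_zpowers _
      · rw [retract_of_notMem (by simpa using h)]; exact one_mem _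
    | inv_of c hc => rw [map_inv]; exact inv_mem hc
    | mul u v hu hv => rw [map_mul]; exact mul_mem hu hv
  obtain ⟨k, hk⟩ := this
  exact ⟨k, hk.symm⟩

end Retract

/-- `a` sends each generator `i` to a conjugate of the generator `s i`. -/
def Compat {α : Type*} (a : MulAut (FreeGroup α)) (s : Equiv.Perm α) : Prop :=
  ∀ i, ∃ c, a (of i) = c * of (s i) * c⁻¹

section Compat
variable {α : Type*}

theorem Compat.one : Compat (1 : MulAut (FreeGroup α)) 1 := fun i => ⟨1, by simp⟩

theorem Compat.mul {a b : MulAut (FreeGroup α)} {s t : Equiv.Perm α} (ha : Compat a s)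
    (hb : Compat b t) : Compat (a * b) (s * t) := by
  intro i
  obtain ⟨c, hc⟩ := hb i
  obtain ⟨d, hd⟩ := ha (t i)
  refine ⟨a c * d, ?_⟩
  rw [MulAut.mul_apply, hc, map_mul, map_mul, hd, map_inv, Equiv.Perm.mul_apply]
  group

theorem Compat.inv {a : MulAut (FreeGroup α)} {s : Equiv.Perm α} (ha : Compat a s) :
    Compat a⁻¹ s⁻¹ := by
  intro i
  obtain ⟨c, hc⟩ := ha (s⁻¹ i)
  refine ⟨(a⁻¹ c)⁻¹, ?_⟩
  apply a.injective
  rw [MulAut.apply_inv_self, map_mul, map_mul, map_inv, map_inv, hc, MulAut.apply_inv_self]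
  simp [mul_assoc]

theorem Compat.retract {a : MulAut (FreeGroup α)} {s : Equiv.Perm α} (ha : Compat a s)
    (A B : Set α) (h : ∀ i, s i ∈ B → i ∈ A) (w : FreeGroup α) :
    retract B (a (retract A w)) = retract B (a w) := by
  have : ((FG.retract B).comp a.toMonoidHom).comp (FG.retract A) =
      (FG.retract B).comp a.toMonoidHom := by
    ext i
    by_cases hi : i ∈ A
    · simp [retract_of_mem hi]
    · obtain ⟨c, hc⟩ := ha i
      have : s i ∉ B := fun h' => hi (h i h')
      simp [retract_of_notMem hi, hc, retract_of_notMem this]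
  exact DFunLike.congr_fun this w

open Pointwise in
theorem exists_smul_disjoint {G X : Type*} [Group G] [MulAction G X] (W : Finset X)
    (h : ∀ x ∈ W, (MulAction.orbit G x).Infinite) : ∃ g : G, ∀ x ∈ W, g • x ∉ W := by
  classical
  by_contra! hcon
  let s : Finset (X × X) := (W ×ˢ W).filter fun p => ∃ g : G, g • p.1 = p.2
  let f : X × X → G := fun p => if h : ∃ g : G, g • p.1 = p.2 then h.choose else 1
  have hf : ∀ p ∈ s, f p • p.1 = p.2 := by
    intro p hp
    have := (Finset.mem_filter.1 hp).2
    simp only [f, dif_pos this]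
    exact this.choose_spec
  have hcov : ⋃ p ∈ s, f p • (MulAction.stabilizer G p.1 : Set G) = Set.univ := by
    rw [Set.eq_univ_iff_forall]
    intro g
    obtain ⟨x, hx, hgx⟩ := hcon g
    have hp : (x, g • x) ∈ s := by
      simp only [s, Finset.mem_filter, Finset.mem_product]
      exact ⟨⟨hx, hgx⟩, g, rfl⟩
    refine Set.mem_biUnion hp ?_
    rw [Set.mem_smul_set_iff_inv_smul_mem]
    change (f (x, g • x))⁻¹ * g ∈ MulAction.stabilizer G x
    rw [MulAction.mem_stabilizer_iff, mul_smul, inv_smul_eq_iff]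
    exact (hf _ hp).symm
  obtain ⟨p, hp, hfin⟩ := Subgroup.exists_finiteIndex_of_leftCoset_cover hcov
  refine h p.1 (Finset.mem_product.1 (Finset.mem_filter.1 hp).1).1 ?_
  have : Finite (G ⧸ MulAction.stabilizer G p.1) := inferInstance
  have : Finite (MulAction.orbit G p.1) :=
    Finite.of_equiv _ (MulAction.orbitEquivQuotientStabilizer G p.1).symm
  exact Set.toFinite _

/-- An element of a free group fixed by enough automorphisms permuting the conjugacy classes of
the generators is conjugate to a power of a generator. -/
theorem eq_conj_zpow_of_fixed (w : FreeGroup α)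
    (h : ∀ i j, i ≠ j → ∃ a s, Compat a s ∧ a w = w ∧
      ¬ (i ∈ Function.periodicPts s ∧ j ∈ Function.periodicPts s)) :
    w = 1 ∨ ∃ (v : α) (c : FreeGroup α) (k : ℤ),
      (∀ a s, Compat a s → a w = w → s v = v) ∧ w = c * of v ^ k * c⁻¹ := by
  classical
  let L : Subgroup (MulAut (FreeGroup α) × Equiv.Perm α) :=
    { carrier := {p | Compat p.1 p.2 ∧ p.1 w = w}
      one_mem' := ⟨Compat.one, rfl⟩
      mul_mem' := fun {a b} ha hb => ⟨ha.1.mul hb.1, by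
        rw [Prod.fst_mul, MulAut.mul_apply, hb.2, ha.2]⟩
      inv_mem' := fun {a} ha => ⟨ha.1.inv, by
        rw [Prod.fst_inv, MulAut.inv_apply, MulEquiv.symm_apply_eq]; exact ha.2.symm⟩ }
  let _ : MulAction L α := MulAction.compHom α ((MonoidHom.snd _ _).comp L.subtype)
  have smul_def : ∀ (g : L) (x : α), g • x = g.1.2 x := fun g x => rfl
  have hper : ∀ i : α, (MulAction.orbit L i).Finite → ∀ g : L,
      i ∈ Function.periodicPts g.1.2 := by
    intro i hi g
    have hmaps : ∀ n : ℕ, ((g.1.2)^[n]) i ∈ MulAction.orbit L i := by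
      intro n
      refine ⟨g ^ n, ?_⟩
      change (g ^ n) • i = _
      rw [smul_def, ← Equiv.Perm.coe_pow]; rfl
    have hnot := Set.not_injOn_infinite_finite_image (s := Set.univ)
      (f := fun n : ℕ => ((g.1.2)^[n]) i) Set.infinite_univ
      (hi.subset (by rintro _ ⟨n, -, rfl⟩; exact hmaps n))
    rw [Set.injOn_univ] at hnot
    obtain ⟨m, n, hmn, hne⟩ : ∃ m n, ((g.1.2)^[m]) i = ((g.1.2)^[n]) i ∧ m < n := by
      simp only [Function.Injective, not_forall] at hnot
      obtain ⟨m, n, h1, h2⟩ := hnot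
      rcases lt_or_gt_of_ne h2 with h3 | h3
      · exact ⟨m, n, h1, h3⟩
      · exact ⟨n, m, h1.symm, h3⟩
    refine ⟨n - m, by omega, ?_⟩
    have h1 : ((g.1.2)^[m]) (((g.1.2)^[n - m]) i) = ((g.1.2)^[m]) i := by
      rw [← Function.iterate_add_apply, Nat.add_sub_cancel' hne.le, hmn]
    exact (g.1.2.injective.iterate m) h1
  let V : Set α := {i | (MulAction.orbit L i).Finite}
  have hVsub : V.Subsingleton := by
    intro i hi j hj
    by_contra hij
    obtain ⟨a, s, h1, h2, h3⟩ := h i j hij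
    exact h3 ⟨hper i hi ⟨(a, s), h1, h2⟩, hper j hj ⟨(a, s), h1, h2⟩⟩
  have hVfix : ∀ v ∈ V, ∀ a s, Compat a s → a w = w → s v = v := by
    intro v hv a s h1 h2
    refine hVsub ?_ hv
    let g : L := ⟨(a, s), h1, h2⟩
    change (MulAction.orbit L (g • v)).Finite
    rw [MulAction.orbit_smul]; exact hv
  obtain ⟨T, hT⟩ := exists_finset_retract w
  let W : Finset α := T.filter fun i => i ∉ V
  obtain ⟨g, hg⟩ := exists_smul_disjoint (G := L) W (fun x hx => (Finset.mem_filter.1 hx).2)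
  have hTW : (T : Set α) ⊆ V ∪ W := by
    intro i hi
    by_cases hV : i ∈ V
    · exact Or.inl hV
    · exact Or.inr (by simp only [W, Finset.coe_filter, Set.mem_ofPred_eq]; exact ⟨hi, hV⟩)
  have hw : FG.retract (V ∪ W) w = w := hT _ hTW
  let B : Set α := V ∪ (g.1.2) '' W
  have hBV : B ∩ (V ∪ W) = V := by
    ext i
    constructor
    · rintro ⟨h1 | ⟨j, hj, rfl⟩, h2 | h2⟩
      · exact h1
      · exact h1
      · exact h2
      · exact absurd h2 (hg j hj)
    · intro hi; exact ⟨Or.inl hi, Or.inl hi⟩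
  have hB : FG.retract B w = FG.retract V w := by
    conv_lhs => rw [← hw, retract_retract, hBV]
  have hginv : (g.1.1)⁻¹ w = w := (L.inv_mem g.2).2
  have hkey : FG.retract (V ∪ W) ((g.1.1)⁻¹ (FG.retract V w)) = w := by
    rw [← hB, g.2.1.inv.retract B (V ∪ W), hginv, hw]
    intro i hi
    rcases hi with hi | hi
    · left
      have := hVfix _ hi g.1.1 g.1.2 g.2.1 g.2.2
      rw [Equiv.Perm.inv_def, Equiv.apply_symm_apply] at this
      rw [this]; exact hi
    · right
      exact ⟨_, hi, by simp⟩
  rcases hVsub.eq_empty_or_singleton with hV | ⟨v, hV⟩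
  · left
    rw [← hkey, hV, retract_empty, map_one, map_one]
  · right
    have hvV : v ∈ V := by rw [hV]; rfl
    obtain ⟨k, hk⟩ := retract_singleton v w
    obtain ⟨c, hc⟩ := g.2.1.inv v
    have h3 : (g.1.2)⁻¹ v = v := hVfix v hvV _ _ g.2.1.inv hginv
    rw [h3] at hc
    refine ⟨v, FG.retract (V ∪ W) c, k, hVfix v hvV, ?_⟩
    conv_lhs => rw [← hkey, hV, hk, map_zpow, hc, conj_zpow, ← hV]
    rw [map_mul, map_mul, map_zpow, map_inv, retract_of_mem (show v ∈ V ∪ (W : Set α) from Or.inl hvV)]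

theorem eq_one_of_fixed (w : FreeGroup α) (a : MulAut (FreeGroup α)) (s : Equiv.Perm α)
    (h : Compat a s) (haw : a w = w) (hs : ∀ i, i ∉ Function.periodicPts s) : w = 1 := by
  rcases eq_conj_zpow_of_fixed w (fun i j _ => ⟨a, s, h, haw, fun h' => hs i h'.1⟩) with
    h1 | ⟨v, c, k, h1, -⟩
  · exact h1
  · exact absurd (⟨1, one_pos, h1 a s h haw⟩ : v ∈ Function.periodicPts s) (hs v)

end Compat

end FG

end

section

namespace FG

open FreeGroup (of lift)

section Kernel
variable {X : Type*}

/-- The projection killing the generator `none`. -/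
def pr : FreeGroup (Option X) →* FreeGroup X := lift fun o => o.elim 1 of

/-- The section of `pr`. -/
def em : FreeGroup X →* FreeGroup (Option X) := lift fun x => of (some x)

@[simp] theorem pr_none : pr (of (none : Option X)) = 1 := by simp [pr]
@[simp] theorem pr_some (x : X) : pr (of (some x)) = of x := by simp [pr]
@[simp] theorem em_of (x : X) : em (of x) = of (some x) := by simp [em]
@[simp] theorem pr_em (f : FreeGroup X) : pr (em f) = f := by
  have : (pr (X := X)).comp em = MonoidHom.id _ := by ext; simp
  exact DFunLike.congr_fun this f

/-- The free basis of the kernel of `pr`, consisting of the conjugates of `none`. -/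
def kerMap : FreeGroup (FreeGroup X) →* FreeGroup (Option X) :=
  lift fun f => em f * of none * (em f)⁻¹

@[simp] theorem kerMap_of (f : FreeGroup X) : kerMap (of f) = em f * of none * (em f)⁻¹ := by
  simp [kerMap]

@[simp] theorem pr_kerMap (u : FreeGroup (FreeGroup X)) : pr (kerMap u) = 1 := by
  have : (pr (X := X)).comp kerMap = 1 := by ext; simp
  exact DFunLike.congr_fun this u

/-- Left translation on the basis of the kernel. -/
def translate : FreeGroup X →* MulAut (FreeGroup (FreeGroup X)) where
  toFun g := FreeGroup.freeGroupCongr (Equiv.mulLeft g)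
  map_one' := by
    ext1 x
    simp [FreeGroup.freeGroupCongr, Equiv.mulLeft]
  map_mul' g h := by
    ext1 x
    simp only [FreeGroup.freeGroupCongr, MulEquiv.coe_mk, Equiv.coe_fn_mk, MulAut.mul_apply,
      FreeGroup.map.comp]
    congr 2
    ext y
    simp

@[simp] theorem translate_of (g f : FreeGroup X) : translate g (of f) = of (g * f) := by
  simp [translate]

/-- The comparison of the free group with a semidirect product. -/
def toSemi : FreeGroup (Option X) →* FreeGroup (FreeGroup X) ⋊[translate] FreeGroup X :=
  lift fun o => o.elim (SemidirectProduct.inl (of 1)) fun x => SemidirectProduct.inr (of x)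

theorem toSemi_em (f : FreeGroup X) : toSemi (em f) = SemidirectProduct.inr f := by
  have : (toSemi (X := X)).comp em = SemidirectProduct.inr :=
    FreeGroup.ext_hom _ _ fun x => by simp [toSemi]
  exact DFunLike.congr_fun this f

theorem toSemi_kerMap (u : FreeGroup (FreeGroup X)) :
    toSemi (kerMap u) = SemidirectProduct.inl u := by
  have : (toSemi (X := X)).comp kerMap = SemidirectProduct.inl := by
    apply FreeGroup.ext_hom
    intro f
    rw [MonoidHom.comp_apply, kerMap_of, map_mul, map_mul, map_inv, toSemi_em]
    have : toSemi (of (none : Option X)) = SemidirectProduct.inl (of 1) := by simp [toSemi]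
    rw [this, ← map_inv, ← SemidirectProduct.inl_aut, translate_of, mul_one]
  exact DFunLike.congr_fun this u

theorem kerMap_injective : Function.Injective (kerMap (X := X)) := by
  intro u v h
  have := congrArg toSemi h
  rw [toSemi_kerMap, toSemi_kerMap] at this
  exact SemidirectProduct.inl_injective this

theorem em_mul_kerMap (f : FreeGroup X) (u : FreeGroup (FreeGroup X)) :
    em f * kerMap u = kerMap (translate f u) * em f := by
  have : (MulAut.conj (em f)).toMonoidHom.comp kerMap =
      kerMap.comp (translate f).toMonoidHom := by
    apply FreeGroup.ext_hom
    intro g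
    simp [mul_assoc]
  have h := DFunLike.congr_fun this u
  rw [← mul_inv_eq_iff_eq_mul]
  exact h

theorem exists_kerMap_mul_em (w : FreeGroup (Option X)) : ∃ u, w = kerMap u * em (pr w) := by
  induction w using FreeGroup.induction_on with
  | C1 => exact ⟨1, by simp⟩
  | of o =>
    cases o with
    | none => exact ⟨of 1, by simp⟩
    | some x => exact ⟨1, by simp⟩
  | inv_of o ho =>
    obtain ⟨u, hu⟩ := ho
    refine ⟨translate (pr (of o))⁻¹ u⁻¹, ?_⟩
    rw [map_inv pr, ← em_mul_kerMap]
    conv_lhs => rw [hu]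
    simp
  | mul v w hv hw =>
    obtain ⟨u, hu⟩ := hv
    obtain ⟨t, ht⟩ := hw
    refine ⟨u * translate (pr v) t, ?_⟩
    conv_lhs => rw [hu, ht]
    rw [mul_assoc, ← mul_assoc (em (pr v)), em_mul_kerMap]
    simp [mul_assoc]

theorem exists_kerMap_of_pr_eq_one {w : FreeGroup (Option X)} (h : pr w = 1) :
    ∃ u, kerMap u = w := by
  obtain ⟨u, hu⟩ := exists_kerMap_mul_em w
  rw [h, map_one, mul_one] at hu
  exact ⟨u, hu.symm⟩

end Kernel

/-- `a` conjugates each generator `i` by `c i`. -/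
def IsBC {I : Type*} (a : MulAut (FreeGroup I)) (c : I → FreeGroup I) : Prop :=
  ∀ i, a (of i) = c i * of i * (c i)⁻¹

section BasisConj
variable {I : Type*} {a : MulAut (FreeGroup I)} {c : I → FreeGroup I}

theorem IsBC.inv (h : IsBC a c) : IsBC a⁻¹ fun i => (a⁻¹ (c i))⁻¹ := by
  intro i
  apply a.injective
  rw [MulAut.apply_inv_self, map_mul, map_mul, map_inv, map_inv, MulAut.apply_inv_self, h]
  simp [mul_assoc]

theorem IsBC.mul {b : MulAut (FreeGroup I)} {d : I → FreeGroup I} (h : IsBC a c) (h' : IsBC b d) :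
    IsBC (a * b) fun i => a (d i) * c i := by
  intro i
  rw [MulAut.mul_apply, h', map_mul, map_mul, h, map_inv]
  group

variable [DecidableEq I]

theorem IsBC.ex_apply (h : IsBC a c) (j : I) (w : FreeGroup I) : ex j (a w) = ex j w := by
  have : (expSum j).comp a.toMonoidHom = expSum j := by
    ext i
    have : ex j (a (of i)) = ex j (of i) := by rw [h]; simp only [ex_mul, ex_inv]; ring
    exact this
  exact congrArg Multiplicative.toAdd (DFunLike.congr_fun this w)

theorem IsBC.pow (h : IsBC a c) (n : ℕ) : ∃ d, IsBC (a ^ n) d ∧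
    ∀ i j, ex j (d i) = n * ex j (c i) := by
  induction n with
  | zero => exact ⟨fun _ => 1, fun i => by simp, fun i j => by simp⟩
  | succ n ih =>
    obtain ⟨d, hd, hd'⟩ := ih
    refine ⟨_, pow_succ' a n ▸ h.mul hd, fun i j => ?_⟩
    rw [ex_mul, h.ex_apply, hd']; push_cast; ring

end BasisConj

section Heisenberg

/-- The integral Heisenberg group. -/
@[ext] structure Heis where
  x : ℤ
  y : ℤ
  z : ℤ

namespace Heis

instance : Mul Heis := ⟨fun p q => ⟨p.x + q.x, p.y + q.y, p.z + q.z + p.x * q.y⟩⟩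
instance : One Heis := ⟨⟨0, 0, 0⟩⟩
instance : Inv Heis := ⟨fun p => ⟨-p.x, -p.y, -p.z + p.x * p.y⟩⟩

@[simp] theorem mul_x (p q : Heis) : (p * q).x = p.x + q.x := rfl
@[simp] theorem mul_y (p q : Heis) : (p * q).y = p.y + q.y := rfl
@[simp] theorem mul_z (p q : Heis) : (p * q).z = p.z + q.z + p.x * q.y := rfl
@[simp] theorem one_x : (1 : Heis).x = 0 := rfl
@[simp] theorem one_y : (1 : Heis).y = 0 := rfl
@[simp] theorem one_z : (1 : Heis).z = 0 := rfl
@[simp] theorem inv_x (p : Heis) : p⁻¹.x = -p.x := rfl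
@[simp] theorem inv_y (p : Heis) : p⁻¹.y = -p.y := rfl
@[simp] theorem inv_z (p : Heis) : p⁻¹.z = -p.z + p.x * p.y := rfl

instance : Group Heis :=
  Group.ofLeftAxioms (fun p q r => by ext <;> simp <;> ring) (fun p => by ext <;> simp)
    (fun p => by ext <;> simp)

end Heis

variable {I : Type*} [DecidableEq I]

/-- The Heisenberg quotient of a free group attached to two generators. -/
def heis (j k : I) : FreeGroup I →* Heis :=
  lift fun i => ⟨if i = j then 1 else 0, if i = k then 1 else 0, 0⟩

@[simp] theorem heis_of (j k i : I) : heis j k (of i) =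
    ⟨if i = j then 1 else 0, if i = k then 1 else 0, 0⟩ := by simp [heis]

@[simp] theorem heis_x (j k : I) (w : FreeGroup I) : (heis j k w).x = ex j w := by
  induction w using FreeGroup.induction_on with
  | C1 => simp
  | of i => simp
  | inv_of i h => simp
  | mul u v hu hv => simp [hu, hv]

@[simp] theorem heis_y (j k : I) (w : FreeGroup I) : (heis j k w).y = ex k w := by
  induction w using FreeGroup.induction_on with
  | C1 => simp
  | of i => simp
  | inv_of i h => simp
  | mul u v hu hv => simp [hu, hv]

theorem IsBC.heis_apply {a : MulAut (FreeGroup I)} {c : I → FreeGroup I} (h : IsBC a c) {j k : I}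
    (hjk : j ≠ k) (w : FreeGroup I) :
    heis j k (a w) = heis j k w * ⟨0, 0, ex k w * ex j (c k) - ex j w * ex k (c j)⟩ := by
  induction w using FreeGroup.induction_on with
  | C1 => ext <;> simp
  | of i =>
    rw [h i]
    by_cases hj : i = j
    · subst hj; ext <;> simp [hjk]; try ring
    · by_cases hk : i = k
      · subst hk; ext <;> simp [hj]; try ring
      · ext <;> simp [hj, hk]; try ring
  | inv_of i hi =>
    rw [map_inv, map_inv, hi]
    ext <;> simp; ring
  | mul u v hu hv =>
    rw [map_mul, map_mul, hu, hv]
    ext <;> simp; ring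

theorem IsBC.ex_mul_eq_of_fixed {a : MulAut (FreeGroup I)} {c : I → FreeGroup I} (h : IsBC a c)
    {j k : I} (hjk : j ≠ k) {w : FreeGroup I} (hw : a w = w) :
    ex k w * ex j (c k) = ex j w * ex k (c j) := by
  have := congrArg Heis.z (h.heis_apply hjk w)
  rw [hw] at this
  simp at this
  linarith

end Heisenberg

section Descent
variable {X : Type*} {a : MulAut (FreeGroup (Option X))} {c : Option X → FreeGroup (Option X)}

theorem IsBC.pr_em_pr (h : IsBC a c) (w : FreeGroup (Option X)) : pr (a (em (pr w))) = pr (a w) := by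
  have : (((pr (X := X)).comp a.toMonoidHom).comp em).comp pr = pr.comp a.toMonoidHom := by
    ext o
    cases o with
    | none => simp [h none]
    | some x => simp
  exact DFunLike.congr_fun this w

theorem IsBC.descend (h : IsBC a c) : ∃ b : MulAut (FreeGroup X), (∀ w, pr (a w) = b (pr w)) ∧
    IsBC b fun x => pr (c (some x)) := by
  refine ⟨MulEquiv.mk' ⟨fun f => pr (a (em f)), fun f => pr (a⁻¹ (em f)), fun f => ?_, fun f => ?_⟩
    (fun f g => by simp), fun w => (h.pr_em_pr w).symm, fun x => ?_⟩
  · change pr (a⁻¹ (em (pr (a (em f))))) = f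
    rw [h.inv.pr_em_pr, MulAut.inv_apply_self, pr_em]
  · change pr (a (em (pr (a⁻¹ (em f))))) = f
    rw [h.pr_em_pr, MulAut.apply_inv_self, pr_em]
  · change pr (a (em (of x))) = _
    rw [em_of, h]; simp

/-- The action of a basis-conjugating automorphism on the kernel of `pr`. -/
theorem exists_ker_lift {c₀ : FreeGroup (Option X)} {b : MulAut (FreeGroup X)}
    (h : a (of none) = c₀ * of none * c₀⁻¹) (hb : ∀ w, pr (a w) = b (pr w)) :
    ∃ (a' : MulAut (FreeGroup (FreeGroup X))) (s : Equiv.Perm (FreeGroup X)), Compat a' s ∧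
      (∀ u, kerMap (a' u) = a (kerMap u)) ∧ ∀ f, s f = b f * pr c₀ := by
  have h1 : ∀ f : FreeGroup X, ∃ d, a (em f * of none * (em f)⁻¹) =
      kerMap (d * of (b f * pr c₀) * d⁻¹) := by
    intro f
    obtain ⟨d, hd⟩ := exists_kerMap_mul_em (a (em f) * c₀)
    rw [map_mul, hb, pr_em] at hd
    refine ⟨d, ?_⟩
    rw [map_mul, map_mul, map_inv, h]
    calc _ = (a (em f) * c₀) * of none * (a (em f) * c₀)⁻¹ := by group
      _ = _ := by rw [hd]; simp [mul_assoc]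
  choose d hd using h1
  let φ : FreeGroup (FreeGroup X) →* FreeGroup (FreeGroup X) :=
    lift fun f => d f * of (b f * pr c₀) * (d f)⁻¹
  have hφ : ∀ u, kerMap (φ u) = a (kerMap u) := by
    intro u
    have : kerMap.comp φ = a.toMonoidHom.comp kerMap := by
      apply FreeGroup.ext_hom
      intro f
      simp only [φ, MonoidHom.comp_apply, FreeGroup.lift_apply_of, kerMap_of]
      rw [← hd]; rfl
    exact DFunLike.congr_fun this u
  have hbij : Function.Bijective φ := by
    constructor
    · intro u v huv
      apply kerMap_injective
      apply a.injective
      rw [← hφ, ← hφ, huv]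
    · intro u
      obtain ⟨v, hv⟩ := exists_kerMap_of_pr_eq_one (w := a⁻¹ (kerMap u)) (by
        apply b.injective
        rw [← hb, MulAut.apply_inv_self, pr_kerMap, map_one])
      refine ⟨v, kerMap_injective ?_⟩
      rw [hφ, hv, MulAut.apply_inv_self]
  refine ⟨MulEquiv.ofBijective φ hbij, b.toEquiv.trans (Equiv.mulRight (pr c₀)), fun f => ⟨d f, ?_⟩,
    hφ, fun f => rfl⟩
  exact FreeGroup.lift_apply_of

variable [DecidableEq X]

@[simp] theorem ex_pr (x : X) (w : FreeGroup (Option X)) : ex x (pr w) = ex (some x) w := by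
  induction w using FreeGroup.induction_on with
  | C1 => simp
  | of o => cases o <;> simp
  | inv_of o h => simpa using h
  | mul u v hu hv => simp [hu, hv]

end Descent

/-- A homologically trivial element fixed by enough basis-conjugating automorphisms is trivial. -/
theorem eq_one_of_isBC_fixed (I : Type*) [Finite I] : ∀ [DecidableEq I] (w : FreeGroup I),
    (∀ j, ex j w = 0) →
    (∀ i j, i ≠ j → ∃ a c, IsBC a c ∧ a w = w ∧ ex j (c i) ≠ 0) → w = 1 := by
  induction I using Finite.induction_empty_option with
  | of_equiv e ih =>
    rename_i α β
    intro _ w hw h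
    classical
    let E := FreeGroup.freeGroupCongr e
    have hE : ∀ j v, ex j (E.symm v) = ex (e j) v := by
      intro j v
      induction v using FreeGroup.induction_on with
      | C1 => simp
      | of o => simp [E, FreeGroup.freeGroupCongr, Equiv.symm_apply_eq]
      | inv_of o h => rw [map_inv, ex_inv, h, ex_inv]
      | mul u v hu hv => simp [hu, hv]
    have hEof : ∀ i, E.symm (of (e i)) = of i := by
      intro i; simp [E, FreeGroup.freeGroupCongr]
    have hEof' : ∀ i, E (of i) = of (e i) := by
      intro i; simp [E, FreeGroup.freeGroupCongr]
    apply E.symm.injective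
    rw [map_one]
    refine ih (E.symm w) (fun j => by rw [hE, hw]) (fun i j hij => ?_)
    obtain ⟨a, c, h1, h2, h3⟩ := h (e i) (e j) (e.injective.ne hij)
    refine ⟨(E.trans a).trans E.symm, fun i => E.symm (c (e i)), fun i => ?_, ?_, ?_⟩
    · change E.symm (a (E (of i))) = _
      rw [hEof', h1, map_mul, map_mul, map_inv, hEof]
    · change E.symm (a (E (E.symm w))) = _
      rw [MulEquiv.apply_symm_apply, h2]
    · rw [hE]; exact h3
  | h_empty =>
    intro _ w _ _
    exact Subsingleton.elim _ _
  | h_option ih =>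
    rename_i X _
    intro _ w hw h
    classical
    have hpr : pr w = 1 := by
      refine ih (pr w) (fun j => ?_) (fun i j hij => ?_)
      · rw [ex_pr]; convert hw (some j)
      · obtain ⟨a, c, h1, h2, h3⟩ := h (some i) (some j) (by simpa using hij)
        obtain ⟨b, hb, hb'⟩ := h1.descend
        refine ⟨b, _, hb', by rw [← hb, h2], ?_⟩
        rw [ex_pr]; convert h3
    rcases isEmpty_or_nonempty X with hX | ⟨⟨x⟩⟩
    · obtain ⟨T, hT⟩ := exists_finset_retract w
      obtain ⟨k, hk⟩ := retract_singleton none w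
      rw [hT] at hk
      · have := hw none
        rw [hk] at this
        simp at this
        rw [hk, this, zpow_zero]
      · intro o _
        cases o with
        | none => rfl
        | some x => exact isEmptyElim x
    · obtain ⟨u, rfl⟩ := exists_kerMap_of_pr_eq_one hpr
      obtain ⟨a, c, h1, h2, h3⟩ := h none (some x) (by simp)
      obtain ⟨b, hb, hb'⟩ := h1.descend
      obtain ⟨a', s, hs, ha', hs'⟩ := exists_ker_lift (h1 none) hb
      rw [eq_one_of_fixed u a' s hs (kerMap_injective (by rw [ha', h2])), map_one]
      rintro f ⟨n, hn, hf⟩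
      have key : ∀ n : ℕ, ex x (s^[n] f) = ex x f + n * ex x (pr (c none)) := by
        intro n
        induction n with
        | zero => simp
        | succ n ihn =>
          rw [Function.iterate_succ_apply', hs', ex_mul, hb'.ex_apply, ihn]; push_cast; ring
      have := key n
      rw [hf.eq] at this
      have h4 : ex x (pr (c none)) ≠ 0 := by rw [ex_pr]; convert h3
      have h5 : (n : ℤ) ≠ 0 := by exact_mod_cast hn.ne'
      have h6 := mul_ne_zero h5 h4
      omega

/-- A criterion for an element to be conjugate to a power of the generator `none`. -/
theorem eq_conj_zpow_none {X : Type*} [Finite X] [DecidableEq X] (w : FreeGroup (Option X))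
    (hw : ∀ x : X, ex (some x) w = 0)
    (h1 : ∀ i j : X, i ≠ j → ∃ a c, IsBC a c ∧ a w = w ∧
      ex (some i) (c (some j)) = ex (some j) (c (some i)) ∧ ex (some j) (c (some i)) ≠ 0)
    (h2 : ∃ j k : X, j ≠ k ∧ ∃ a c, IsBC a c ∧ a w = w ∧
      ex (some k) (c (some j)) ≠ ex (some j) (c (some k))) :
    ∃ (d : FreeGroup (Option X)) (k : ℤ), w = d * of none ^ k * d⁻¹ := by
  have hpr : pr w = 1 := by
    refine eq_one_of_isBC_fixed X (pr w) (fun j => by rw [ex_pr]; exact hw j)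
      (fun i j hij => ?_)
    obtain ⟨a, c, h3, h4, h5, h6⟩ := h1 i j hij
    obtain ⟨b, hb, hb'⟩ := h3.descend
    exact ⟨b, _, hb', by rw [← hb, h4], by rw [ex_pr]; exact h6⟩
  obtain ⟨u, rfl⟩ := exists_kerMap_of_pr_eq_one hpr
  have main : ∀ f f' : FreeGroup X, f ≠ f' → ∃ a s, Compat a s ∧ a u = u ∧
      ¬ (f ∈ Function.periodicPts s ∧ f' ∈ Function.periodicPts s) := by
    intro f f' hff'
    by_contra! hcon
    apply hff'
    have step : ∀ a c, IsBC a c → a (kerMap u) = kerMap u → ∃ b d, IsBC b d ∧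
        b (f' * f⁻¹) = f' * f⁻¹ ∧ ∃ n : ℤ, n ≠ 0 ∧
        ∀ i j : X, ex j (d i) = n * ex (some j) (c (some i)) := by
      intro a c h3 h4
      obtain ⟨b, hb, hb'⟩ := h3.descend
      obtain ⟨a', s, hs, ha', hs'⟩ := exists_ker_lift (h3 none) hb
      obtain ⟨⟨n, hn, hf⟩, ⟨n', hn', hf'⟩⟩ :=
        hcon a' s hs (kerMap_injective (by rw [ha', h4]))
      have hit : ∀ n : ℕ, (b ^ n) (f' * f⁻¹) = s^[n] f' * (s^[n] f)⁻¹ := by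
        intro n
        induction n with
        | zero => rfl
        | succ n ih =>
          rw [Function.iterate_succ_apply', Function.iterate_succ_apply', hs', hs', pow_succ',
            MulAut.mul_apply, ih, map_mul, map_inv]
          group
      obtain ⟨d, hd, hd'⟩ := hb'.pow (n * n')
      refine ⟨b ^ (n * n'), d, hd, ?_, (n * n' : ℕ), by positivity, fun i j => by
        rw [hd', ex_pr]⟩
      rw [hit, (hf.mul_const n').eq, (hf'.const_mul n).eq]
    have heq : ∀ i j, i ≠ j → ex i (f' * f⁻¹) = ex j (f' * f⁻¹) := by
      intro i j hij
      obtain ⟨a, c, h3, h4, h5, h6⟩ := h1 i j hij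
      obtain ⟨b, d, hbd, hfix, n, hn, hex⟩ := step a c h3 h4
      have := hbd.ex_mul_eq_of_fixed hij hfix
      rw [hex, hex, h5] at this
      exact (mul_right_cancel₀ (mul_ne_zero hn h6) this).symm
    obtain ⟨j, k, hjk, a, c, h3, h4, h5⟩ := h2
    have hzero : ex j (f' * f⁻¹) = 0 := by
      obtain ⟨b, d, hbd, hfix, n, hn, hex⟩ := step a c h3 h4
      have := hbd.ex_mul_eq_of_fixed hjk hfix
      rw [hex, hex, heq j k hjk] at this
      rw [heq j k hjk]
      by_contra h0
      exact h5 (mul_left_cancel₀ hn (mul_left_cancel₀ h0 this)).symm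
    have : f' * f⁻¹ = 1 := by
      refine eq_one_of_isBC_fixed X _ (fun i => ?_) (fun i j hij => ?_)
      · by_cases hij : i = j
        · rw [hij, hzero]
        · rw [heq i j hij, hzero]
      · obtain ⟨a, c, h3, h4, h5, h6⟩ := h1 i j hij
        obtain ⟨b, d, hbd, hfix, n, hn, hex⟩ := step a c h3 h4
        exact ⟨b, d, hbd, hfix, by rw [hex]; exact mul_ne_zero hn h6⟩
    exact (mul_inv_eq_one.1 this).symm
  rcases eq_conj_zpow_of_fixed u main with rfl | ⟨f, c, k, -, rfl⟩
  · exact ⟨1, 0, by simp⟩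
  · refine ⟨kerMap c * em f, k, ?_⟩
    rw [map_mul, map_mul, map_zpow, kerMap_of, map_inv, conj_zpow]
    group

end FG

end

section

open FreeGroup (of lift)

/-- The braid group with `m` generators (on `m + 1` strands). -/
abbrev BG (m : ℕ) : Type := PresentedGroup (braidRels m)

namespace BG

variable {m : ℕ}

/-- The generators of the braid group, indexed by natural numbers. -/
def S (i : ℕ) : BG m := if h : i < m then PresentedGroup.of ⟨i, h⟩ else 1

theorem S_of_lt {i : ℕ} (h : i < m) : (S i : BG m) = PresentedGroup.of ⟨i, h⟩ := dif_pos h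

theorem S_of_le {i : ℕ} (h : m ≤ i) : (S i : BG m) = 1 := dif_neg (by omega)

theorem of_eq_S (i : Fin m) : (PresentedGroup.of i : BG m) = S i := by
  rw [S_of_lt i.2]

theorem braid {i : ℕ} (h : i + 1 < m) :
    (S i * S (i + 1) * S i : BG m) = S (i + 1) * S i * S (i + 1) := by
  rw [S_of_lt h, S_of_lt (show i < m by omega)]
  rw [← mul_inv_eq_one]
  exact PresentedGroup.one_of_mem ⟨⟨i, by omega⟩, ⟨i + 1, h⟩, Or.inl ⟨rfl, rfl⟩⟩

theorem comm {i j : ℕ} (h : i + 2 ≤ j) : Commute (S i : BG m) (S j) := by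
  by_cases hj : j < m
  · rw [S_of_lt hj, S_of_lt (show i < m by omega)]
    change _ * _ = _ * _
    rw [← mul_inv_eq_one]
    exact PresentedGroup.one_of_mem ⟨⟨i, by omega⟩, ⟨j, hj⟩, Or.inr ⟨h, rfl⟩⟩
  · rw [S_of_le (not_lt.1 hj)]
    exact Commute.one_right _

variable {H : Type*} [Group H]

/-- The universal property of the braid group. -/
def lift (f : ℕ → H) (h1 : ∀ i, i + 1 < m → f i * f (i + 1) * f i = f (i + 1) * f i * f (i + 1))
    (h2 : ∀ i j, i + 2 ≤ j → j < m → f i * f j = f j * f i) : BG m →* H :=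
  PresentedGroup.toGroup (f := fun i : Fin m => f i) (by
    rintro r ⟨i, j, ⟨hij, rfl⟩ | ⟨hij, rfl⟩⟩
    · have hj := j.2
      simp only [map_mul, map_inv, FreeGroup.lift_apply_of, ← hij]
      rw [mul_inv_eq_one]
      exact h1 i (by omega)
    · simp only [map_mul, map_inv, FreeGroup.lift_apply_of]
      rw [mul_inv_eq_one]
      exact h2 i j hij j.2)

@[simp] theorem lift_S (f : ℕ → H) (h1) (h2) {i : ℕ} (h : i < m) :
    lift (m := m) f h1 h2 (S i) = f i := by
  rw [S_of_lt h]
  exact PresentedGroup.toGroup.of _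

theorem hom_ext {φ ψ : BG m →* H} (h : ∀ i, i < m → φ (S i) = ψ (S i)) : φ = ψ :=
  PresentedGroup.ext fun i => by rw [of_eq_S]; exact h i i.2

theorem mem_of_S {L : Subgroup (BG m)} (h : ∀ i, i < m → S i ∈ L) (b : BG m) : b ∈ L := by
  have : Subgroup.closure (Set.range PresentedGroup.of) ≤ L := by
    rw [Subgroup.closure_le]
    rintro _ ⟨i, rfl⟩
    rw [of_eq_S]; exact h i i.2
  rw [PresentedGroup.closure_range_of] at this
  exact this (Subgroup.mem_top b)

theorem induction {p : BG m → Prop} (h0 : p 1) (h1 : ∀ i, i < m → p (S i))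
    (hmul : ∀ a b, p a → p b → p (a * b)) (hinv : ∀ a, p a → p a⁻¹) (b : BG m) : p b :=
  mem_of_S (L := ⟨⟨⟨{b | p b}, fun {a b} => hmul a b⟩, h0⟩, fun {a} => hinv a⟩) h1 b

end BG

theorem mulAut_ext {I : Type*} {a b : MulAut (FreeGroup I)} (h : ∀ i, a (of i) = b (of i)) : a = b := by
  have : a.toMonoidHom = b.toMonoidHom := by ext i; exact h i
  ext w
  exact DFunLike.congr_fun this w

section Swap
variable {I : Type*} [DecidableEq I]

/-- The automorphism of a free group induced by a half twist. -/
def artinGen (p q : I) : MulAut (FreeGroup I) :=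
  MonoidHom.toMulEquiv
    (lift fun i => if i = p then (of p)⁻¹ * of q * of p else if i = q then of p else of i)
    (lift fun i => if i = p then of q else if i = q then of q * of p * (of q)⁻¹ else of i)
    (by
      ext i
      by_cases hp : i = p <;> by_cases hq : i = q <;> by_cases hpq : p = q <;>
        simp_all [mul_assoc])
    (by
      ext i
      by_cases hp : i = p <;> by_cases hq : i = q <;> by_cases hpq : p = q <;>
        simp_all [mul_assoc])

theorem artinGen_left (p q : I) : artinGen p q (of p) = (of p)⁻¹ * of q * of p := by
  simp [artinGen]

theorem artinGen_right (p q : I) : artinGen p q (of q) = of p := by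
  by_cases h : q = p
  · subst h; simp [artinGen]
  · simp [artinGen, h]

theorem artinGen_other {p q i : I} (hp : i ≠ p) (hq : i ≠ q) : artinGen p q (of i) = of i := by
  simp [artinGen, hp, hq]

theorem artinGen_braid {p q r : I} (hpq : p ≠ q) (hqr : q ≠ r) (hpr : p ≠ r) :
    artinGen p q * artinGen q r * artinGen p q = artinGen q r * artinGen p q * artinGen q r := by
  apply mulAut_ext
  intro i
  simp only [MulAut.mul_apply]
  by_cases hp : i = p
  · subst hp
    simp [artinGen_left, artinGen_right, artinGen_other, hpq, hpr, hpr.symm, hqr.symm, mul_assoc]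
  by_cases hq : i = q
  · subst hq
    simp [artinGen_left, artinGen_right, artinGen_other, hpq, hpr, hpr.symm, hqr.symm, mul_assoc]
  by_cases hr : i = r
  · subst hr
    simp [artinGen_left, artinGen_right, artinGen_other, hpq, hpr, hpr.symm, hqr.symm]
  simp [artinGen_other, hp, hq, hr]

theorem artinGen_comm {p q r s : I} (h1 : p ≠ r) (h2 : p ≠ s) (h3 : q ≠ r) (h4 : q ≠ s) :
    artinGen p q * artinGen r s = artinGen r s * artinGen p q := by
  apply mulAut_ext
  intro i
  simp only [MulAut.mul_apply]
  by_cases hp : i = p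
  · subst hp
    simp [artinGen_left, artinGen_other, h1, h2, h3, h4]
  by_cases hq : i = q
  · subst hq
    simp [artinGen_right, artinGen_other, h1, h2, h3, h4]
  by_cases hr : i = r
  · subst hr
    simp [artinGen_left, artinGen_other, h1.symm, h2.symm, h3.symm, h4.symm]
  by_cases hs : i = s
  · subst hs
    simp [artinGen_right, artinGen_other, h1.symm, h2.symm, h3.symm, h4.symm]
  simp [artinGen_other, hp, hq, hr, hs]

/-- The contribution of a crossing of the strands `p` and `q` to the pair `(j, k)`. -/
def crossing (p q j k : I) : ℤ := if (j = p ∧ k = q) ∨ (j = q ∧ k = p) then 1 else 0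

/-- The permutation of pairs of strands decorated by integers induced by a half twist. -/
def crossGen (p q : I) : Equiv.Perm (I × I × ℤ) where
  toFun x := (Equiv.swap p q x.1, Equiv.swap p q x.2.1, x.2.2 + crossing p q x.1 x.2.1)
  invFun x := (Equiv.swap p q x.1, Equiv.swap p q x.2.1, x.2.2 - crossing p q x.1 x.2.1)
  left_inv x := by
    have : crossing p q (Equiv.swap p q x.1) (Equiv.swap p q x.2.1) = crossing p q x.1 x.2.1 := by
      simp only [crossing, Equiv.swap_apply_eq_iff, Equiv.swap_apply_left, Equiv.swap_apply_right]
      congr 1; rw [or_comm]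
    simp [this]
  right_inv x := by
    have : crossing p q (Equiv.swap p q x.1) (Equiv.swap p q x.2.1) = crossing p q x.1 x.2.1 := by
      simp only [crossing, Equiv.swap_apply_eq_iff, Equiv.swap_apply_left, Equiv.swap_apply_right]
      congr 1; rw [or_comm]
    simp [this]

theorem crossGen_apply (p q j k : I) (z : ℤ) : crossGen p q (j, k, z) =
    (Equiv.swap p q j, Equiv.swap p q k, z + crossing p q j k) := rfl

theorem swap_braid {p q r : I} (hpq : p ≠ q) (hqr : q ≠ r) (hpr : p ≠ r) :
    Equiv.swap p q * Equiv.swap q r * Equiv.swap p q =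
      Equiv.swap q r * Equiv.swap p q * Equiv.swap q r := by
  ext i
  simp only [Equiv.Perm.mul_apply]
  by_cases hp : i = p
  · subst hp; simp [Equiv.swap_apply_def, hpq, hpr, hpr.symm, hqr.symm]
  by_cases hq : i = q
  · subst hq; simp [Equiv.swap_apply_def, hpq, hpr, hpr.symm, hqr.symm]
  by_cases hr : i = r
  · subst hr; simp [Equiv.swap_apply_def, hpr, hpq, hpr.symm, hqr.symm]
  simp [Equiv.swap_apply_def, hp, hq, hr]

theorem swap_comm' {p q r s : I} (h1 : p ≠ r) (h2 : p ≠ s) (h3 : q ≠ r) (h4 : q ≠ s) :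
    Equiv.swap p q * Equiv.swap r s = Equiv.swap r s * Equiv.swap p q := by
  ext i
  simp only [Equiv.Perm.mul_apply]
  by_cases hp : i = p
  · subst hp; simp [Equiv.swap_apply_def, h1, h2, h3, h4]
  by_cases hq : i = q
  · subst hq; simp [Equiv.swap_apply_def, h1, h2, h3, h4]
  by_cases hr : i = r
  · subst hr; simp [Equiv.swap_apply_def, h1.symm, h2.symm, h3.symm, h4.symm]
  by_cases hs : i = s
  · subst hs; simp [Equiv.swap_apply_def, h1.symm, h2.symm, h3.symm, h4.symm]
  simp [Equiv.swap_apply_def, hp, hq, hr, hs]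

theorem crossGen_braid {p q r : I} (hpq : p ≠ q) (hqr : q ≠ r) (hpr : p ≠ r) :
    crossGen p q * crossGen q r * crossGen p q = crossGen q r * crossGen p q * crossGen q r := by
  refine Equiv.ext fun x => ?_
  obtain ⟨j, k, z⟩ := x
  have h := swap_braid hpq hqr hpr
  simp only [Equiv.Perm.mul_apply, crossGen_apply, Prod.mk.injEq]
  refine ⟨Equiv.ext_iff.1 h j, Equiv.ext_iff.1 h k, ?_⟩
  rw [add_assoc, add_assoc, add_assoc, add_assoc]
  congr 1
  by_cases hp : j = p
  · subst hp
    by_cases hkp : k = j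
    · subst hkp; simp [crossing, Equiv.swap_apply_def, hpq, hpr, hpr.symm, hqr.symm, hpq.symm, hqr]
    by_cases hkq : k = q
    · subst hkq; simp [crossing, Equiv.swap_apply_def, hpq, hpr, hpr.symm, hqr.symm, hpq.symm, hqr]
    by_cases hkr : k = r
    · subst hkr; simp [crossing, Equiv.swap_apply_def, hpq, hpr, hpr.symm, hqr.symm, hpq.symm, hqr]
    simp [crossing, Equiv.swap_apply_def, hpq, hpr, hpr.symm, hqr.symm, hpq.symm, hqr, hkp, hkq, hkr]
  by_cases hq : j = q
  · subst hq
    by_cases hkp : k = p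
    · subst hkp; simp [crossing, Equiv.swap_apply_def, hpq, hpr, hpr.symm, hqr.symm, hpq.symm, hqr]
    by_cases hkq : k = j
    · subst hkq; simp [crossing, Equiv.swap_apply_def, hpq, hpr, hpr.symm, hqr.symm, hpq.symm, hqr]
    by_cases hkr : k = r
    · subst hkr; simp [crossing, Equiv.swap_apply_def, hpq, hpr, hpr.symm, hqr.symm, hpq.symm, hqr]
    simp [crossing, Equiv.swap_apply_def, hpq, hpr, hpr.symm, hqr.symm, hpq.symm, hqr, hkp, hkq, hkr]
  by_cases hr : j = r
  · subst hr
    by_cases hkp : k = p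
    · subst hkp; simp [crossing, Equiv.swap_apply_def, hpq, hpr, hpr.symm, hqr.symm, hpq.symm, hqr]
    by_cases hkq : k = q
    · subst hkq; simp [crossing, Equiv.swap_apply_def, hpq, hpr, hpr.symm, hqr.symm, hpq.symm, hqr]
    by_cases hkr : k = j
    · subst hkr; simp [crossing, Equiv.swap_apply_def, hpq, hpr, hpr.symm, hqr.symm, hpq.symm, hqr]
    simp [crossing, Equiv.swap_apply_def, hpq, hpr, hpr.symm, hqr.symm, hpq.symm, hqr, hkp, hkq, hkr]
  simp [crossing, Equiv.swap_apply_def, hp, hq, hr]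

theorem crossing_swap {p q r s : I} (h1 : p ≠ r) (h2 : p ≠ s) (h3 : q ≠ r) (h4 : q ≠ s) (j k : I) :
    crossing r s (Equiv.swap p q j) (Equiv.swap p q k) = crossing r s j k := by
  simp [crossing, Equiv.swap_apply_eq_iff, Equiv.swap_apply_of_ne_of_ne h1.symm h3.symm,
    Equiv.swap_apply_of_ne_of_ne h2.symm h4.symm]

theorem crossGen_comm {p q r s : I} (h1 : p ≠ r) (h2 : p ≠ s) (h3 : q ≠ r) (h4 : q ≠ s) :
    crossGen p q * crossGen r s = crossGen r s * crossGen p q := by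
  refine Equiv.ext fun x => ?_
  obtain ⟨j, k, z⟩ := x
  have h := swap_comm' h1 h2 h3 h4
  simp only [Equiv.Perm.mul_apply, crossGen_apply, Prod.mk.injEq]
  refine ⟨Equiv.ext_iff.1 h j, Equiv.ext_iff.1 h k, ?_⟩
  rw [crossing_swap h1 h2 h3 h4, crossing_swap h1.symm h3.symm h2.symm h4.symm]
  ring

end Swap

end

section

open FreeGroup (of)

namespace BG

variable {m : ℕ}

/-- The strand with number `i`. -/
def str (i : ℕ) : Fin (m + 1) := Fin.ofNat (m + 1) i

theorem val_str {i : ℕ} (h : i ≤ m) : ((str i : Fin (m + 1)) : ℕ) = i :=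
  Nat.mod_eq_of_lt (by omega)

theorem str_val (i : Fin (m + 1)) : str (i : ℕ) = i := Fin.ext (val_str (by omega))

theorem str_inj {i j : ℕ} (hi : i ≤ m) (hj : j ≤ m) : (str i : Fin (m + 1)) = str j ↔ i = j := by
  rw [Fin.ext_iff, val_str hi, val_str hj]

theorem eq_str {i : ℕ} (hi : i ≤ m) (j : Fin (m + 1)) : j = str i ↔ (j : ℕ) = i := by
  rw [Fin.ext_iff, val_str hi]

theorem ne_str {i : ℕ} (hi : i ≤ m) (j : Fin (m + 1)) : j ≠ str i ↔ (j : ℕ) ≠ i :=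
  (eq_str hi j).not

theorem str_ne {i j : ℕ} (hi : i ≤ m) (hj : j ≤ m) (h : i ≠ j) : (str i : Fin (m + 1)) ≠ str j :=
  (str_inj hi hj).not.2 h

section LiftPairs
variable {H : Type*} [Group H] (g : Fin (m + 1) → Fin (m + 1) → H)

/-- Homomorphisms from the braid group given by a family indexed by pairs of strands. -/
def liftPairs
    (h1 : ∀ p q r, p ≠ q → q ≠ r → p ≠ r → g p q * g q r * g p q = g q r * g p q * g q r)
    (h2 : ∀ p q r s, p ≠ r → p ≠ s → q ≠ r → q ≠ s → g p q * g r s = g r s * g p q) : BG m →* H :=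
  lift (fun i => g (str i) (str (i + 1)))
    (fun i h => h1 _ _ _ (str_ne (by omega) (by omega) (by omega))
      (str_ne (by omega) (by omega) (by omega)) (str_ne (by omega) (by omega) (by omega)))
    (fun i j hij hj => h2 _ _ _ _ (str_ne (by omega) (by omega) (by omega))
      (str_ne (by omega) (by omega) (by omega)) (str_ne (by omega) (by omega) (by omega))
      (str_ne (by omega) (by omega) (by omega)))

@[simp] theorem liftPairs_S (h1 h2) {i : ℕ} (h : i < m) :
    liftPairs g h1 h2 (S i) = g (str i) (str (i + 1)) := lift_S _ _ _ h

end LiftPairs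

/-- The permutation of the strands. -/
def perm : BG m →* Equiv.Perm (Fin (m + 1)) :=
  liftPairs (fun p q => Equiv.swap p q) (fun _ _ _ h1 h2 h3 => swap_braid h1 h2 h3)
    (fun _ _ _ _ h1 h2 h3 h4 => swap_comm' h1 h2 h3 h4)

/-- The Artin action on the free group. -/
def artin : BG m →* MulAut (FreeGroup (Fin (m + 1))) :=
  liftPairs artinGen (fun _ _ _ h1 h2 h3 => artinGen_braid h1 h2 h3)
    (fun _ _ _ _ h1 h2 h3 h4 => artinGen_comm h1 h2 h3 h4)

/-- The action on pairs of strands decorated by integers. -/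
def cross : BG m →* Equiv.Perm (Fin (m + 1) × Fin (m + 1) × ℤ) :=
  liftPairs crossGen (fun _ _ _ h1 h2 h3 => crossGen_braid h1 h2 h3)
    (fun _ _ _ _ h1 h2 h3 h4 => crossGen_comm h1 h2 h3 h4)

theorem perm_S {i : ℕ} (h : i < m) : perm (S i : BG m) = Equiv.swap (str i) (str (i + 1)) :=
  liftPairs_S _ _ _ h
theorem artin_S {i : ℕ} (h : i < m) : artin (S i : BG m) = artinGen (str i) (str (i + 1)) :=
  liftPairs_S _ _ _ h
theorem cross_S {i : ℕ} (h : i < m) : cross (S i : BG m) = crossGen (str i) (str (i + 1)) :=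
  liftPairs_S _ _ _ h

/-- The signed number of crossings of the strands `j` and `k`. -/
def chi (b : BG m) (j k : Fin (m + 1)) : ℤ := (cross b (j, k, 0)).2.2

theorem cross_apply (b : BG m) : ∀ (j k : Fin (m + 1)) (z : ℤ),
    cross b (j, k, z) = (perm b j, perm b k, z + chi b j k) := by
  have key : ∃ f : Fin (m + 1) → Fin (m + 1) → ℤ, ∀ (j k : Fin (m + 1)) (z : ℤ),
      cross b (j, k, z) = (perm b j, perm b k, z + f j k) := by
    induction b using induction with
    | h0 => exact ⟨fun _ _ => 0, by simp⟩
    | h1 i h => exact ⟨crossing (str i) (str (i + 1)), by simp [cross_S h, perm_S h, crossGen_apply]⟩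
    | hmul a b ha hb =>
      obtain ⟨f, hf⟩ := ha
      obtain ⟨g, hg⟩ := hb
      refine ⟨fun j k => g j k + f (perm b j) (perm b k), fun j k z => ?_⟩
      rw [map_mul, Equiv.Perm.mul_apply, hg, hf, map_mul]
      simp [add_assoc]
    | hinv a ha =>
      obtain ⟨f, hf⟩ := ha
      refine ⟨fun j k => - f ((perm a)⁻¹ j) ((perm a)⁻¹ k), fun j k z => ?_⟩
      rw [map_inv, Equiv.Perm.inv_eq_iff_eq, hf, map_inv]
      simp
  obtain ⟨f, hf⟩ := key
  intro j k z
  rw [chi, hf, hf]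
  simp

theorem chi_mul (a b : BG m) (j k : Fin (m + 1)) :
    chi (a * b) j k = chi b j k + chi a (perm b j) (perm b k) := by
  rw [chi, map_mul, Equiv.Perm.mul_apply, cross_apply, cross_apply]
  simp

@[simp] theorem chi_one (j k : Fin (m + 1)) : chi (1 : BG m) j k = 0 := by simp [chi]

theorem chi_inv (a : BG m) (j k : Fin (m + 1)) :
    chi a⁻¹ j k = - chi a ((perm a)⁻¹ j) ((perm a)⁻¹ k) := by
  have := chi_mul a a⁻¹ j k
  rw [mul_inv_cancel, chi_one, map_inv] at this
  linarith

theorem chi_S {i : ℕ} (h : i < m) (j k : Fin (m + 1)) :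
    chi (S i) j k = crossing (str i) (str (i + 1)) j k := by
  simp [chi, cross_S h, crossGen_apply]

theorem chi_symm (b : BG m) : ∀ j k, chi b j k = chi b k j := by
  induction b using induction with
  | h0 => simp
  | h1 i h =>
    intro j k
    rw [chi_S h, chi_S h, crossing, crossing]
    congr 1
    grind
  | hmul a b ha hb => intro j k; rw [chi_mul, chi_mul, ha, hb]
  | hinv a ha => intro j k; rw [chi_inv, chi_inv, ha]

theorem chi_parity (b : BG m) : ∀ j k, j ≠ k → (Even (chi b j k) ↔ (j < k ↔ perm b j < perm b k)) := by
  induction b using induction with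
  | h0 => simp
  | h1 i h =>
    intro j k hjk
    rw [chi_S h, crossing, perm_S h, Equiv.swap_apply_def, Equiv.swap_apply_def]
    have h1 := val_str (m := m) (i := i) (by omega)
    have h2 := val_str (m := m) (i := i + 1) (by omega)
    simp only [Fin.lt_def, eq_str h, eq_str h.le]
    split_ifs <;> simp <;> omega
  | hmul a b ha hb =>
    intro j k hjk
    rw [chi_mul, Int.even_add, ha _ _ ((perm b).injective.ne hjk), hb _ _ hjk, map_mul]
    simp only [Equiv.Perm.mul_apply]
    tauto
  | hinv a ha =>
    intro j k hjk
    rw [chi_inv, even_neg, ha _ _ ((perm a)⁻¹.injective.ne hjk), map_inv]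
    simp
    tauto

theorem ex_artin (b : BG m) : ∀ j w, FG.ex (perm b j) (artin b w) = FG.ex j w := by
  induction b using induction with
  | h0 => simp
  | h1 i h =>
    intro j w
    rw [artin_S h, perm_S h]
    have hne : (str i : Fin (m + 1)) ≠ str (i + 1) := str_ne (by omega) (by omega) (by omega)
    induction w using FreeGroup.induction_on with
    | C1 => simp
    | of l =>
      by_cases h1 : l = str i
      · subst h1; rw [artinGen_left]
        simp only [FG.ex_mul, FG.ex_inv, FG.ex_of, Equiv.swap_apply_def]; grind
      by_cases h2 : l = str (i + 1)
      · subst h2; rw [artinGen_right]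
        simp only [FG.ex_of, Equiv.swap_apply_def]; grind
      · rw [artinGen_other h1 h2]
        simp only [FG.ex_of, Equiv.swap_apply_def]; grind
    | inv_of l hl => rw [map_inv, FG.ex_inv, hl, FG.ex_inv]
    | mul u v hu hv => rw [map_mul, FG.ex_mul, hu, hv, FG.ex_mul]
  | hmul a b ha hb =>
    intro j w
    rw [map_mul, map_mul, MulAut.mul_apply, Equiv.Perm.mul_apply, ha, hb]
  | hinv a ha =>
    intro j w
    rw [map_inv, map_inv]
    have := ha ((perm a)⁻¹ j) ((artin a)⁻¹ w)
    rw [← this]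
    simp

/-- The linking numbers are determined by the Artin action. -/
theorem artin_of (b : BG m) : ∀ j, ∃ c, artin b (of j) = c * of (perm b j) * c⁻¹ ∧
    ∀ k, k ≠ j → 2 * FG.ex (perm b k) c =
      - chi b j k + (if perm b j < perm b k then 1 else 0) - if j < k then 1 else 0 := by
  induction b using induction with
  | h0 => exact fun j => ⟨1, by simp, by simp⟩
  | h1 i h =>
    intro j
    have h1 := val_str (m := m) (i := i) (by omega)
    have h2 := val_str (m := m) (i := i + 1) (by omega)
    have hne : (str i : Fin (m + 1)) ≠ str (i + 1) := str_ne (by omega) (by omega) (by omega)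
    rw [artin_S h, perm_S h]
    by_cases hj1 : j = str i
    · subst hj1
      refine ⟨(of (str i))⁻¹, by simp [artinGen_left], fun k hk => ?_⟩
      rw [chi_S h, crossing, Equiv.swap_apply_left]
      by_cases hk2 : k = str (i + 1)
      · subst hk2
        simp [Fin.lt_def, h1, h2]
      · rw [Equiv.swap_apply_of_ne_of_ne hk hk2]
        rw [ne_str h.le] at hk
        rw [← ne_eq, ne_str h] at hk2
        simp only [Fin.lt_def, h1, h2, eq_str h.le, eq_str h, FG.ex_inv, FG.ex_of, Fin.ext_iff]
        split_ifs <;> omega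
    by_cases hj2 : j = str (i + 1)
    · subst hj2
      refine ⟨1, by simp [artinGen_right], fun k hk => ?_⟩
      rw [chi_S h, crossing, Equiv.swap_apply_right]
      by_cases hk2 : k = str i
      · subst hk2
        simp [Fin.lt_def, h1, h2]
      · rw [Equiv.swap_apply_of_ne_of_ne hk2 hk]
        rw [ne_str h] at hk
        rw [← ne_eq, ne_str h.le] at hk2
        simp only [Fin.lt_def, h1, h2, eq_str h.le, eq_str h, FG.ex_one, Fin.ext_iff]
        split_ifs <;> omega
    · refine ⟨1, by simp [artinGen_other hj1 hj2, Equiv.swap_apply_of_ne_of_ne hj1 hj2],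
        fun k hk => ?_⟩
      rw [Equiv.swap_apply_of_ne_of_ne hj1 hj2, chi_S h, crossing, Equiv.swap_apply_def]
      rw [← ne_eq, ne_str h.le] at hj1
      rw [← ne_eq, ne_str h] at hj2
      rw [Ne, Fin.ext_iff] at hk
      simp only [eq_str h.le, eq_str h, Fin.lt_def, FG.ex_one]
      split_ifs <;> omega
  | hmul a b ha hb =>
    intro j
    obtain ⟨c, hc, hc'⟩ := hb j
    obtain ⟨d, hd, hd'⟩ := ha (perm b j)
    refine ⟨artin a c * d, ?_, fun k hk => ?_⟩
    · rw [map_mul, MulAut.mul_apply, hc, map_mul, map_mul, hd, map_inv, map_mul]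
      simp [mul_assoc]
    · rw [FG.ex_mul, chi_mul, map_mul, Equiv.Perm.mul_apply, ex_artin, mul_add, hc' k hk,
        hd' (perm b k) ((perm b).injective.ne hk), Equiv.Perm.mul_apply]
      ring
  | hinv a ha =>
    intro j
    obtain ⟨c, hc, hc'⟩ := ha ((perm a)⁻¹ j)
    refine ⟨((artin a)⁻¹ c)⁻¹, ?_, fun k hk => ?_⟩
    · rw [map_inv, MulAut.inv_apply, MulEquiv.symm_apply_eq]
      rw [map_mul, map_mul, map_inv, map_inv, map_inv, hc]
      simp [mul_assoc, MulAut.inv_apply]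
    · have h1 := hc' ((perm a)⁻¹ k) ((perm a)⁻¹.injective.ne hk)
      have h2 := ex_artin a ((perm a)⁻¹ k) ((artin a)⁻¹ c)
      rw [FG.ex_inv, chi_inv, map_inv, ← h2]
      simp at h1 ⊢
      linarith

/-- The braids inducing the trivial permutation. -/
def IsPure (b : BG m) : Prop := perm b = 1

theorem IsPure.perm_apply {b : BG m} (h : IsPure b) (j : Fin (m + 1)) : perm b j = j := by
  rw [h]; rfl

theorem IsPure.mul {a b : BG m} (ha : IsPure a) (hb : IsPure b) : IsPure (a * b) := by
  rw [IsPure, map_mul, ha, hb, one_mul]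

theorem IsPure.inv {a : BG m} (ha : IsPure a) : IsPure a⁻¹ := by
  rw [IsPure, map_inv, ha, inv_one]

theorem IsPure.zpow {a : BG m} (ha : IsPure a) (n : ℤ) : IsPure (a ^ n) := by
  rw [IsPure, map_zpow, ha, one_zpow]

theorem IsPure.pow {a : BG m} (ha : IsPure a) (n : ℕ) : IsPure (a ^ n) := by
  rw [IsPure, map_pow, ha, one_pow]

theorem IsPure.conj {a : BG m} (ha : IsPure a) (h : BG m) : IsPure (h * a * h⁻¹) := by
  rw [IsPure, map_mul, map_mul, ha, mul_one, ← map_mul, mul_inv_cancel, map_one]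

theorem chi_mul_pure (a : BG m) {b : BG m} (hb : IsPure b) (j k) :
    chi (a * b) j k = chi a j k + chi b j k := by
  rw [chi_mul, hb.perm_apply, hb.perm_apply, add_comm]

theorem chi_inv_pure {b : BG m} (hb : IsPure b) (j k) : chi b⁻¹ j k = - chi b j k := by
  rw [chi_inv, hb]; rfl

theorem chi_pow_pure {b : BG m} (hb : IsPure b) (n : ℕ) (j k) :
    chi (b ^ n) j k = n * chi b j k := by
  induction n with
  | zero => simp
  | succ n ih => rw [pow_succ, chi_mul_pure _ hb, ih]; push_cast; ring

theorem chi_zpow_pure {b : BG m} (hb : IsPure b) (n : ℤ) (j k) :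
    chi (b ^ n) j k = n * chi b j k := by
  cases n with
  | ofNat n => simpa using chi_pow_pure hb n j k
  | negSucc n =>
    rw [zpow_negSucc, chi_inv_pure (hb.pow _), chi_pow_pure hb, Int.negSucc_eq]; push_cast; ring

theorem chi_conj {b : BG m} (hb : IsPure b) (h : BG m) (j k) :
    chi (h * b * h⁻¹) j k = chi b ((perm h)⁻¹ j) ((perm h)⁻¹ k) := by
  rw [chi_mul, chi_mul, chi_inv, hb.perm_apply, hb.perm_apply, map_inv]
  ring

theorem perm_surjective : Function.Surjective (perm : BG m → Equiv.Perm (Fin (m + 1))) := by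
  have h : Submonoid.closure (Set.range fun i : Fin m => Equiv.swap i.castSucc i.succ) ≤
      (MonoidHom.range (perm (m := m))).toSubmonoid := by
    rw [Submonoid.closure_le]
    rintro _ ⟨i, rfl⟩
    refine ⟨S i, ?_⟩
    change _ = Equiv.swap i.castSucc i.succ
    rw [perm_S i.2, (eq_str (by omega) i.castSucc).2 rfl,
      (eq_str (by omega) i.succ).2 (Fin.val_succ i)]
    rfl
  rw [Equiv.Perm.mclosure_swap_castSucc_succ] at h
  exact fun x => h (Submonoid.mem_top x)

end BG

end

section

open FreeGroup (of)

namespace BG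

variable {m : ℕ}

/-- The semidirect product of a free group and a braid group for the Artin action. -/
abbrev Semi (m : ℕ) : Type := FreeGroup (Fin (m + 1)) ⋊[artin (m := m)] BG m

/-- The free generators of the semidirect product. -/
def sx (i : ℕ) : Semi m := SemidirectProduct.inl (of (str i))

/-- The braid generators of the semidirect product. -/
def sb (i : ℕ) : Semi m := SemidirectProduct.inr (S i)

theorem inr_mul_inl (b : BG m) (f : FreeGroup (Fin (m + 1))) :
    (SemidirectProduct.inr b * SemidirectProduct.inl f : Semi m) =
      SemidirectProduct.inl (artin b f) * SemidirectProduct.inr b := by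
  rw [SemidirectProduct.inl_aut, map_inv, inv_mul_cancel_right]

theorem sb_mul_sx_succ {i : ℕ} (h : i < m) : (sb i * sx (i + 1) : Semi m) = sx i * sb i := by
  rw [sb, sx, inr_mul_inl, artin_S h, artinGen_right]; rfl

theorem sb_mul_sx {i : ℕ} (h : i < m) :
    (sb i * sx i : Semi m) = (sx i)⁻¹ * sx (i + 1) * sx i * sb i := by
  rw [sb, sx, inr_mul_inl, artin_S h, artinGen_left]; simp [sx]

theorem sb_comm_sx {i j : ℕ} (h : i < m) (hj : j ≤ m) (h1 : j ≠ i) (h2 : j ≠ i + 1) :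
    (sb i * sx j : Semi m) = sx j * sb i := by
  rw [sb, sx, inr_mul_inl, artin_S h, artinGen_other (str_ne hj h.le h1) (str_ne hj h h2)]

theorem sb_braid {i : ℕ} (h : i + 1 < m) :
    (sb i * sb (i + 1) * sb i : Semi m) = sb (i + 1) * sb i * sb (i + 1) := by
  simp only [sb, ← map_mul, braid h]

theorem sb_comm {i j : ℕ} (h : i + 2 ≤ j) : (sb i * sb j : Semi m) = sb j * sb i := by
  simp only [sb, ← map_mul, (comm h).eq]

/-- The action of a generator on the cosets of the braids fixing the last strand. -/
def combGen (i : ℕ) : Equiv.Perm (ℕ × Semi m) where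
  toFun x := if x.1 < i then (x.1, sb (i - 1) * x.2) else if x.1 = i then (i + 1, sx i * x.2)
    else if x.1 = i + 1 then (i, x.2) else if x.1 ≤ m + 1 then (x.1, sb i * x.2) else x
  invFun x := if x.1 < i then (x.1, (sb (i - 1))⁻¹ * x.2) else if x.1 = i then (i + 1, x.2)
    else if x.1 = i + 1 then (i, (sx i)⁻¹ * x.2) else
      if x.1 ≤ m + 1 then (x.1, (sb i)⁻¹ * x.2) else x
  left_inv x := by
    obtain ⟨p, h⟩ := x
    dsimp only
    split_ifs <;> simp_all
  right_inv x := by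
    obtain ⟨p, h⟩ := x
    dsimp only
    split_ifs <;> simp_all

theorem combGen_lt {i p : ℕ} (hp : p < i) (h : Semi m) :
    combGen i (p, h) = (p, sb (i - 1) * h) := by simp [combGen, hp]
theorem combGen_eq (i : ℕ) (h : Semi m) : combGen i (i, h) = (i + 1, sx i * h) := by
  simp [combGen]
theorem combGen_succ (i : ℕ) (h : Semi m) : combGen i (i + 1, h) = (i, h) := by
  simp [combGen]
theorem combGen_gt {i p : ℕ} (hp : i + 1 < p) (hp' : p ≤ m + 1) (h : Semi m) :
    combGen i (p, h) = (p, sb i * h) := by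
  simp [combGen, show ¬ p < i by omega, show p ≠ i by omega, show p ≠ i + 1 by omega, hp']
theorem combGen_out {i p : ℕ} (hi : i ≤ m) (hp : m + 1 < p) (h : Semi m) :
    combGen i (p, h) = (p, h) := by
  simp [combGen, show ¬ p < i by omega, show p ≠ i by omega, show p ≠ i + 1 by omega, hp]

theorem combGen_braid {i : ℕ} (hi : i + 1 < m + 1) :
    (combGen i * combGen (i + 1) * combGen i : Equiv.Perm (ℕ × Semi m)) =
      combGen (i + 1) * combGen i * combGen (i + 1) := by
  refine Equiv.ext fun x => ?_
  obtain ⟨p, h⟩ := x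
  simp only [Equiv.Perm.mul_apply]
  rcases lt_trichotomy p i with hp | rfl | hp
  · simp only [combGen_lt hp, combGen_lt (show p < i + 1 by omega)]
    obtain ⟨k, rfl⟩ : ∃ k, i = k + 1 := ⟨i - 1, by omega⟩
    simp only [Nat.add_sub_cancel, ← mul_assoc, sb_braid (m := m) (i := k) (by omega)]
  · simp only [combGen_eq, combGen_gt (show p + 1 < p + 1 + 1 by omega)
      (show p + 1 + 1 ≤ m + 1 by omega), combGen_lt (show p < p + 1 by omega)]
    simp only [Nat.add_sub_cancel, ← mul_assoc]
    rw [sb_mul_sx_succ (by omega), mul_assoc (sx p), sb_mul_sx (by omega)]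
    simp [mul_assoc]
  · obtain rfl | hp : p = i + 1 ∨ i + 1 < p := by omega
    · simp only [combGen_succ, combGen_lt (show i < i + 1 by omega), combGen_eq,
        combGen_gt (show i + 1 < i + 1 + 1 by omega) (show i + 1 + 1 ≤ m + 1 by omega)]
      simp only [Nat.add_sub_cancel, ← mul_assoc]
      rw [sb_mul_sx_succ (by omega)]
    · obtain rfl | hp : p = i + 1 + 1 ∨ i + 2 < p := by omega
      · simp only [combGen_gt (show i + 1 < i + 1 + 1 by omega)
          (show i + 1 + 1 ≤ m + 1 by omega), combGen_succ, combGen_lt (show i < i + 1 by omega),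
          Nat.add_sub_cancel]
      · by_cases hm : p ≤ m + 1
        · simp only [combGen_gt (show i + 1 < p by omega) hm,
            combGen_gt (show i + 1 + 1 < p by omega) hm, ← mul_assoc,
            sb_braid (m := m) (i := i) (by omega)]
        · simp only [combGen_out (m := m) (i := i) (p := p) (by omega) (by omega),
            combGen_out (m := m) (i := i + 1) (p := p) (by omega) (by omega)]

theorem combGen_comm {i j : ℕ} (hij : i + 2 ≤ j) (hj : j < m + 1) :
    (combGen i * combGen j : Equiv.Perm (ℕ × Semi m)) = combGen j * combGen i := by
  refine Equiv.ext fun x => ?_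
  obtain ⟨p, h⟩ := x
  simp only [Equiv.Perm.mul_apply]
  rcases lt_trichotomy p i with hp | rfl | hp
  · simp only [combGen_lt (show p < i from hp), combGen_lt (show p < j by omega), ← mul_assoc,
      sb_comm (m := m) (i := i - 1) (j := j - 1) (by omega)]
  · simp only [combGen_lt (show p < j by omega), combGen_lt (show p + 1 < j by omega), combGen_eq, ← mul_assoc, sb_comm_sx (m := m) (i := j - 1) (j := p) (by omega) (by omega)
      (by omega) (by omega)]
  obtain rfl | hp : p = i + 1 ∨ i + 1 < p := by omega
  · simp only [combGen_lt (show i < j by omega), combGen_lt (show i + 1 < j by omega),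
      combGen_succ]
  rcases lt_trichotomy p j with hp' | rfl | hp'
  · simp only [combGen_lt (show p < j from hp'), combGen_gt (m := m) hp (by omega),
      ← mul_assoc, sb_comm (m := m) (i := i) (j := j - 1) (by omega)]
  · simp only [combGen_eq, combGen_gt hp (show p ≤ m + 1 by omega),
      combGen_gt (show i + 1 < p + 1 by omega) (show p + 1 ≤ m + 1 by omega), ← mul_assoc, sb_comm_sx (m := m) (i := i) (j := p) (by omega) (by omega)
      (by omega) (by omega)]
  obtain rfl | hp' : p = j + 1 ∨ j + 1 < p := by omega
  · simp only [combGen_succ, combGen_gt (show i + 1 < j by omega) (show j ≤ m + 1 by omega),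
      combGen_gt (show i + 1 < j + 1 by omega) (show j + 1 ≤ m + 1 by omega)]
  by_cases hm : p ≤ m + 1
  · simp only [combGen_gt (m := m) hp hm, combGen_gt (m := m) hp' hm, ← mul_assoc, sb_comm hij]
  · simp only [combGen_out (m := m) (i := i) (p := p) (by omega) (by omega),
      combGen_out (m := m) (i := j) (p := p) (by omega) (by omega)]

/-- The action of the braid group on the cosets of the braids fixing the last strand. -/
def comb : BG (m + 1) →* Equiv.Perm (ℕ × Semi m) :=
  lift combGen (fun _ h => combGen_braid h) fun _ _ h h' => combGen_comm h h'

theorem comb_S {i : ℕ} (h : i ≤ m) : comb (S i : BG (m + 1)) = combGen i :=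
  lift_S _ _ _ (by omega)

/-- The inclusion of the braids on the first strands. -/
def up : BG m →* BG (m + 1) :=
  lift S (fun _ h => braid (by omega)) fun _ _ h _ => (comm h).eq

@[simp] theorem up_S {i : ℕ} (h : i < m) : up (S i : BG m) = S i := lift_S _ _ _ h

/-- Auxiliary recursion for `A`. -/
def Aaux : ℕ → BG (m + 1)
  | 0 => S m ^ 2
  | k + 1 => S (m - (k + 1)) * Aaux k * (S (m - (k + 1)))⁻¹

/-- The pure braid in which the last strand turns around the strand `i`. -/
def A (i : ℕ) : BG (m + 1) := Aaux (m - i)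

theorem A_last : (A m : BG (m + 1)) = S m ^ 2 := by simp [A, Aaux]

theorem A_of_lt {i : ℕ} (h : i < m) : (A i : BG (m + 1)) = S i * A (i + 1) * (S i)⁻¹ := by
  obtain ⟨k, hk⟩ : ∃ k, m - i = k + 1 := ⟨m - i - 1, by omega⟩
  rw [A, hk, Aaux, A, show m - (i + 1) = k by omega, show m - (k + 1) = i by omega]

/-- Descending induction from `m`. -/
theorem descInd {p : ℕ → Prop} (h0 : p m) (h1 : ∀ i, i < m → p (i + 1) → p i) {i : ℕ}
    (h : i ≤ m) : p i :=
  Nat.decreasingInduction (fun k hk hp => h1 k hk hp) h0 h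

theorem A_comm_lt {i : ℕ} (hi : i ≤ m) : ∀ {j}, j + 1 < i → Commute (S j : BG (m + 1)) (A i) := by
  refine descInd (p := fun i => ∀ {j}, j + 1 < i → Commute (S j : BG (m + 1)) (A i)) ?_ ?_ hi
  · intro j hj
    rw [A_last]; exact (comm (by omega)).pow_right 2
  · intro i hi ih j hj
    rw [A_of_lt hi]
    have h1 : Commute (S j : BG (m + 1)) (S i) := comm (by omega)
    exact (h1.mul_right (ih (by omega))).mul_right h1.inv_right

theorem A_comm_gt {i : ℕ} (hi : i ≤ m) :
    ∀ {j}, i < j → j < m → Commute (S j : BG (m + 1)) (A i) := by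
  refine descInd (p := fun i => ∀ {j}, i < j → j < m → Commute (S j : BG (m + 1)) (A i)) ?_ ?_ hi
  · intro j hj hj'; omega
  · intro i hi ih j hj hj'
    obtain rfl | hj : j = i + 1 ∨ i + 2 ≤ j := by omega
    · rw [A_of_lt hi, A_of_lt hj']
      have h1 : Commute (S i : BG (m + 1)) (A (i + 1 + 1)) := A_comm_lt (by omega) (by omega)
      have h2 := braid (m := m + 1) (i := i) (by omega)
      change _ * _ = _ * _
      rw [← mul_inv_eq_iff_eq_mul]
      calc _ = (S (i + 1) * S i * S (i + 1)) * A (i + 1 + 1) *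
            (S (i + 1) * S i * S (i + 1) : BG (m + 1))⁻¹ := by group
        _ = S i * S (i + 1) * (S i * A (i + 1 + 1) * (S i)⁻¹) * (S (i + 1))⁻¹ * (S i)⁻¹ := by
            rw [← h2]; group
        _ = _ := by rw [h1.eq]; group
    · rw [A_of_lt hi]
      have h1 : Commute (S j : BG (m + 1)) (S i) := (comm hj).symm
      exact (h1.mul_right (ih (by omega) hj')).mul_right h1.inv_right

theorem A_conj {i : ℕ} (hi : i < m) :
    (S i * A i * (S i)⁻¹ : BG (m + 1)) = (A i)⁻¹ * A (i + 1) * A i := by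
  obtain ⟨n, rfl⟩ : ∃ n, m = n + 1 := ⟨m - 1, by omega⟩
  refine descInd (m := n) (p := fun i => (S i * A i * (S i)⁻¹ : BG (n + 1 + 1)) =
    (A i)⁻¹ * A (i + 1) * A i) ?_ ?_ (show i ≤ n by omega)
  · rw [A_of_lt (show n < n + 1 by omega), A_last]
    have h := braid (m := n + 1 + 1) (i := n) (by omega)
    generalize (S n : BG (n + 1 + 1)) = s at *
    generalize (S (n + 1) : BG (n + 1 + 1)) = t at *
    have h1 : t * (s * t ^ 2 * s) = (s * t ^ 2 * s) * t := by
      calc t * (s * t ^ 2 * s) = (t * s * t) * t * s := by simp [pow_two, mul_assoc]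
        _ = s * t * (s * t * s) := by rw [← h]; simp [mul_assoc]
        _ = _ := by rw [h]; simp [pow_two, mul_assoc]
    have h2 : t ^ 2 * (s * t ^ 2 * s) = (s * t ^ 2 * s) * t ^ 2 :=
      (show Commute t (s * t ^ 2 * s) from h1).pow_left 2
    have h3 : (s * t ^ 2 * s⁻¹) * (s * (s * t ^ 2 * s⁻¹) * s⁻¹) = t ^ 2 * (s * t ^ 2 * s⁻¹) := by
      calc _ = (s * t ^ 2 * s) * t ^ 2 * s⁻¹ * s⁻¹ := by group
        _ = _ := by rw [← h2]; group
    rw [mul_assoc (_)⁻¹, ← h3]; group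
  · intro i hi ih
    have h := braid (m := n + 1 + 1) (i := i) (by omega)
    have e1 : (S (i + 1) * S i) * S (i + 1) * (S (i + 1) * S i)⁻¹ = (S i : BG (n + 1 + 1)) := by
      rw [← h]; group
    have e2 : (S (i + 1) * S i) * A (i + 1 + 1) * (S (i + 1) * S i)⁻¹ =
        (A (i + 1) : BG (n + 1 + 1)) := by
      have h1 : Commute (S i : BG (n + 1 + 1)) (A (i + 1 + 1)) := A_comm_lt (by omega) (by omega)
      calc _ = S (i + 1) * (S i * A (i + 1 + 1) * (S i)⁻¹) * (S (i + 1) : BG (n + 1 + 1))⁻¹ := by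
            group
        _ = _ := by rw [h1.eq, mul_inv_cancel_right, A_of_lt (show i + 1 < n + 1 by omega)]
    have e3 : (S (i + 1) * S i) * A (i + 1) * (S (i + 1) * S i)⁻¹ = (A i : BG (n + 1 + 1)) := by
      have h1 : Commute (S (i + 1) : BG (n + 1 + 1)) (A i) :=
        A_comm_gt (by omega) (by omega) (by omega)
      calc _ = S (i + 1) * (S i * A (i + 1) * (S i)⁻¹) * (S (i + 1) : BG (n + 1 + 1))⁻¹ := by
            group
        _ = _ := by rw [← A_of_lt (by omega), h1.eq, mul_inv_cancel_right]
    have key := congrArg (fun x => (S (i + 1) * S i) * x * (S (i + 1) * S i : BG (n + 1 + 1))⁻¹) ih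
    rw [← e1, ← e2, ← e3]
    calc _ = (S (i + 1) * S i) * (S (i + 1) * A (i + 1) * (S (i + 1))⁻¹) *
          (S (i + 1) * S i : BG (n + 1 + 1))⁻¹ := by group
      _ = _ := by rw [key]; group

/-- The inclusion of the free group generated by the pure braids `A i`. -/
def kf : FreeGroup (Fin (m + 1)) →* BG (m + 1) := FreeGroup.lift fun i => A i

@[simp] theorem kf_of (i : Fin (m + 1)) : kf (of i) = A i := by simp [kf]

theorem kf_str {i : ℕ} (h : i ≤ m) : kf (of (str i) : FreeGroup (Fin (m + 1))) = A i := by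
  rw [kf_of, val_str h]

theorem kf_artin (b : BG m) : ∀ f, kf (artin b f) = up b * kf f * (up b)⁻¹ := by
  induction b using induction with
  | h0 => simp
  | h1 i h =>
    intro f
    have : kf.comp (artin (S i : BG m)).toMonoidHom =
        (MulAut.conj (up (S i : BG m))).toMonoidHom.comp kf := by
      apply FreeGroup.ext_hom
      intro j
      simp only [MonoidHom.comp_apply, MulEquiv.coe_toMonoidHom, MulAut.conj_apply]
      rw [artin_S h, up_S h]
      by_cases h1 : j = str i
      · subst h1
        rw [artinGen_left, map_mul, map_mul, map_inv, kf_str h.le, kf_str h, A_conj h]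
      by_cases h2 : j = str (i + 1)
      · subst h2
        rw [artinGen_right, kf_str h.le, kf_str h, A_of_lt h]
      rw [artinGen_other h1 h2, kf_of, eq_mul_inv_iff_mul_eq]
      rw [← ne_eq, ne_str h.le] at h1
      rw [← ne_eq, ne_str h] at h2
      rcases lt_or_gt_of_ne h1 with h3 | h3
      · exact (A_comm_gt (by omega) h3 h).symm.eq
      · exact (A_comm_lt (by omega) (by omega)).symm.eq
    exact DFunLike.congr_fun this f
  | hmul a b ha hb =>
    intro f
    rw [map_mul, MulAut.mul_apply, ha, hb, map_mul]; group
  | hinv a ha =>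
    intro f
    have := ha ((artin a)⁻¹ f)
    rw [MulAut.apply_inv_self] at this
    rw [this, map_inv, map_inv]; group

theorem comb_A {i : ℕ} (hi : i ≤ m) (h : Semi m) : comb (A i) (m + 1, h) = (m + 1, sx i * h) := by
  refine descInd (p := fun i => ∀ h : Semi m, comb (A i) (m + 1, h) = (m + 1, sx i * h)) ?_ ?_ hi h
  · intro h
    rw [A_last, map_pow, comb_S le_rfl, pow_two, Equiv.Perm.mul_apply, combGen_succ, combGen_eq]
  · intro i hi ih h
    have hinv : (comb (S i : BG (m + 1)))⁻¹ (m + 1, h) = (m + 1, (sb i)⁻¹ * h) := by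
      rw [Equiv.Perm.inv_eq_iff_eq, comb_S hi.le, combGen_gt (by omega) le_rfl, mul_inv_cancel_left]
    rw [A_of_lt hi, map_mul, map_mul, map_inv, Equiv.Perm.mul_apply, Equiv.Perm.mul_apply, hinv, ih,
      comb_S hi.le, combGen_gt (by omega) le_rfl]
    simp only [← mul_assoc, sb_mul_sx_succ hi]
    rw [mul_inv_cancel_right]

theorem comb_kf (f : FreeGroup (Fin (m + 1))) : ∀ h : Semi m,
    comb (kf f) (m + 1, h) = (m + 1, SemidirectProduct.inl f * h) := by
  induction f using FreeGroup.induction_on with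
  | C1 => simp
  | of i => intro h; rw [kf_of, comb_A (by omega), sx, str_val]
  | inv_of i ih => 
    intro h
    rw [map_inv, map_inv, Equiv.Perm.inv_eq_iff_eq, ih, map_inv, mul_inv_cancel_left]
  | mul u v hu hv => intro h; rw [map_mul, map_mul, Equiv.Perm.mul_apply, hv, hu, map_mul, mul_assoc]

theorem comb_up (b : BG m) : ∀ h : Semi m,
    comb (up b) (m + 1, h) = (m + 1, SemidirectProduct.inr b * h) := by
  induction b using induction with
  | h0 => simp
  | h1 i hi => intro h; rw [up_S hi, comb_S hi.le, combGen_gt (by omega) le_rfl, sb]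
  | hmul a b ha hb => intro h; rw [map_mul, map_mul, Equiv.Perm.mul_apply, hb, ha, map_mul, mul_assoc]
  | hinv a ha =>
    intro h
    rw [map_inv, map_inv, Equiv.Perm.inv_eq_iff_eq, ha, map_inv, mul_inv_cancel_left]

/-- Uniqueness in the combing of braids. -/
theorem kf_mul_up_inj {f f' : FreeGroup (Fin (m + 1))} {b b' : BG m}
    (h : kf f * up b = kf f' * up b') : f = f' ∧ b = b' := by
  have h1 := congrArg (fun x => (comb x (m + 1, (1 : Semi m))).2) h
  simp only [map_mul, Equiv.Perm.mul_apply, comb_up, comb_kf, mul_one] at h1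
  exact ⟨by simpa using congrArg SemidirectProduct.left h1,
    by simpa using congrArg SemidirectProduct.right h1⟩

theorem kf_injective : Function.Injective (kf (m := m)) := fun f f' h =>
  (kf_mul_up_inj (b := 1) (b' := 1) (by rw [h])).1

end BG

end

section

open FreeGroup (of)

namespace BG

variable {m : ℕ}

/-- The inclusion of the semidirect product as the braids fixing the last strand. -/
def inc : Semi m →* BG (m + 1) :=
  SemidirectProduct.lift kf up fun b => MonoidHom.ext fun f => by
    simp [kf_artin]

@[simp] theorem inc_inl (f : FreeGroup (Fin (m + 1))) : inc (SemidirectProduct.inl f) = kf f := by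
  simp [inc]
@[simp] theorem inc_inr (b : BG m) : inc (SemidirectProduct.inr b) = up b := by simp [inc]

theorem exists_of_inc (h : Semi m) : ∃ f b, inc h = kf f * up b :=
  ⟨h.left, h.right, by rw [← inc_inl, ← inc_inr, ← map_mul, SemidirectProduct.inl_left_mul_inr_right]⟩

/-- Auxiliary recursion for `cst`. -/
def cstAux : ℕ → BG (m + 1)
  | 0 => 1
  | k + 1 => S (m - k) * cstAux k

/-- Representatives of the cosets of the braids fixing the last strand. -/
def cst (p : ℕ) : BG (m + 1) := cstAux (m + 1 - p)

theorem cst_last : (cst (m + 1) : BG (m + 1)) = 1 := by simp [cst, cstAux]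

theorem cst_of_lt {i : ℕ} (h : i < m + 1) : (cst i : BG (m + 1)) = S i * cst (i + 1) := by
  obtain ⟨k, hk⟩ : ∃ k, m + 1 - i = k + 1 := ⟨m + 1 - i - 1, by omega⟩
  rw [cst, hk, cstAux, cst, show m + 1 - (i + 1) = k by omega, show m - k = i by omega]

theorem cst_comm_lt {i : ℕ} (hi : i ≤ m + 1) :
    ∀ {j}, j + 1 < i → Commute (S j : BG (m + 1)) (cst i) := by
  refine descInd (p := fun i => ∀ {j}, j + 1 < i → Commute (S j : BG (m + 1)) (cst i)) ?_ ?_ hi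
  · intro j hj
    rw [cst_last]; exact Commute.one_right _
  · intro i hi ih j hj
    rw [cst_of_lt hi]
    exact (comm (by omega)).mul_right (ih (by omega))

theorem cst_comm_gt {i : ℕ} (hi : i ≤ m + 1) :
    ∀ {j}, i ≤ j → j < m → (S (j + 1) * cst i : BG (m + 1)) = cst i * S j := by
  refine descInd (p := fun i => ∀ {j}, i ≤ j → j < m →
    (S (j + 1) * cst i : BG (m + 1)) = cst i * S j) ?_ ?_ hi
  · intro j hj hj'; omega
  · intro i hi ih j hj hj'
    obtain rfl | hj : j = i ∨ i + 1 ≤ j := by omega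
    · have h := braid (m := m + 1) (i := j) (by omega)
      have h1 : Commute (S j : BG (m + 1)) (cst (j + 1 + 1)) := cst_comm_lt (by omega) (by omega)
      rw [cst_of_lt hi, cst_of_lt (show j + 1 < m + 1 by omega)]
      calc _ = (S (j + 1) * S j * S (j + 1)) * (cst (j + 1 + 1) : BG (m + 1)) := by
            simp only [mul_assoc]
        _ = S j * S (j + 1) * (S j * cst (j + 1 + 1)) := by rw [← h]; simp only [mul_assoc]
        _ = _ := by rw [h1.eq]; simp only [mul_assoc]
    · have h1 : Commute (S i : BG (m + 1)) (S (j + 1)) := comm (by omega)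
      rw [cst_of_lt hi, ← mul_assoc, ← h1.eq, mul_assoc, ih hj hj', mul_assoc]

theorem S_sq_mul_cst {i : ℕ} (hi : i ≤ m) :
    (S i ^ 2 * cst (i + 1) : BG (m + 1)) = cst (i + 1) * A i := by
  refine descInd (p := fun i => (S i ^ 2 * cst (i + 1) : BG (m + 1)) = cst (i + 1) * A i) ?_ ?_ hi
  · rw [cst_last, A_last]; simp
  · intro i hi ih
    have h := braid (m := m + 1) (i := i) (by omega)
    have h1 : Commute (S i : BG (m + 1)) (cst (i + 1 + 1)) := cst_comm_lt (by omega) (by omega)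
    rw [A_of_lt hi, cst_of_lt (show i + 1 < m + 1 by omega)]
    have e : (S i ^ 2 * S (i + 1) : BG (m + 1)) = S (i + 1) * S i * S (i + 1) ^ 2 * (S i)⁻¹ := by
      rw [eq_mul_inv_iff_mul_eq]
      calc _ = S i * (S i * S (i + 1) * S i : BG (m + 1)) := by simp only [pow_two, mul_assoc]
        _ = (S i * S (i + 1) * S i) * S (i + 1) := by rw [h]; simp only [mul_assoc]; 
                                                      rw [← mul_assoc, ← mul_assoc, h]; simp only [mul_assoc]
        _ = _ := by rw [h]; simp only [pow_two, mul_assoc]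
    calc _ = (S i ^ 2 * S (i + 1)) * (cst (i + 1 + 1) : BG (m + 1)) := by simp only [mul_assoc]
      _ = S (i + 1) * S i * (S (i + 1) ^ 2 * cst (i + 1 + 1)) * (S i)⁻¹ := by
        rw [e, mul_assoc _ (S i)⁻¹, h1.inv_left.eq]; simp only [mul_assoc]
      _ = S (i + 1) * (S i * cst (i + 1 + 1)) * A (i + 1) * (S i)⁻¹ := by
        rw [ih]; simp only [mul_assoc]
      _ = _ := by rw [h1.eq]; simp only [mul_assoc]

theorem S_mul_cst {i p : ℕ} (hi : i ≤ m) (hp : p ≤ m + 1) :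
    ∃ h : Semi m, S i * cst p = cst (Equiv.swap i (i + 1) p) * inc h := by
  rcases lt_trichotomy p i with h | rfl | h
  · refine ⟨SemidirectProduct.inr (S (i - 1)), ?_⟩
    obtain ⟨k, rfl⟩ : ∃ k, i = k + 1 := ⟨i - 1, by omega⟩
    rw [Equiv.swap_apply_of_ne_of_ne (by omega) (by omega), cst_comm_gt hp (by omega) (by omega),
      inc_inr, Nat.add_sub_cancel, up_S (by omega)]
  · refine ⟨SemidirectProduct.inl (of (str p)), ?_⟩
    rw [Equiv.swap_apply_left, inc_inl, kf_str hi, ← S_sq_mul_cst hi, cst_of_lt (by omega), pow_two,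
      mul_assoc]
  obtain rfl | h : p = i + 1 ∨ i + 1 < p := by omega
  · refine ⟨1, ?_⟩
    rw [Equiv.swap_apply_right, map_one, mul_one, ← cst_of_lt (by omega)]
  · refine ⟨SemidirectProduct.inr (S i), ?_⟩
    rw [Equiv.swap_apply_of_ne_of_ne (by omega) (by omega), (cst_comm_lt hp h).eq, inc_inr,
      up_S (by omega)]

theorem swap_le {i p : ℕ} (hi : i ≤ m) (hp : p ≤ m + 1) : Equiv.swap i (i + 1) p ≤ m + 1 := by
  rw [Equiv.swap_apply_def]; split_ifs <;> omega

theorem exists_cst_mul (b : BG (m + 1)) : ∀ {p}, p ≤ m + 1 →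
    (∃ q ≤ m + 1, ∃ h : Semi m, b * cst p = cst q * inc h) ∧
    ∃ q ≤ m + 1, ∃ h : Semi m, b⁻¹ * cst p = cst q * inc h := by
  induction b using induction with
  | h0 => intro p hp; exact ⟨⟨p, hp, 1, by simp⟩, ⟨p, hp, 1, by simp⟩⟩
  | h1 i hi =>
    intro p hp
    refine ⟨⟨_, swap_le (by omega) hp, S_mul_cst (by omega) hp⟩,
      ⟨_, swap_le (show i ≤ m by omega) hp, ?_⟩⟩
    obtain ⟨h, hh⟩ := S_mul_cst (show i ≤ m by omega) (swap_le (show i ≤ m by omega) hp)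
    rw [Equiv.swap_apply_self] at hh
    exact ⟨h⁻¹, by rw [map_inv, eq_mul_inv_iff_mul_eq, mul_assoc, ← hh, inv_mul_cancel_left]⟩
  | hmul a b ha hb =>
    intro p hp
    obtain ⟨⟨q, hq, h, hh⟩, -⟩ := hb hp
    obtain ⟨⟨q', hq', h', hh'⟩, -⟩ := ha hq
    obtain ⟨-, ⟨r, hr, k, hk⟩⟩ := ha hp
    obtain ⟨-, ⟨r', hr', k', hk'⟩⟩ := hb hr
    refine ⟨⟨q', hq', h' * h, ?_⟩, ⟨r', hr', k' * k, ?_⟩⟩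
    · rw [mul_assoc, hh, ← mul_assoc, hh', map_mul, mul_assoc]
    · rw [mul_inv_rev, mul_assoc, hk, ← mul_assoc, hk', map_mul, mul_assoc]
  | hinv a ha =>
    intro p hp
    rw [inv_inv]
    exact (ha hp).symm

theorem exists_eq_cst_mul (b : BG (m + 1)) : ∃ p ≤ m + 1, ∃ h : Semi m, b = cst p * inc h := by
  simpa [cst_last] using (exists_cst_mul b (le_refl (m + 1))).1

theorem str_castSucc {i : ℕ} (hi : i ≤ m) :
    (str i : Fin (m + 1 + 1)) = (str i : Fin (m + 1)).castSucc := by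
  symm; rw [eq_str (by omega), Fin.val_castSucc, val_str hi]

theorem perm_up (b : BG m) : ∀ j, perm (up b) (Fin.castSucc j) = (perm b j).castSucc := by
  induction b using induction with
  | h0 => simp
  | h1 i h =>
    intro j
    rw [up_S h, perm_S h, perm_S (by omega), str_castSucc h.le, str_castSucc h,
      (Fin.castSucc_injective _).swap_apply]
  | hmul a b ha hb => intro j; rw [map_mul, map_mul, Equiv.Perm.mul_apply, hb, ha]; simp
  | hinv a ha =>
    intro j
    rw [map_inv, map_inv, Equiv.Perm.inv_eq_iff_eq, ha, map_inv]; simp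

theorem perm_up_last (b : BG m) : perm (up b) (Fin.last (m + 1)) = Fin.last (m + 1) := by
  induction b using induction with
  | h0 => simp
  | h1 i h =>
    rw [up_S h, perm_S (by omega), str_castSucc h.le, str_castSucc h]
    exact Equiv.swap_apply_of_ne_of_ne (Fin.castSucc_lt_last _).ne' (Fin.castSucc_lt_last _).ne'
  | hmul a b ha hb => rw [map_mul, map_mul, Equiv.Perm.mul_apply, hb, ha]
  | hinv a ha => rw [map_inv, map_inv, Equiv.Perm.inv_eq_iff_eq, ha]

theorem isPure_S_sq (i : ℕ) : IsPure (S i ^ 2 : BG m) := by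
  by_cases h : i < m
  · rw [IsPure, map_pow, perm_S h, pow_two, Equiv.swap_mul_self]
  · rw [S_of_le (by omega)]; simp [IsPure]

theorem crossing_perm {I : Type*} [DecidableEq I] (p q j k : I) (s : Equiv.Perm I) :
    crossing p q (s⁻¹ j) (s⁻¹ k) = crossing (s p) (s q) j k := by
  simp only [crossing, Equiv.Perm.inv_eq_iff_eq]

theorem chi_S_sq {i : ℕ} (h : i < m) (j k : Fin (m + 1)) :
    chi (S i ^ 2) j k = 2 * crossing (str i) (str (i + 1)) j k := by
  have h1 : crossing (str i : Fin (m + 1)) (str (i + 1)) (perm (S i) j) (perm (S i) k) =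
      crossing (str i) (str (i + 1)) j k := by
    have h2 := crossing_perm (str i : Fin (m + 1)) (str (i + 1)) j k (perm (S i))
    rw [perm_S h, Equiv.swap_inv, Equiv.swap_apply_left, Equiv.swap_apply_right] at h2
    rw [perm_S h, h2]
    simp only [crossing, or_comm]
  rw [pow_two, chi_mul, chi_S h, chi_S h, h1]; ring

theorem chi_conj_S_sq {i : ℕ} (h : i < m) (x : BG m) (j k : Fin (m + 1)) :
    chi (x * S i ^ 2 * x⁻¹) j k = 2 * crossing (perm x (str i)) (perm x (str (i + 1))) j k := by
  rw [chi_conj (isPure_S_sq i), chi_S_sq h, crossing_perm]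

theorem chi_up (b : BG m) : ∀ j k, chi (up b) (Fin.castSucc j) (Fin.castSucc k) = chi b j k := by
  induction b using induction with
  | h0 => simp
  | h1 i h =>
    intro j k
    rw [up_S h, chi_S h, chi_S (by omega), str_castSucc h.le, str_castSucc h]
    simp only [crossing, Fin.castSucc_inj]
  | hmul a b ha hb => intro j k; rw [map_mul, chi_mul, chi_mul, perm_up, perm_up, ha, hb]
  | hinv a ha =>
    intro j k
    rw [map_inv, chi_inv, chi_inv, ← map_inv, ← map_inv, perm_up, perm_up, ha, map_inv]

theorem chi_up_last (b : BG m) : ∀ j, chi (up b) (Fin.castSucc j) (Fin.last (m + 1)) = 0 := by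
  induction b using induction with
  | h0 => simp
  | h1 i h =>
    intro j
    rw [up_S h, chi_S (by omega), str_castSucc h.le, str_castSucc h]
    simp [crossing, (Fin.castSucc_lt_last _).ne']
  | hmul a b ha hb => intro j; rw [map_mul, chi_mul, perm_up, perm_up_last, ha, hb, add_zero]
  | hinv a ha =>
    intro j
    rw [map_inv, chi_inv, ← map_inv, ← map_inv, perm_up, perm_up_last, ha, neg_zero]

theorem A_data {i : ℕ} (hi : i ≤ m) : IsPure (A i : BG (m + 1)) ∧
    ∀ j k, chi (A i : BG (m + 1)) j k = 2 * crossing (str i) (Fin.last (m + 1)) j k := by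
  refine descInd (p := fun i => IsPure (A i : BG (m + 1)) ∧
    ∀ j k, chi (A i : BG (m + 1)) j k = 2 * crossing (str i) (Fin.last (m + 1)) j k) ?_ ?_ hi
  · rw [A_last]
    refine ⟨isPure_S_sq _, fun j k => ?_⟩
    rw [chi_S_sq (by omega), show (str (m + 1) : Fin (m + 1 + 1)) = Fin.last (m + 1) by
      symm; rw [eq_str le_rfl, Fin.val_last]]
  · intro i hi ih
    rw [A_of_lt hi]
    refine ⟨ih.1.conj _, fun j k => ?_⟩
    rw [chi_conj ih.1, ih.2, crossing_perm, ← up_S hi, perm_up_last, up_S hi, perm_S (by omega),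
      Equiv.swap_apply_right]

theorem kf_data (f : FreeGroup (Fin (m + 1))) : IsPure (kf f) ∧
    (∀ j k, chi (kf f) (Fin.castSucc j) (Fin.castSucc k) = 0) ∧
    ∀ j, chi (kf f) (Fin.castSucc j) (Fin.last (m + 1)) = 2 * FG.ex j f := by
  induction f using FreeGroup.induction_on with
  | C1 => simp [IsPure]
  | of i =>
    obtain ⟨h1, h2⟩ := A_data (m := m) (i := i) (by omega)
    rw [kf_of]
    refine ⟨h1, fun j k => ?_, fun j => ?_⟩
    · rw [h2]; simp [crossing, (Fin.castSucc_lt_last _).ne]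
    · rw [h2, str_castSucc (by omega), str_val]
      simp [crossing, (Fin.castSucc_lt_last _).ne, eq_comm]
  | inv_of i ih =>
    obtain ⟨h1, h2, h3⟩ := ih
    rw [map_inv]
    refine ⟨h1.inv, fun j k => ?_, fun j => ?_⟩
    · rw [chi_inv_pure h1, h2, neg_zero]
    · rw [chi_inv_pure h1, h3, FG.ex_inv]; ring
  | mul u v hu hv =>
    rw [map_mul]
    refine ⟨hu.1.mul hv.1, fun j k => ?_, fun j => ?_⟩
    · rw [chi_mul_pure _ hv.1, hu.2.1, hv.2.1, add_zero]
    · rw [chi_mul_pure _ hv.1, hu.2.2, hv.2.2, FG.ex_mul]; ring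

theorem isPure_kf (f : FreeGroup (Fin (m + 1))) : IsPure (kf f) := (kf_data f).1
theorem chi_kf (f : FreeGroup (Fin (m + 1))) (j k) :
    chi (kf f) (Fin.castSucc j) (Fin.castSucc k) = 0 := (kf_data f).2.1 j k
theorem chi_kf_last (f : FreeGroup (Fin (m + 1))) (j) :
    chi (kf f) (Fin.castSucc j) (Fin.last (m + 1)) = 2 * FG.ex j f := (kf_data f).2.2 j

theorem perm_cst {p : ℕ} (hp : p ≤ m + 1) :
    perm (cst p : BG (m + 1)) (Fin.last (m + 1)) = str p := by
  refine descInd (p := fun p => perm (cst p : BG (m + 1)) (Fin.last (m + 1)) = str p) ?_ ?_ hp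
  · rw [cst_last, map_one, eq_str le_rfl]; rfl
  · intro i hi ih
    rw [cst_of_lt hi, map_mul, Equiv.Perm.mul_apply, ih, perm_S hi, Equiv.swap_apply_right]

theorem exists_kf_mul_up {b : BG (m + 1)} (h : perm b (Fin.last (m + 1)) = Fin.last (m + 1)) :
    ∃ f b', b = kf f * up b' := by
  obtain ⟨p, hp, s, rfl⟩ := exists_eq_cst_mul b
  obtain ⟨f, b', hs⟩ := exists_of_inc s
  rw [hs] at h ⊢
  refine ⟨f, b', ?_⟩
  rw [map_mul, map_mul, isPure_kf, one_mul, Equiv.Perm.mul_apply, perm_up_last, perm_cst hp, eq_comm,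
    eq_str hp, Fin.val_last] at h
  rw [← h, cst_last, one_mul]

theorem IsPure.exists_kf_mul_up {g : BG (m + 1)} (h : IsPure g) :
    ∃ f b, g = kf f * up b ∧ IsPure b ∧
      (∀ j k, chi b j k = chi g (Fin.castSucc j) (Fin.castSucc k)) ∧
      ∀ j, 2 * FG.ex j f = chi g (Fin.castSucc j) (Fin.last (m + 1)) := by
  obtain ⟨f, b, rfl⟩ := BG.exists_kf_mul_up (h.perm_apply (Fin.last (m + 1)))
  have hu : IsPure (up b) := by
    have := (isPure_kf f).inv.mul h
    rwa [inv_mul_cancel_left] at this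
  have hb : IsPure b := Equiv.ext fun j => by
    have := hu.perm_apply (Fin.castSucc j)
    rw [perm_up, Fin.castSucc_inj] at this
    exact this
  refine ⟨f, b, rfl, hb, fun j k => ?_, fun j => ?_⟩
  · rw [chi_mul_pure _ hu, chi_kf, chi_up, zero_add]
  · rw [chi_mul_pure _ hu, chi_kf_last, chi_up_last, add_zero]

theorem IsPure.exists_isBC {g : BG (m + 1)} (h : IsPure g) :
    ∃ a c, FG.IsBC a c ∧ (∀ w, kf (a w) = g * kf w * g⁻¹) ∧
      ∀ j k, k ≠ j → 2 * FG.ex k (c j) = chi g (Fin.castSucc k) (Fin.last (m + 1)) -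
        chi g (Fin.castSucc j) (Fin.castSucc k) := by
  obtain ⟨f, b, rfl, hb, h1, h2⟩ := h.exists_kf_mul_up
  choose c hc hc' using artin_of b
  refine ⟨MulAut.conj f * artin b, fun j => f * c j, fun j => ?_, fun w => ?_, fun j k hjk => ?_⟩
  · rw [MulAut.mul_apply, hc, hb.perm_apply, MulAut.conj_apply]; group
  · rw [MulAut.mul_apply, MulAut.conj_apply, map_mul, map_mul, kf_artin, map_inv]; group
  · have := hc' j k hjk
    rw [hb.perm_apply, hb.perm_apply, h1] at this
    rw [FG.ex_mul, mul_add, h2, this]; ring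

end BG

end

section

open FreeGroup (of)
open scoped commutatorElement

namespace FG

theorem eq_conj_zpow_last {n : ℕ} (w : FreeGroup (Fin (n + 1)))
    (hw : ∀ x : Fin n, ex x.castSucc w = 0)
    (h1 : ∀ i j : Fin n, i ≠ j → ∃ a c, IsBC a c ∧ a w = w ∧
      ex i.castSucc (c j.castSucc) = ex j.castSucc (c i.castSucc) ∧
      ex j.castSucc (c i.castSucc) ≠ 0)
    (h2 : ∃ j k : Fin n, j ≠ k ∧ ∃ a c, IsBC a c ∧ a w = w ∧
      ex k.castSucc (c j.castSucc) ≠ ex j.castSucc (c k.castSucc)) :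
    ∃ (d : FreeGroup (Fin (n + 1))) (k : ℤ), w = d * of (Fin.last n) ^ k * d⁻¹ := by
  let e : Option (Fin n) ≃ Fin (n + 1) := finSuccEquivLast.symm
  have hes : ∀ i : Fin n, e (some i) = i.castSucc := fun i => finSuccEquivLast_symm_some i
  have hen : e none = Fin.last n := finSuccEquivLast_symm_none
  let E := FreeGroup.freeGroupCongr e
  have hE : ∀ j v, ex j (E.symm v) = ex (e j) v := by
    intro j v
    induction v using FreeGroup.induction_on with
    | C1 => simp
    | of o => simp [E, FreeGroup.freeGroupCongr, Equiv.symm_apply_eq]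
    | inv_of o h => rw [map_inv, ex_inv, h, ex_inv]
    | mul u v hu hv => simp [hu, hv]
  have hEof : ∀ i, E.symm (of (e i)) = of i := by
    intro i; simp [E, FreeGroup.freeGroupCongr]
  have hEof' : ∀ i, E (of i) = of (e i) := by
    intro i; simp [E, FreeGroup.freeGroupCongr]
  have htr : ∀ (a : MulAut (FreeGroup (Fin (n + 1)))) c, IsBC a c → a w = w →
      ∃ a' c', IsBC a' c' ∧ a' (E.symm w) = E.symm w ∧
        ∀ i j, ex i (c' j) = ex (e i) (c (e j)) := by
    intro a c h h'
    refine ⟨(E.trans a).trans E.symm, fun i => E.symm (c (e i)), fun i => ?_, ?_, fun i j => ?_⟩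
    · change E.symm (a (E (of i))) = _
      rw [hEof', h, map_mul, map_mul, map_inv, hEof]
    · change E.symm (a (E (E.symm w))) = _
      rw [MulEquiv.apply_symm_apply, h']
    · rw [hE]
  obtain ⟨d, k, hk⟩ := eq_conj_zpow_none (E.symm w) (fun x => by rw [hE, hes, hw])
    (fun i j hij => by
      obtain ⟨a, c, h3, h4, h5⟩ := h1 i j hij
      obtain ⟨a', c', h6, h7, h8⟩ := htr a c h3 h4
      refine ⟨a', c', h6, h7, ?_⟩
      rw [h8, h8, hes, hes]; exact h5)
    (by
      obtain ⟨j, k, hjk, a, c, h3, h4, h5⟩ := h2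
      obtain ⟨a', c', h6, h7, h8⟩ := htr a c h3 h4
      refine ⟨j, k, hjk, a', c', h6, h7, ?_⟩
      rw [h8, h8, hes, hes]; exact h5)
  refine ⟨E d, k, ?_⟩
  have := congrArg E hk
  rwa [MulEquiv.apply_symm_apply, map_mul, map_mul, map_zpow, hEof', hen, map_inv] at this

end FG

namespace BG

variable {m : ℕ}

theorem chi_self (b : BG m) (j : Fin (m + 1)) : chi b j j = 0 := by
  induction b using induction generalizing j with
  | h0 => simp
  | h1 i h =>
    rw [chi_S h, crossing, if_neg]
    have := str_ne (m := m) h.le h (show i ≠ i + 1 by omega)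
    rintro (⟨h1, h2⟩ | ⟨h1, h2⟩)
    · exact this (h1.symm.trans h2)
    · exact this (h2.symm.trans h1)
  | hmul a b ha hb => rw [chi_mul, ha, hb, add_zero]
  | hinv a ha => rw [chi_inv, ha, neg_zero]

theorem exists_perm_str (hm : 0 < m) {p q : Fin (m + 1)} (h : p ≠ q) :
    ∃ x : BG m, perm x (str 0) = p ∧ perm x (str 1) = q := by
  obtain ⟨x, hx⟩ := perm_surjective (Equiv.swap (Equiv.swap (str 0) p (str 1)) q *
    Equiv.swap (str 0) p)
  have h01 := str_ne (m := m) hm.le hm (show 0 ≠ 1 by omega)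
  refine ⟨x, ?_, ?_⟩
  · rw [hx, Equiv.Perm.mul_apply, Equiv.swap_apply_left, Equiv.swap_apply_of_ne_of_ne _ h]
    intro h'
    have h2 := (Equiv.swap (str 0) p).injective
      ((Equiv.swap_apply_left (str 0) p).trans h')
    exact h01 h2
  · rw [hx, Equiv.Perm.mul_apply, Equiv.swap_apply_left]

theorem commute_of_kf_mul_up {f f' : FreeGroup (Fin (m + 1))} {b b' : BG m}
    (h : Commute (kf f * up b) (kf f' * up b')) : Commute b b' := by
  have e : ∀ (f f' : FreeGroup (Fin (m + 1))) (b b' : BG m),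
      kf f * up b * (kf f' * up b') = kf (f * artin b f') * up (b * b') := by
    intro f f' b b'
    rw [map_mul, map_mul, kf_artin]; group
  have h' := h.eq
  rw [e, e] at h'
  exact (kf_mul_up_inj h').2

theorem eq_one_of_commute (m : ℕ) : ∀ b : BG m, IsPure b → (∀ j k, chi b j k = 0) →
    (∀ i j : Fin (m + 1), i ≠ j → i ≠ Fin.last m → j ≠ Fin.last m → ∃ (g : BG m) (c κ : ℤ),
      IsPure g ∧ Commute g b ∧ κ ≠ 0 ∧ ∀ p q, p ≠ q → chi g p q = c + κ * crossing i j p q) →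
    b = 1 := by
  induction m with
  | zero =>
    intro b _ _ _
    have := mem_of_S (L := (⊥ : Subgroup (BG 0))) (fun i hi => by omega) b
    exact Subgroup.mem_bot.1 this
  | succ m ih =>
    intro b hb hchi h
    obtain ⟨f, b', rfl, hb', h1, h2⟩ := hb.exists_kf_mul_up
    have hb1 : b' = 1 := by
      refine ih b' hb' (fun j k => by rw [h1, hchi]) fun i j hij _ _ => ?_
      obtain ⟨g, c, κ, hg, hgc, hκ, hgchi⟩ := h i.castSucc j.castSucc
        (fun h => hij (Fin.castSucc_injective _ h))
        (Fin.castSucc_lt_last _).ne (Fin.castSucc_lt_last _).ne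
      obtain ⟨f', g', rfl, hg', h1', -⟩ := hg.exists_kf_mul_up
      refine ⟨g', c, κ, hg', commute_of_kf_mul_up hgc, hκ, fun p q hpq => ?_⟩
      rw [h1', hgchi _ _ fun h => hpq (Fin.castSucc_injective _ h)]
      simp only [crossing, Fin.castSucc_inj]
    subst hb1
    simp only [map_one, mul_one] at *
    rw [FG.eq_one_of_isBC_fixed _ f (fun j => ?_) fun i j hij => ?_, map_one]
    · have := h2 j; rw [hchi] at this; omega
    · obtain ⟨g, c, κ, hg, hgc, hκ, hgchi⟩ := h i.castSucc j.castSucc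
        (fun h => hij (Fin.castSucc_injective _ h))
        (Fin.castSucc_lt_last _).ne (Fin.castSucc_lt_last _).ne
      obtain ⟨a, d, had, hkf, hex⟩ := hg.exists_isBC
      refine ⟨a, d, had, kf_injective ?_, fun h0 => hκ ?_⟩
      · rw [hkf, hgc.eq, mul_inv_cancel_right]
      · have := hex i j hij.symm
        rw [h0, hgchi _ _ (Fin.castSucc_lt_last _).ne,
          hgchi _ _ fun h => hij (Fin.castSucc_injective _ h)] at this
        simp [crossing, (Fin.castSucc_lt_last _).ne'] at this
        omega

/-- A central pure braid with vanishing linking numbers is trivial. -/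
theorem eq_one_of_mem_center {b : BG m} (hc : b ∈ Subgroup.center (BG m)) (hb : IsPure b)
    (hchi : ∀ j k, chi b j k = 0) : b = 1 := by
  refine eq_one_of_commute m b hb hchi fun i j hij hi hj => ?_
  have hm : 0 < m := by
    rcases Nat.eq_zero_or_pos m with rfl | h
    · exact absurd (Fin.ext (by omega)) hij
    · exact h
  obtain ⟨x, hx1, hx2⟩ := exists_perm_str hm hij
  refine ⟨x * S 0 ^ 2 * x⁻¹, 0, 2, (isPure_S_sq 0).conj x, (Subgroup.mem_center_iff.1 hc _),
    two_ne_zero, fun p q _ => ?_⟩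
  rw [chi_conj_S_sq hm, hx1, zero_add, hx2, zero_add]

theorem perm_eq_one_of_central {I : Type*} [DecidableEq I] {s : Equiv.Perm I}
    (hI : ∀ i j : I, ∃ k, k ≠ i ∧ k ≠ j) (h : ∀ t, t * s = s * t) : s = 1 := by
  by_contra hs
  obtain ⟨j, hj⟩ : ∃ j, s j ≠ j := by
    by_contra! hcon
    exact hs (Equiv.ext hcon)
  obtain ⟨l, hl, hl'⟩ := hI j (s j)
  have := congrArg (fun t => t j) (h (Equiv.swap (s j) l))
  simp only [Equiv.Perm.mul_apply, Equiv.swap_apply_left,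
    Equiv.swap_apply_of_ne_of_ne hj.symm hl.symm] at this
  exact hl' this

theorem isPure_of_mem_center (hm : 2 ≤ m) {b : BG m} (hc : b ∈ Subgroup.center (BG m)) :
    IsPure b := by
  refine perm_eq_one_of_central (fun i j => ?_) fun t => ?_
  · by_contra! hcon
    have h0 := hcon (str 0)
    have h1 := hcon (str 1)
    have h2 := hcon (str 2)
    have h01 := str_ne (m := m) (i := 0) (j := 1) (by omega) (by omega) (by omega)
    have h02 := str_ne (m := m) (i := 0) (j := 2) (by omega) (by omega) (by omega)
    have h12 := str_ne (m := m) (i := 1) (j := 2) (by omega) (by omega) (by omega)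
    by_cases e0 : (str 0 : Fin (m + 1)) = i
    · have e1 := h1 (fun h => h01 (e0.trans h.symm))
      have e2 := h2 (fun h => h02 (e0.trans h.symm))
      exact h12 (e1.trans e2.symm)
    · have e0 := h0 e0
      by_cases e1 : (str 1 : Fin (m + 1)) = i
      · have e2 := h2 (fun h => h12 (e1.trans h.symm))
        exact h02 (e0.trans e2.symm)
      · exact h01 (e0.trans (h1 e1).symm)
  · obtain ⟨x, rfl⟩ := perm_surjective t
    rw [← map_mul, ← map_mul, Subgroup.mem_center_iff.1 hc x]

theorem chi_const_of_mem_center (hm : 2 ≤ m) {b : BG m} (hc : b ∈ Subgroup.center (BG m)) :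
    ∃ c, ∀ j k, j ≠ k → chi b j k = c := by
  refine ⟨chi b (str 0) (str 1), fun j k hjk => ?_⟩
  obtain ⟨x, rfl, rfl⟩ := exists_perm_str (by omega) hjk
  have h1 := chi_conj (isPure_of_mem_center hm hc) x (perm x (str 0)) (perm x (str 1))
  rw [Subgroup.mem_center_iff.1 hc x, mul_inv_cancel_right] at h1
  simpa using h1

/-- The exponent sum of a braid. -/
def len : BG m →* Multiplicative ℤ :=
  lift (fun _ => Multiplicative.ofAdd 1) (fun _ _ => rfl) fun _ _ _ _ => rfl

theorem len_S {i : ℕ} (h : i < m) : len (S i : BG m) = Multiplicative.ofAdd 1 := lift_S _ _ _ h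

theorem cst_mul_cst_zero {p : ℕ} (hp : p ≤ m) :
    (cst (p + 1) * cst 0 * S m : BG (m + 1)) = cst 0 * cst p := by
  refine descInd (p := fun p => (cst (p + 1) * cst 0 * S m : BG (m + 1)) = cst 0 * cst p)
    ?_ ?_ hp
  · rw [cst_of_lt (show m < m + 1 by omega), cst_last]; simp
  · intro i hi ih
    rw [cst_of_lt (show i + 1 < m + 1 by omega), cst_of_lt (show i < m + 1 by omega), mul_assoc,
      mul_assoc, ← mul_assoc (cst _), ih, ← mul_assoc, cst_comm_gt (by omega) (by omega) hi,
      mul_assoc]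

theorem cst_zero_pow_mul {k : ℕ} (hk : k ≤ m) :
    (cst 0 ^ k * S 0 : BG (m + 1)) = S k * cst 0 ^ k := by
  induction k with
  | zero => simp
  | succ k ih =>
    rw [pow_succ', mul_assoc, ih (by omega), ← mul_assoc, ← cst_comm_gt (by omega) (by omega) hk,
      mul_assoc]

theorem cst_zero_pow_comm : Commute (cst 0 ^ (m + 2) : BG (m + 1)) (S 0) := by
  have h : (cst 0 ^ 2 * S m : BG (m + 1)) = S 0 * cst 0 ^ 2 := by
    rw [pow_two, ← mul_assoc (S 0), cst_of_lt (show 0 < m + 1 by omega)]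
    nth_rw 2 [← cst_of_lt (show 0 < m + 1 by omega)]
    rw [mul_assoc (S 0), mul_assoc (S 0), cst_mul_cst_zero (by omega), ← mul_assoc,
      ← cst_of_lt (show 0 < m + 1 by omega), mul_assoc]
  change _ * _ = _ * _
  rw [show m + 2 = 2 + m by omega, pow_add, mul_assoc, cst_zero_pow_mul le_rfl, ← mul_assoc, h,
    mul_assoc]

theorem cst_zero_pow_mem_center : (cst 0 ^ (m + 2) : BG (m + 1)) ∈ Subgroup.center (BG (m + 1)) := by
  rw [Subgroup.mem_center_iff]
  intro g
  rw [← Subgroup.mem_centralizer_singleton_iff]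
  refine mem_of_S (L := Subgroup.centralizer {(cst 0 ^ (m + 2) : BG (m + 1))}) (fun i hi => ?_) g
  rw [Subgroup.mem_centralizer_singleton_iff]
  have h1 := cst_zero_pow_mul (m := m) (k := i) (by omega)
  rw [← mul_inv_eq_iff_eq_mul] at h1
  rw [← h1]
  have h2 : Commute (cst 0 ^ (m + 2) : BG (m + 1)) (cst 0 ^ i) := (Commute.refl _).pow_pow _ _
  exact ((h2.mul_right cst_zero_pow_comm).mul_right h2.inv_right).symm.eq

theorem exists_mem_center (hm : 2 ≤ m) : ∃ z ∈ Subgroup.center (BG m), ∃ c : ℤ, c ≠ 0 ∧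
    ∀ j k, j ≠ k → chi z j k = c := by
  obtain ⟨m, rfl⟩ : ∃ k, m = k + 1 := ⟨m - 1, by omega⟩
  refine ⟨_, cst_zero_pow_mem_center, ?_⟩
  obtain ⟨c, hc⟩ := chi_const_of_mem_center hm cst_zero_pow_mem_center
  refine ⟨c, fun h0 => ?_, hc⟩
  have h1 : (cst 0 ^ (m + 2) : BG (m + 1)) = 1 := by
    refine eq_one_of_mem_center cst_zero_pow_mem_center
      (isPure_of_mem_center hm cst_zero_pow_mem_center) fun j k => ?_
    by_cases h : j = k
    · rw [h, chi_self]
    · rw [hc j k h, h0]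
  have h2 : ∀ {p}, p ≤ m + 1 → (len (cst p : BG (m + 1))).toAdd + p = m + 1 := by
    intro p hp
    refine descInd (p := fun p => (len (cst p : BG (m + 1))).toAdd + p = m + 1) ?_ ?_ hp
    · rw [cst_last]; simp
    · intro i hi ih
      rw [cst_of_lt hi, map_mul, len_S hi, toAdd_mul, toAdd_ofAdd]
      push_cast at ih
      linarith
  have h3 := congrArg (fun x => (len x).toAdd) h1
  have h4 := h2 (p := 0) (by omega)
  simp only [map_pow, toAdd_pow, map_one, toAdd_one, smul_eq_mul] at h3
  simp only [Nat.cast_zero, add_zero] at h4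
  rw [h4] at h3
  simp at h3
  omega

/-- Pure braids which commute modulo the center commute. -/
theorem commute_of_mem_center {a b : BG m} (hb : IsPure b) (ha : IsPure a)
    (h : ⁅a, b⁆ ∈ Subgroup.center (BG m)) : Commute a b := by
  rw [← commutatorElement_eq_one_iff_commute]
  refine eq_one_of_mem_center h ?_ fun j k => ?_
  · exact ((ha.mul hb).mul ha.inv).mul hb.inv
  · rw [commutatorElement_def, chi_mul_pure _ hb.inv, chi_mul_pure _ ha.inv, chi_mul_pure _ hb,
      chi_inv_pure ha, chi_inv_pure hb]
    ring

/-- A criterion for a braid to be conjugate to a power of the square of a generator. -/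
theorem exists_conj_zpow {f : FreeGroup (Fin (m + 1))}
    (h0 : ∀ j : Fin m, chi (kf f) j.castSucc.castSucc (Fin.last (m + 1)) = 0)
    (h1 : ∀ i j : Fin m, i ≠ j → ∃ g, IsPure g ∧ Commute g (kf f) ∧
      chi g i.castSucc.castSucc (Fin.last (m + 1)) = chi g j.castSucc.castSucc (Fin.last (m + 1)) ∧
      chi g j.castSucc.castSucc (Fin.last (m + 1)) ≠ chi g i.castSucc.castSucc j.castSucc.castSucc)
    (h2 : ∃ j k : Fin m, j ≠ k ∧ ∃ g, IsPure g ∧ Commute g (kf f) ∧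
      chi g j.castSucc.castSucc (Fin.last (m + 1)) ≠ chi g k.castSucc.castSucc (Fin.last (m + 1))) :
    ∃ (d : BG (m + 1)) (k : ℤ), kf f = d * (S m ^ 2) ^ k * d⁻¹ := by
  have hfix : ∀ (g : BG (m + 1)) (a : MulAut (FreeGroup (Fin (m + 1)))), Commute g (kf f) → (∀ w, kf (a w) = g * kf w * g⁻¹) →
      a f = f := by
    intro g a hg h
    apply kf_injective
    rw [h, hg.eq, mul_inv_cancel_right]
  have hcs : ∀ {i j : Fin m}, i ≠ j → i.castSucc ≠ j.castSucc := fun h h' =>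
    h (Fin.castSucc_injective _ h')
  obtain ⟨d, k, hd⟩ := FG.eq_conj_zpow_last f (fun j => by
      have := h0 j
      rw [chi_kf_last] at this; omega)
    (fun i j hij => by
      obtain ⟨g, hg, hgc, h3, h4⟩ := h1 i j hij
      obtain ⟨a, c, h5, h6, h7⟩ := hg.exists_isBC
      have e1 := h7 i.castSucc j.castSucc (hcs hij.symm)
      have e2 := h7 j.castSucc i.castSucc (hcs hij)
      rw [chi_symm g j.castSucc.castSucc] at e2
      exact ⟨a, c, h5, hfix g a hgc h6, by omega, by omega⟩)
    (by
      obtain ⟨j, k, hjk, g, hg, hgc, h3⟩ := h2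
      obtain ⟨a, c, h5, h6, h7⟩ := hg.exists_isBC
      have e1 := h7 j.castSucc k.castSucc (hcs hjk.symm)
      have e2 := h7 k.castSucc j.castSucc (hcs hjk)
      rw [chi_symm g k.castSucc.castSucc] at e2
      exact ⟨j, k, hjk, a, c, h5, hfix g a hgc h6, by omega⟩)
  refine ⟨kf d, k, ?_⟩
  rw [hd, map_mul, map_mul, map_zpow, map_inv, kf_of, Fin.val_last, A_last]

end BG

end

section

/-- A sequence of elements satisfying the braid relations. -/
structure BraidSeq {Γ : Type*} [Group Γ] (m : ℕ) (s : ℕ → Γ) : Prop where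
  braid : ∀ i, i + 1 < m → s i * s (i + 1) * s i = s (i + 1) * s i * s (i + 1)
  comm : ∀ i j, i + 2 ≤ j → j < m → s i * s j = s j * s i

namespace BraidSeq

variable {Γ : Type*} [Group Γ] {m : ℕ} {s : ℕ → Γ}

theorem eq_of_commute_of_braid {x y : Γ} (h : x * y * x = y * x * y) (hc : x * y = y * x) : x = y := by
  rw [← hc, mul_assoc, mul_assoc] at h
  have := mul_left_cancel h
  rw [← hc] at this
  exact mul_right_cancel this

theorem eq_one_of_braid_mul {x y c : Γ} (h : x * y * x = y * x * y)
    (h' : (x * c) * y * (x * c) = y * (x * c) * y) (hx : c * x = x * c) (hy : c * y = y * c) :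
    c = 1 := by
  have e1 : (x * c) * y * (x * c) = (x * y * x) * c * c := by
    simp only [mul_assoc]; rw [← mul_assoc c y, hy]
    simp only [mul_assoc]; rw [← mul_assoc c x, hx]; simp only [mul_assoc]
  have e2 : y * (x * c) * y = (y * x * y) * c := by
    simp only [mul_assoc]; rw [hy]
  rw [e1, e2, ← h] at h'
  simpa using h'

theorem map {Δ : Type*} [Group Δ] (h : BraidSeq m s) (f : Γ →* Δ) : BraidSeq m fun i => f (s i) where
  braid i hi := by simp only [← map_mul, h.braid i hi]
  comm i j hi hj := by simp only [← map_mul, h.comm i j hi hj]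

theorem eq_zero_of_eq_succ (h : BraidSeq m s) {i : ℕ} (hi : i + 1 < m) (he : s i = s (i + 1)) :
    ∀ j, j < m → s j = s 0 := by
  have up1 : ∀ i, i + 2 < m → s i = s (i + 1) → s (i + 1) = s (i + 2) := by
    intro i hi he
    refine eq_of_commute_of_braid (h.braid (i + 1) hi) ?_
    rw [← he]; exact h.comm _ _ le_rfl hi
  have down1 : ∀ i, i + 2 < m → s (i + 1) = s (i + 2) → s i = s (i + 1) := by
    intro i hi he
    refine eq_of_commute_of_braid (h.braid i (by omega)) ?_
    rw [he]; exact h.comm _ _ le_rfl hi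
  have h0 : s 0 = s 1 := by
    induction i with
    | zero => exact he
    | succ i ih => exact ih (by omega) (down1 i hi he)
  have hs : ∀ j, j + 1 < m → s j = s (j + 1) := by
    intro j
    induction j with
    | zero => intro _; exact h0
    | succ j ih => intro hj; exact up1 j hj (ih (by omega))
  intro j
  induction j with
  | zero => intro _; rfl
  | succ j ih => intro hj; rw [← hs j hj, ih (by omega)]

theorem isConj (h : BraidSeq m s) : ∀ i, i < m → IsConj (s 0) (s i) := by
  intro i
  induction i with
  | zero => intro _; exact IsConj.refl _
  | succ i ih =>
    intro hi
    refine (ih (by omega)).trans (isConj_iff.2 ⟨s i * s (i + 1), ?_⟩)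
    rw [mul_inv_eq_iff_eq_mul, h.braid i hi, mul_assoc]

/-- A sequence satisfying the braid relations whose members are different enough. -/
structure Nondeg (m : ℕ) (s : ℕ → Γ) : Prop extends BraidSeq m s where
  ne_succ : ∀ i, i + 1 < m → s i ≠ s (i + 1)
  ne_add_two : ∀ i, i + 2 < m → s i ≠ s (i + 2)

theorem nondeg (h : BraidSeq m s) (hm : 4 ≤ m) (hs : s 0 ≠ s 1) : Nondeg m s where
  toBraidSeq := h
  ne_succ i hi he := hs (h.eq_zero_of_eq_succ hi he 1 (by omega)).symm
  ne_add_two i hi he := by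
    have key : ∀ j, j + 1 < m → s j ≠ s (j + 1) := fun j hj he =>
      hs (h.eq_zero_of_eq_succ hj he 1 (by omega)).symm
    by_cases h3 : i + 3 < m
    · refine key (i + 2) h3 (eq_of_commute_of_braid (h.braid (i + 2) h3) ?_)
      rw [← he]; exact h.comm _ _ (by omega) h3
    · obtain ⟨k, rfl⟩ : ∃ k, i = k + 1 := ⟨i - 1, by omega⟩
      refine key k (by omega) (eq_of_commute_of_braid (h.braid k (by omega)) ?_)
      rw [he]; exact h.comm _ _ (by omega) hi

namespace Nondeg

theorem not_commute (h : Nondeg m s) {i : ℕ} (hi : i + 1 < m) : ¬ Commute (s i) (s (i + 1)) :=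
  fun hc => h.ne_succ i hi (eq_of_commute_of_braid (h.braid i hi) hc)

theorem ne_one (h : Nondeg m s) (hm : 2 ≤ m) : s 0 ≠ 1 := fun h0 =>
  h.not_commute (i := 0) hm (by rw [h0]; exact Commute.one_left _)

/-- The images of the last generators in a quotient of the centralizer of the first one. -/
theorem quotient (h : Nondeg m s) (hm : 2 ≤ m) {C : Subgroup Γ} (N : Subgroup C) [N.Normal]
    (hC : ∀ i, 2 ≤ i → i < m → s i ∈ C) (hN : ∀ c ∈ N, ∀ x : C, c * x = x * c) :
    Nondeg (m - 2) fun i => if hi : i + 2 < m then (QuotientGroup.mk ⟨s (i + 2), hC _ (by omega) hi⟩ : C ⧸ N)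
      else 1 where
  braid i hi := by
    rw [dif_pos (by omega), dif_pos (by omega)]
    have := h.braid (i + 2) (by omega)
    refine congrArg (QuotientGroup.mk (s := N)) (Subtype.ext ?_)
    simpa [show i + 2 + 1 = i + 1 + 2 by omega] using this
  comm i j hi hj := by
    rw [dif_pos (by omega), dif_pos (by omega)]
    have := h.comm (i + 2) (j + 2) (by omega) (by omega)
    exact congrArg (QuotientGroup.mk (s := N)) (Subtype.ext this)
  ne_succ i hi he := by
    rw [dif_pos (by omega), dif_pos (by omega), QuotientGroup.eq] at he
    have hb := h.braid (i + 2) (by omega)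
    have hc := fun x hx => congrArg Subtype.val (hN _ he ⟨x, hx⟩)
    simp only [Subgroup.coe_mul, Subgroup.coe_inv] at hc
    refine h.ne_succ (i + 2) (by omega) ?_
    rw [← inv_mul_eq_one]
    refine eq_one_of_braid_mul (x := s (i + 2)) (y := s (i + 2)) rfl ?_
      (hc _ (hC _ (by omega) (by omega))) (hc _ (hC _ (by omega) (by omega)))
    rw [mul_inv_cancel_left]
    exact hb.symm
  ne_add_two i hi he := by
    rw [dif_pos (by omega), dif_pos (by omega), QuotientGroup.eq] at he
    have hb := h.braid (i + 2) (by omega)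
    have hb' := h.braid (i + 2 + 1) (by omega)
    have hc := fun x hx => congrArg Subtype.val (hN _ he ⟨x, hx⟩)
    simp only [Subgroup.coe_mul, Subgroup.coe_inv] at hc
    refine h.ne_add_two (i + 2) (by omega) ?_
    rw [← inv_mul_eq_one]
    refine eq_one_of_braid_mul (x := s (i + 2)) (y := s (i + 2 + 1)) hb ?_
      (hc _ (hC _ (by omega) (by omega))) (hc _ (hC _ (by omega) (by omega)))
    rw [mul_inv_cancel_left]
    exact hb'.symm

end Nondeg

/-- The band generators: `band s i k` corresponds to the pair `i`, `i + 1 + k`. -/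
def band (s : ℕ → Γ) (i : ℕ) : ℕ → Γ
  | 0 => s i
  | k + 1 => s (i + 1 + k) * band s i k * (s (i + 1 + k))⁻¹

theorem isConj_band (h : BraidSeq m s) {i : ℕ} (hi : i < m) (k : ℕ) : IsConj (s 0) (band s i k) := by
  induction k with
  | zero => exact h.isConj i hi
  | succ k ih => exact ih.trans (isConj_iff.2 ⟨_, rfl⟩)

theorem commute_conj_iff (x y z : Γ) : Commute x (y * z * y⁻¹) ↔ Commute (y⁻¹ * x * y) z := by
  have := (MulAut.conj y).injective.eq_iff (a := (y⁻¹ * x * y) * z) (b := z * (y⁻¹ * x * y))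
  simp only [MulAut.conj_apply] at this
  rw [Commute, SemiconjBy, Commute, SemiconjBy, ← this]
  group

theorem commute_conj_iff_of_commute {x y : Γ} (h : Commute x y) (z : Γ) :
    Commute x (y * z * y⁻¹) ↔ Commute x z := by
  rw [commute_conj_iff, mul_assoc, h.eq, inv_mul_cancel_left]

theorem band_comm_gt (h : BraidSeq m s) {i l : ℕ} (hl : l < m) :
    ∀ k, i + 1 + k < l → Commute (s l) (band s i k) := by
  intro k
  induction k with
  | zero => intro hk; exact (h.comm i l (by omega) hl).symm
  | succ k ih =>
    intro hk
    rw [band, commute_conj_iff_of_commute (h.comm (i + 1 + k) l (by omega) hl).symm]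
    exact ih (by omega)

theorem band_comm_lt (h : BraidSeq m s) {i l : ℕ} (hl : l + 1 < i) :
    ∀ k, i + k < m → Commute (s l) (band s i k) := by
  intro k
  induction k with
  | zero => intro hk; exact h.comm l i (by omega) hk
  | succ k ih =>
    intro hk
    rw [band, commute_conj_iff_of_commute (h.comm l (i + 1 + k) (by omega) (by omega))]
    exact ih (by omega)

theorem band_comm_mid (h : BraidSeq m s) {i l : ℕ} (hl : i < l) :
    ∀ k, i + k < m → l < i + k → Commute (s l) (band s i k) := by
  intro k
  induction k with
  | zero => intro _ hk; omega
  | succ k ih =>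
    intro hk hk'
    obtain hlk | rfl : l < i + k ∨ l = i + k := by omega
    · rw [band, commute_conj_iff_of_commute (h.comm l (i + 1 + k) (by omega) (by omega))]
      exact ih (by omega) hlk
    · obtain ⟨k, rfl⟩ : ∃ k', k = k' + 1 := ⟨k - 1, by omega⟩
      have hb := h.braid (i + (k + 1)) (by omega)
      rw [band, show i + 1 + (k + 1) = i + (k + 1) + 1 by omega, commute_conj_iff]
      have e : (s (i + (k + 1) + 1))⁻¹ * s (i + (k + 1)) * s (i + (k + 1) + 1) =
          s (i + (k + 1)) * s (i + (k + 1) + 1) * (s (i + (k + 1)))⁻¹ := by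
        rw [eq_mul_inv_iff_mul_eq, mul_assoc, mul_assoc, inv_mul_eq_iff_eq_mul, ← mul_assoc, hb,
          mul_assoc]
      rw [e, band, show i + 1 + k = i + (k + 1) by omega]
      have := h.band_comm_gt (i := i) (l := i + (k + 1) + 1) (by omega) k (by omega)
      have h3 := (Commute.conj_iff (s (i + (k + 1)))).2 this
      exact h3

theorem Nondeg.band_right (h : Nondeg m s) {i : ℕ} :
    ∀ k, i + k + 1 < m → ¬ Commute (s (i + k + 1)) (band s i k) := by
  intro k
  induction k with
  | zero => intro hk hc; exact h.not_commute (i := i) hk hc.symm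
  | succ k ih =>
    intro hk hc
    have hb := h.braid (i + k + 1) (by omega)
    rw [band, show i + 1 + k = i + k + 1 by omega, commute_conj_iff,
      show i + (k + 1) + 1 = i + k + 1 + 1 by omega] at hc
    have e : (s (i + k + 1))⁻¹ * s (i + k + 1 + 1) * s (i + k + 1) =
        s (i + k + 1 + 1) * s (i + k + 1) * (s (i + k + 1 + 1))⁻¹ := by
      rw [eq_mul_inv_iff_mul_eq, mul_assoc, mul_assoc, inv_mul_eq_iff_eq_mul, ← mul_assoc, ← hb,
        mul_assoc]
    rw [e] at hc
    have := (commute_conj_iff_of_commute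
      (h.band_comm_gt (i := i) (l := i + k + 1 + 1) (by omega) k (by omega)).symm _).1 hc.symm
    exact ih (by omega) this.symm

theorem Nondeg.band_right' (h : Nondeg m s) {i : ℕ} (k : ℕ) (hk : i + k + 1 < m) :
    ¬ Commute (s (i + k + 1)) (band s i (k + 1)) := by
  rw [band, show i + 1 + k = i + k + 1 by omega, commute_conj_iff_of_commute (Commute.refl _)]
  exact h.band_right k hk

theorem Nondeg.band_left (h : Nondeg m s) {i : ℕ} :
    ∀ k, i + 1 + k < m → ¬ Commute (s i) (band s (i + 1) k) := by
  intro k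
  induction k with
  | zero => intro hk hc; exact h.not_commute (i := i) hk hc
  | succ k ih =>
    intro hk
    rw [band, commute_conj_iff_of_commute (h.comm i (i + 1 + 1 + k) (by omega) (by omega))]
    exact ih (by omega)

theorem band_succ_left (h : BraidSeq m s) {i : ℕ} :
    ∀ k, i + 1 + k < m → band s (i + 1) k = s i * band s i (k + 1) * (s i)⁻¹ := by
  intro k
  induction k with
  | zero =>
    intro hk
    have hb := h.braid i (by omega)
    simp only [band, add_zero]
    rw [eq_mul_inv_iff_mul_eq, ← mul_assoc, eq_mul_inv_iff_mul_eq, ← mul_assoc, ← hb]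
  | succ k ih =>
    intro hk
    have hc := h.comm i (i + 1 + 1 + k) (by omega) (by omega)
    rw [band, ih (by omega), band.eq_2 s i (k + 1), show i + 1 + (k + 1) = i + 1 + 1 + k by omega]
    calc _ = (s (i + 1 + 1 + k) * s i) * band s i (k + 1) * (s (i + 1 + 1 + k) * s i)⁻¹ := by
          simp only [mul_inv_rev, mul_assoc]
      _ = _ := by rw [← hc]; simp only [mul_inv_rev, mul_assoc]

theorem Nondeg.band_left' (h : Nondeg m s) {i : ℕ} (k : ℕ) (hk : i + 1 + k < m) :
    ¬ Commute (s i) (band s i (k + 1)) := by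
  have := h.band_left k hk
  rwa [h.band_succ_left k hk, commute_conj_iff_of_commute (Commute.refl _)] at this

theorem Nondeg.band_commute_iff (h : Nondeg m s) {i k l : ℕ} (hik : i + k < m) (hl : l < m) :
    Commute (s l) (band s i k) ↔
      ((l = i ∨ l = i + 1 + k) ↔ (l + 1 = i ∨ l + 1 = i + 1 + k)) := by
  rcases lt_trichotomy (l + 1) i with h1 | h1 | h1
  · have := h.band_comm_lt h1 k hik
    exact iff_of_true this (by omega)
  · subst h1
    have := h.band_left k hik
    exact iff_of_false this (by omega)
  rcases lt_trichotomy l (i + 1 + k) with h2 | h2 | h2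
  · rcases k with _ | k
    · obtain rfl : l = i := by omega
      have : Commute (s l) (band s l 0) := Commute.refl _
      exact iff_of_true this (by omega)
    obtain rfl | h3 | rfl : l = i ∨ (i < l ∧ l < i + (k + 1)) ∨ l = i + (k + 1) := by omega
    · have := h.band_left' (i := l) k (by omega)
      exact iff_of_false this (by omega)
    · have := h.band_comm_mid h3.1 (k + 1) hik h3.2
      exact iff_of_true this (by omega)
    · have := h.band_right' (i := i) k (by omega)
      rw [show i + k + 1 = i + (k + 1) by omega] at this
      exact iff_of_false this (by omega)
  · subst h2
    have := h.band_right (i := i) k (by omega)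
    rw [show i + k + 1 = i + 1 + k by omega] at this
    exact iff_of_false this (by omega)
  · have := h.band_comm_gt (i := i) hl k (by omega)
    exact iff_of_true this (by omega)

theorem Nondeg.band_inj (h : Nondeg m s) (hm : m ≠ 3) (hm2 : 2 ≤ m) {i k i' k' : ℕ} (hik : i + k < m)
    (hik' : i' + k' < m) (he : band s i k = band s i' k') : i = i' ∧ k = k' := by
  have h1 : ∀ l, l ≤ m → (((l = i ∨ l = i + 1 + k) ↔ (l = i' ∨ l = i' + 1 + k')) ↔
      ((0 = i ∨ 0 = i + 1 + k) ↔ (0 = i' ∨ 0 = i' + 1 + k'))) := by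
    intro l
    induction l with
    | zero => intro _; exact Iff.rfl
    | succ l ih =>
      intro hl
      have e1 := h.band_commute_iff hik (l := l) (by omega)
      have e2 := h.band_commute_iff hik' (l := l) (by omega)
      rw [he, e2] at e1
      refine Iff.trans ?_ (ih (by omega))
      rw [Iff.comm (a := l = i' ∨ l = i' + 1 + k')] at e1
      generalize (l = i ∨ l = i + 1 + k) = a at *
      generalize (l = i' ∨ l = i' + 1 + k') = b at *
      generalize (l + 1 = i ∨ l + 1 = i + 1 + k) = c at *
      generalize (l + 1 = i' ∨ l + 1 = i' + 1 + k') = d at *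
      clear ih
      by_cases a <;> by_cases b <;> by_cases c <;> by_cases d <;> simp_all
  by_cases h0 : (0 = i ∨ 0 = i + 1 + k) ↔ (0 = i' ∨ 0 = i' + 1 + k')
  · simp only [h0, iff_true] at h1
    have a1 := (h1 i (by omega)).1 (Or.inl rfl)
    have a2 := (h1 (i + 1 + k) (by omega)).1 (Or.inr rfl)
    omega
  · exfalso
    simp only [h0, iff_false] at h1
    have a0 := h1 0 (by omega)
    have a1 := h1 1 (by omega)
    have a2 := h1 2 (by omega)
    by_cases hm3 : m = 2
    · omega
    have a3 := h1 3 (by omega)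
    have a4 := h1 4 (by omega)
    omega

end BraidSeq

end

section

open scoped Nat

namespace BraidSeq

universe u

theorem inv_conj_of_braid {Γ : Type*} [Group Γ] {x y : Γ} (h : x * y * x = y * x * y) :
    y⁻¹ * x * y = x * y * x⁻¹ := by
  rw [eq_mul_inv_iff_mul_eq, mul_assoc, mul_assoc, inv_mul_eq_iff_eq_mul, ← mul_assoc, h, mul_assoc]

section Counting

variable {Γ : Type*} [Group Γ] [Finite Γ]

theorem card_mul_card_centralizer_le {ι : Type*} (f : ι → Γ) (hf : f.Injective) (x : Γ)
    (hx : ∀ i, IsConj x (f i)) :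
    Nat.card ι * Nat.card (Subgroup.centralizer {x}) ≤ Nat.card Γ := by
  choose g hg using fun i => isConj_iff.1 (hx i)
  rw [Subgroup.card_eq_card_quotient_mul_card_subgroup (Subgroup.centralizer {x})]
  refine Nat.mul_le_mul_right _ (Nat.card_le_card_of_injective
    (fun i => (QuotientGroup.mk (g i) : Γ ⧸ Subgroup.centralizer {x})) fun i j hij => hf ?_)
  have := Subgroup.mem_centralizer_singleton_iff.1 (QuotientGroup.eq.1 hij)
  rw [← hg i, ← hg j, mul_inv_eq_iff_eq_mul]
  have h2 : x * ((g i)⁻¹ * g j) = (g i)⁻¹ * g j * x := this.symm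
  have := congrArg (fun z => g i * z * (g j)⁻¹ * g i) h2
  simpa [mul_assoc] using this

theorem card_mul_card_centralizer_le_of_nodup (l : List Γ) (hl : l.Nodup) (x : Γ)
    (hx : ∀ y ∈ l, IsConj x y) :
    l.length * Nat.card (Subgroup.centralizer {x}) ≤ Nat.card Γ := by
  have := card_mul_card_centralizer_le l.get (List.nodup_iff_injective_get.1 hl) x
    fun i => hx _ (List.get_mem l i)
  simpa using this

theorem orderOf_le_card_centralizer (x : Γ) : orderOf x ≤ Nat.card (Subgroup.centralizer {x}) := by
  have hx : x ∈ Subgroup.centralizer {x} := Subgroup.mem_centralizer_singleton_iff.2 rfl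
  have := orderOf_le_card (G := Subgroup.centralizer {x}) (x := ⟨x, hx⟩)
  rwa [Subgroup.orderOf_mk] at this

theorem two_le_orderOf {x : Γ} (hx : x ≠ 1) : 2 ≤ orderOf x := by
  have h1 := orderOf_pos x
  have h2 : orderOf x ≠ 1 := fun h => hx (orderOf_eq_one_iff.1 h)
  omega

end Counting

variable {Γ : Type*} [Group Γ] {m : ℕ} {s : ℕ → Γ}

theorem Nondeg.card_pairs_mul_card_centralizer_le [Finite Γ] (h : Nondeg m s) (hm : m ≠ 3)
    (hm2 : 2 ≤ m) :
    (m + 1) * m * Nat.card (Subgroup.centralizer {s 0}) ≤ 2 * Nat.card Γ := by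
  have hc : Nat.card (Σ t : Fin m, Fin (t + 1)) * 2 = (m + 1) * m := by
    rw [Nat.card_sigma]
    simp only [Nat.card_eq_fintype_card, Fintype.card_fin]
    rw [Fin.sum_univ_eq_sum_range fun i => i + 1]
    have := Finset.sum_range_id_mul_two (m + 1)
    rw [Finset.sum_range_succ'] at this
    simpa using this
  rw [← hc, mul_comm _ 2, mul_assoc]
  refine Nat.mul_le_mul_left _ (card_mul_card_centralizer_le
    (fun x : Σ t : Fin m, Fin (t + 1) => band s (x.1 - x.2) x.2) ?_ _ ?_)
  · rintro ⟨⟨t, ht⟩, ⟨k, hk⟩⟩ ⟨⟨t', ht'⟩, ⟨k', hk'⟩⟩ he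
    simp only at hk hk' he
    obtain ⟨h1, rfl⟩ := h.band_inj hm hm2 (by omega) (by omega) he
    obtain rfl : t = t' := by omega
    rfl
  · rintro ⟨⟨t, ht⟩, ⟨k, hk⟩⟩
    exact h.isConj_band (by simp only; omega) _

theorem Nondeg.four_le_card_centralizer [Finite Γ] (h : Nondeg 3 s) :
    4 ≤ Nat.card (Subgroup.centralizer {s 0}) := by
  have key : ∀ l : List (Subgroup.centralizer {s 0}), l.Nodup →
      l.length ≤ Nat.card (Subgroup.centralizer {s 0}) := by
    intro l hl
    have := Nat.card_le_card_of_injective l.get (List.nodup_iff_injective_get.1 hl)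
    simpa using this
  have key : ∀ l : List Γ, l.Nodup → (∀ x ∈ l, x ∈ Subgroup.centralizer {s 0}) →
      l.length ≤ Nat.card (Subgroup.centralizer {s 0}) := by
    intro l hl hm
    have := key (l.attachWith _ hm) ?_
    · simpa using this
    · rw [← List.nodup_map_iff Subtype.val_injective]
      simpa using hl
  have h02 := h.ne_add_two 0 (by omega)
  have c02 := h.comm 0 2 (by omega) (by omega)
  have b01 := h.braid 0 (by omega)
  have b12 := h.braid 1 (by omega)
  have n01 := h.ne_succ 0 (by omega)
  have h0 := h.ne_one (by omega)
  have h2 : s 2 ≠ 1 := fun h2 => h.not_commute (i := 1) (by omega) (by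
    rw [h2]; exact Commute.one_right _)
  simp only [zero_add] at *
  have c0 : s 0 ∈ Subgroup.centralizer {s 0} := Subgroup.mem_centralizer_singleton_iff.2 rfl
  have c2 : s 2 ∈ Subgroup.centralizer {s 0} := Subgroup.mem_centralizer_singleton_iff.2 c02.symm
  by_cases hp : s 0 * s 2 = 1
  · have e2 : s 2 = (s 0)⁻¹ := eq_inv_of_mul_eq_one_right hp
    by_cases h3 : s 0 * s 0 * s 0 = 1
    · exfalso
      rw [show (1 : ℕ) + 1 = 2 from rfl, e2] at b12
      generalize s 0 = x at *
      generalize s 1 = y at *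
      have e1 := inv_conj_of_braid b01
      have e2 := congrArg (·⁻¹) (inv_conj_of_braid b12.symm)
      simp only [mul_inv_rev, inv_inv, ← mul_assoc] at e2
      rw [e1] at e2
      have hx : x⁻¹ = x * x := (eq_inv_of_mul_eq_one_left h3).symm
      have e3 : x * (x * y * x⁻¹) * x⁻¹ = y⁻¹ := by rw [e2]; group
      have e4 : x * (x * y * x⁻¹) * x⁻¹ = x⁻¹ * y * x := by
        have hx' : x⁻¹ * x⁻¹ = x := by rw [← mul_inv_rev, ← hx, inv_inv]
        calc _ = (x * x) * y * (x⁻¹ * x⁻¹) := by simp only [mul_assoc]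
          _ = _ := by rw [hx', ← hx]
      have e5 : x * y⁻¹ * x⁻¹ = y := by rw [← e3, e4]; group
      have e6 : x * y * x⁻¹ = y⁻¹ := by rw [← inv_inj]; simpa [mul_assoc] using e5
      have e7 : y = y⁻¹ := by rw [← e3, e6, e5]
      rw [← e7, mul_inv_eq_iff_eq_mul] at e6
      exact n01 (eq_of_commute_of_braid b01 e6)
    · refine key [1, s 0, (s 0)⁻¹, s 0 * s 0] ?_ ?_
      · have a1 : (1 : Γ) ≠ (s 0)⁻¹ := fun e => h0 (inv_eq_one.1 e.symm)
        have a2 : s 0 ≠ (s 0)⁻¹ := by rw [← e2]; exact h02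
        have a3 : (1 : Γ) ≠ s 0 * s 0 := fun e => a2 (eq_inv_of_mul_eq_one_left e.symm)
        have a4 : (s 0)⁻¹ ≠ s 0 * s 0 := fun e => h3 (by rw [← e, inv_mul_cancel])
        simp [h0.symm, a1, a2, a3, a4, h0]
      · simp [c0, Subgroup.one_mem, Subgroup.mul_mem, Subgroup.inv_mem]
  · refine key [1, s 0, s 2, s 0 * s 2] ?_ ?_
    · simp [h0.symm, h2.symm, h02, h0, h2, Ne.symm hp]
    · simp [c0, c2, Subgroup.one_mem, Subgroup.mul_mem]

theorem Nondeg.card_ge_three [Finite Γ] (h : Nondeg 3 s) : 24 ≤ Nat.card Γ := by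
  have h4 := h.four_le_card_centralizer
  have h02 := h.ne_add_two 0 (by omega)
  have n1 : ¬ Commute (s 1) (s 0) := fun hc => h.not_commute (i := 0) (by omega) hc.symm
  have n0 : ¬ Commute (s 0) (s 1) := fun hc => n1 hc.symm
  have n2 : ¬ Commute (s 1) (s 2) := h.not_commute (i := 1) (by omega)
  have c2 : Commute (s 0) (s 2) := h.comm 0 2 (by omega) (by omega)
  have c0 : Commute (s 0) (s 0) := Commute.refl _
  have c1 : Commute (s 1) (s 1) := Commute.refl _
  set x3 := s 1 * s 0 * (s 1)⁻¹ with hx3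
  set x4 := s 1 * s 2 * (s 1)⁻¹ with hx4
  set x5 := s 2 * x3 * (s 2)⁻¹ with hx5
  have p30 : ¬ Commute (s 0) x3 := h.band_left' (i := 0) 0 (by omega)
  have p31 : ¬ Commute (s 1) x3 := h.band_right' (i := 0) 0 (by omega)
  have p40 : ¬ Commute (s 0) x4 := by
    rw [hx4, commute_conj_iff, inv_conj_of_braid (h.braid 0 (by omega))]
    exact fun hc => n2 ((commute_conj_iff_of_commute c2.symm _).1 hc.symm).symm
  have p41 : ¬ Commute (s 1) x4 := by
    rw [hx4, commute_conj_iff_of_commute (Commute.refl _)]; exact n2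
  have p50 : ¬ Commute (s 0) x5 := h.band_left' (i := 0) 1 (by omega)
  have p51 : Commute (s 1) x5 := h.band_comm_mid (i := 0) (l := 1) (by omega) 2 (by omega) (by omega)
  have n34 : x3 ≠ x4 := by
    intro e
    exact h02 (by simpa [hx3, hx4] using e)
  have n15 : s 1 ≠ x5 := by
    intro e
    apply n34
    have hb := h.braid 1 (by omega)
    simp only [Nat.reduceAdd] at hb
    rw [hx5, eq_mul_inv_iff_mul_eq, ← inv_mul_eq_iff_eq_mul] at e
    rw [← e, hx4, eq_mul_inv_iff_mul_eq, mul_assoc, mul_assoc, inv_mul_eq_iff_eq_mul, ← mul_assoc, hb,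
      mul_assoc]
  have q : ∀ {x y z : Γ}, Commute x y → ¬ Commute x z → y ≠ z := fun a b e => b (e ▸ a)
  have := card_mul_card_centralizer_le_of_nodup [s 0, s 2, s 1, x5, x3, x4] (by
    simp only [List.nodup_cons, List.mem_cons, List.not_mem_nil, or_false, not_or,
      not_false_eq_true, List.nodup_nil, and_true]
    exact ⟨⟨h02, q c0 n0, q c0 p50, q c0 p30, q c0 p40⟩, ⟨q c2 n0, q c2 p50, q c2 p30, q c2 p40⟩,
      ⟨n15, q c1 p31, q c1 p41⟩, ⟨q p51 p31, q p51 p41⟩, n34⟩) (s 0) (by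
    have i0 : IsConj (s 0) (s 0) := IsConj.refl _
    have i1 := h.isConj 1 (by omega)
    have i2 := h.isConj 2 (by omega)
    have i3 : IsConj (s 0) x3 := isConj_iff.2 ⟨_, rfl⟩
    have i4 : IsConj (s 0) x4 := i2.trans (isConj_iff.2 ⟨_, rfl⟩)
    have i5 : IsConj (s 0) x5 := i3.trans (isConj_iff.2 ⟨_, rfl⟩)
    simp only [List.forall_mem_cons, i0, i1, i2, i3, i4, i5, true_and]
    simp)
  simp only [List.length_cons, List.length_nil] at this
  omega

theorem Nondeg.card_centralizer_ge {Γ : Type u} [Group Γ] [Finite Γ] {m : ℕ} {s : ℕ → Γ}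
    (h : Nondeg m s) (hm : 2 ≤ m) {r : ℕ}
    (hr : ∀ {Δ : Type u} [Group Δ] [Finite Δ] (s' : ℕ → Δ), Nondeg (m - 2) s' → r ≤ Nat.card Δ) :
    orderOf (s 0) * r ≤ Nat.card (Subgroup.centralizer {s 0}) := by
  set C := Subgroup.centralizer {s 0} with hC
  have h0 : s 0 ∈ C := Subgroup.mem_centralizer_singleton_iff.2 rfl
  let N : Subgroup C := Subgroup.zpowers ⟨s 0, h0⟩
  have hN : ∀ c ∈ N, ∀ x : C, c * x = x * c := by
    rintro _ ⟨k, rfl⟩ x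
    have : Commute (⟨s 0, h0⟩ : C) x :=
      Subtype.ext (Subgroup.mem_centralizer_singleton_iff.1 x.2).symm
    exact this.zpow_left k
  have : N.Normal := ⟨fun c hc x => by rw [← hN c hc, mul_inv_cancel_right]; exact hc⟩
  have h2 := hr _ (h.quotient hm N (fun i h1 h2 => Subgroup.mem_centralizer_singleton_iff.2
    (h.comm 0 i (by omega) h2).symm) hN)
  rw [Subgroup.card_eq_card_quotient_mul_card_subgroup N, Nat.card_zpowers, Subgroup.orderOf_mk,
    mul_comm]
  exact Nat.mul_le_mul_right _ h2

theorem Nondeg.factorial_le {m : ℕ} (hm : 2 ≤ m) : ∀ {Γ : Type u} [Group Γ] [Finite Γ] (s : ℕ → Γ),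
    Nondeg m s → (m + 1)! ≤ Nat.card Γ := by
  induction m using Nat.strong_induction_on with
  | _ m ih =>
    intro Γ _ _ s h
    by_cases h3 : m = 3
    · subst h3
      exact h.card_ge_three
    have hp := h.card_pairs_mul_card_centralizer_le h3 hm
    have ho := two_le_orderOf (h.ne_one hm)
    have hC : 2 * (m - 1)! ≤ Nat.card (Subgroup.centralizer {s 0}) := by
      by_cases h2 : m = 2
      · subst h2
        have := orderOf_le_card_centralizer (s 0)
        simpa using by omega
      · refine (Nat.mul_le_mul_right _ ho).trans (h.card_centralizer_ge hm fun {Δ} _ _ s' h' => ?_)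
        have := ih (m - 2) (by omega) (by omega) s' h'
        rwa [show m - 2 + 1 = m - 1 by omega] at this
    obtain ⟨k, rfl⟩ : ∃ k, m = k + 1 := ⟨m - 1, by omega⟩
    rw [Nat.factorial_succ, Nat.factorial_succ]
    simp only [Nat.add_sub_cancel] at hC
    have := Nat.mul_le_mul_left ((k + 1 + 1) * (k + 1)) hC
    nlinarith

/-! ### Symmetric groups -/

theorem Nondeg.orderOf_and_card {m : ℕ} (hm : 4 ≤ m) {s : ℕ → Equiv.Perm (Fin (m + 1))}
    (h : Nondeg m s) : orderOf (s 0) = 2 ∧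
      Nat.card (Subgroup.centralizer {s 0}) = 2 * (m - 1)! := by
  have hp := h.card_pairs_mul_card_centralizer_le (by omega) (by omega)
  have ho := two_le_orderOf (h.ne_one (by omega))
  have hC : orderOf (s 0) * (m - 1)! ≤ Nat.card (Subgroup.centralizer {s 0}) := by
    refine h.card_centralizer_ge (by omega) fun {Δ} _ _ s' h' => ?_
    have := Nondeg.factorial_le (m := m - 2) (by omega) s' h'
    rwa [show m - 2 + 1 = m - 1 by omega] at this
  have hcard : Nat.card (Equiv.Perm (Fin (m + 1))) = (m + 1) * m * (m - 1)! := by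
    rw [Nat.card_perm, Nat.card_eq_fintype_card, Fintype.card_fin]
    obtain ⟨k, rfl⟩ : ∃ k, m = k + 1 := ⟨m - 1, by omega⟩
    rw [Nat.factorial_succ, Nat.factorial_succ, Nat.add_sub_cancel, mul_assoc]
  rw [hcard] at hp
  have hle : Nat.card (Subgroup.centralizer {s 0}) ≤ 2 * (m - 1)! := by
    have hpos : 0 < (m + 1) * m := by positivity
    exact Nat.le_of_mul_le_mul_left (by linarith) hpos
  have hf : 0 < (m - 1)! := Nat.factorial_pos _
  have ho2 : orderOf (s 0) ≤ 2 := Nat.le_of_mul_le_mul_right (hC.trans hle) hf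
  have : orderOf (s 0) = 2 := le_antisymm ho2 ho
  exact ⟨this, le_antisymm hle (by rwa [this] at hC)⟩

theorem two_pow_mul_factorial_lt (t : ℕ) : 2 ^ (t + 3) * (t + 4)! < (2 * (t + 4) - 2)! := by
  rw [show 2 * (t + 4) - 2 = 2 * t + 6 by omega]
  induction t with
  | zero => decide
  | succ t ih =>
    rw [show 2 * (t + 1) + 6 = (2 * t + 6) + 1 + 1 by omega,
      show t + 1 + 4 = t + 4 + 1 by omega, Nat.factorial_succ, show t + 1 + 3 = t + 3 + 1 by omega,
      pow_succ]
    have h1 : 2 * (t + 4 + 1) ≤ (2 * t + 6 + 1 + 1) * (2 * t + 6 + 1) := by nlinarith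
    calc 2 ^ (t + 3) * 2 * ((t + 4 + 1) * (t + 4)!) =
        2 * (t + 4 + 1) * (2 ^ (t + 3) * (t + 4)!) := by ring
      _ < 2 * (t + 4 + 1) * (2 * t + 6)! := by
        exact Nat.mul_lt_mul_of_pos_left ih (by omega)
      _ ≤ _ := by
        rw [Nat.factorial_succ (2 * t + 6 + 1), Nat.factorial_succ (2 * t + 6), ← mul_assoc]
        exact Nat.mul_le_mul_right _ h1

theorem eq_one_or_of_factorial {n t : ℕ} (hn : 5 ≤ n) (ht : 1 ≤ t) (htn : 2 * t ≤ n)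
    (h : 2 ^ t * t ! * (n - 2 * t)! = 2 * (n - 2)!) : t = 1 ∨ t = 3 ∧ n = 6 := by
  obtain ⟨t, rfl⟩ : ∃ k, t = k + 1 := ⟨t - 1, by omega⟩
  have hd : (2 * (t + 1) - 2)! * (n - 2 * (t + 1))! ≤ (n - 2)! := by
    have := Nat.factorial_mul_factorial_dvd_factorial_add (2 * (t + 1) - 2) (n - 2 * (t + 1))
    rw [show 2 * (t + 1) - 2 + (n - 2 * (t + 1)) = n - 2 by omega] at this
    exact Nat.le_of_dvd (Nat.factorial_pos _) this
  have hpos := Nat.factorial_pos (n - 2 * (t + 1))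
  have h1 : 2 ^ t * (t + 1)! * (n - 2 * (t + 1))! = (n - 2)! := by
    rw [pow_succ] at h; linarith
  rcases t with _ | _ | _ | t
  · left; rfl
  · exfalso
    obtain ⟨k, rfl⟩ : ∃ k, n = k + 4 := ⟨n - 4, by omega⟩
    simp only [show k + 4 - 2 = k + 1 + 1 by omega, show k + 4 - 2 * (0 + 1 + 1) = k by omega,
      Nat.factorial_succ] at h1 hpos
    have : (2 * 2 : ℕ) * k ! = (k + 1 + 1) * (k + 1) * k ! := by
      simp at h1; linarith
    have := Nat.eq_of_mul_eq_mul_right hpos this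
    have : k = 1 ∨ 2 ≤ k := by omega
    rcases this with rfl | hk
    · omega
    · nlinarith
  · right
    refine ⟨rfl, ?_⟩
    obtain ⟨k, rfl⟩ : ∃ k, n = k + 6 := ⟨n - 6, by omega⟩
    simp only [show k + 6 - 2 = k + 1 + 1 + 1 + 1 by omega,
      show k + 6 - 2 * (0 + 1 + 1 + 1) = k by omega, Nat.factorial_succ] at h1 hpos
    have : (24 : ℕ) * k ! = (k + 1 + 1 + 1 + 1) * (k + 1 + 1 + 1) * (k + 1 + 1) * (k + 1) * k ! := by
      simp at h1; linarith
    have := Nat.eq_of_mul_eq_mul_right hpos this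
    rcases Nat.eq_zero_or_pos k with rfl | hk
    · rfl
    · exfalso
      have a1 : 2 * 3 ≤ (k + 1) * (k + 1 + 1) := Nat.mul_le_mul (by omega) (by omega)
      have a2 : 4 * 5 ≤ (k + 1 + 1 + 1) * (k + 1 + 1 + 1 + 1) := Nat.mul_le_mul (by omega) (by omega)
      have := Nat.mul_le_mul a1 a2
      nlinarith
  · exfalso
    have h2 := two_pow_mul_factorial_lt t
    have h3 := Nat.mul_lt_mul_of_pos_right h2 hpos
    rw [show t + 1 + 1 + 1 = t + 3 by omega, show t + 3 + 1 = t + 4 by omega] at *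
    omega

theorem Nondeg.isSwap_or {m : ℕ} (hm : 4 ≤ m) {s : ℕ → Equiv.Perm (Fin (m + 1))}
    (h : Nondeg m s) : (s 0).IsSwap ∨ m = 5 ∧ s 0 * s 0 = 1 ∧ ∀ a, s 0 a ≠ a := by
  obtain ⟨ho, hc⟩ := h.orderOf_and_card hm
  obtain ⟨t, ht⟩ := Equiv.Perm.cycleType_prime_order (σ := s 0) (by rw [ho]; exact Nat.prime_two)
  rw [ho] at ht
  have hs := (s 0).sum_cycleType
  have hle := (s 0).sum_cycleType_le
  rw [Equiv.Perm.nat_card_centralizer] at hc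
  rw [ht] at hc hs hle
  simp only [Multiset.sum_replicate, Fintype.card_fin, Multiset.prod_replicate, smul_eq_mul,
    Multiset.toFinset_replicate, Nat.succ_ne_zero, if_false, Finset.prod_singleton,
    Multiset.count_replicate_self] at hc hs hle
  rcases eq_one_or_of_factorial (n := m + 1) (t := t + 1) (by omega) (by omega) (by omega) (by
    rw [show m + 1 - 2 = m - 1 by omega, ← hc, mul_comm 2 (t + 1)]; ring) with h1 | ⟨h1, h2⟩
  · left
    rw [← Equiv.Perm.card_support_eq_two, ← hs, h1]
  · right
    refine ⟨by omega, by rw [← pow_two, ← ho, pow_orderOf_eq_one], fun a ha => ?_⟩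
    have : (s 0).support = Finset.univ := by
      apply Finset.eq_univ_of_card
      rw [← hs, Fintype.card_fin]; omega
    have ha' : a ∈ (s 0).support := by rw [this]; exact Finset.mem_univ _
    exact Equiv.Perm.mem_support.1 ha' ha

end BraidSeq

end

section

open scoped commutatorElement

namespace BG

section Perfect

theorem commutatorElement_mul_central {G : Type*} [Group G] {z w : G} (hz : ∀ g, g * z = z * g)
    (hw : ∀ g, g * w = w * g) (a b : G) : ⁅a * z, b * w⁆ = ⁅a, b⁆ := by
  have h1 : ∀ x y z : G, Commute y z → ⁅x * z, y⁆ = ⁅x, y⁆ := fun x y z h => by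
    rw [commutatorElement_def, commutatorElement_def, mul_inv_rev, mul_assoc x, h.symm.eq]
    group
  rw [h1 _ _ _ (hz _), ← inv_inj, commutatorElement_inv, commutatorElement_inv, h1 _ _ _ (hw _)]

theorem le_commutator_map {G H : Type*} [Group G] [Group H] (f : G →* H) {V : Subgroup G}
    (h : V ≤ ⁅V, V⁆) : V.map f ≤ ⁅V.map f, V.map f⁆ := by
  rw [← Subgroup.map_commutator]
  exact Subgroup.map_mono h

theorem le_commutator_comap {G H : Type*} [Group G] [Group H] {f : G →* H}
    (hf : Function.Injective f) {V : Subgroup H} (hV : V ≤ f.range) (h : V ≤ ⁅V, V⁆) :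
    V.comap f ≤ ⁅V.comap f, V.comap f⁆ := by
  rw [← Subgroup.map_le_map_iff_of_injective hf, Subgroup.map_commutator,
    Subgroup.map_comap_eq_self hV]
  exact h

theorem eq_bot_of_le_commutator {α : Type*} {V : Subgroup (FreeGroup α)} (h : V ≤ ⁅V, V⁆) :
    V = ⊥ := by
  have hfree : IsFreeGroup V := inferInstance
  have htop : commutator V = ⊤ := by
    rw [eq_top_iff, ← Subgroup.map_le_map_iff_of_injective V.subtype_injective, commutator_def,
      Subgroup.map_commutator, ← MonoidHom.range_eq_map, Subgroup.range_subtype]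
    exact h
  obtain hg | ⟨⟨g⟩⟩ := isEmpty_or_nonempty (IsFreeGroup.Generators V)
  · have : Subsingleton V := (IsFreeGroup.toFreeGroup V).toEquiv.subsingleton
    exact (Subgroup.eq_bot_iff_forall _).2 fun x hx =>
      congrArg Subtype.val (Subsingleton.elim (⟨x, hx⟩ : V) 1)
  · exfalso
    let φ : V →* Multiplicative ℤ := IsFreeGroup.lift fun _ => Multiplicative.ofAdd 1
    have h1 : φ (IsFreeGroup.of g) = Multiplicative.ofAdd 1 := IsFreeGroup.lift_of _ _
    have h2 : IsFreeGroup.of g ∈ φ.ker :=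
      Abelianization.commutator_subset_ker φ (htop ▸ Subgroup.mem_top _)
    rw [MonoidHom.mem_ker, h1] at h2
    exact absurd (congrArg Multiplicative.toAdd h2) (by simp)

theorem inc_eq {m : ℕ} (h : Semi m) : inc h = kf h.left * up h.right := by
  rw [← inc_inl, ← inc_inr, ← map_mul, SemidirectProduct.inl_left_mul_inr_right]

theorem inc_injective {m : ℕ} : Function.Injective (inc (m := m)) := fun x y h => by
  rw [inc_eq, inc_eq] at h
  obtain ⟨h1, h2⟩ := kf_mul_up_inj h
  exact SemidirectProduct.ext h1 h2

/-- Pure braid groups contain no perfect subgroups. -/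
theorem eq_bot_of_isPure_of_le_commutator : ∀ {m : ℕ} {V : Subgroup (BG m)}, (∀ x ∈ V, IsPure x) →
    V ≤ ⁅V, V⁆ → V = ⊥ := by
  intro m
  induction m with
  | zero =>
    intro V _ _
    refine (Subgroup.eq_bot_iff_forall _).2 fun x _ => ?_
    exact mem_of_S (L := ⊥) (fun i hi => by omega) x
  | succ m ih =>
    intro V hV h
    have hr : V ≤ (inc (m := m)).range := fun x hx => by
      obtain ⟨f, b, rfl, -⟩ := (hV x hx).exists_kf_mul_up
      exact ⟨SemidirectProduct.inl f * SemidirectProduct.inr b, by simp⟩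
    have h1 := le_commutator_comap inc_injective hr h
    have h2 : (V.comap inc).map SemidirectProduct.rightHom = ⊥ := by
      refine ih ?_ (le_commutator_map _ h1)
      rintro _ ⟨x, hx, rfl⟩
      obtain ⟨f, b, hb, hb', -⟩ := (hV _ hx).exists_kf_mul_up
      rw [inc_eq] at hb
      rw [SemidirectProduct.rightHom_eq_right, (kf_mul_up_inj hb).2]
      exact hb'
    have h3 : V.comap inc ≤ (SemidirectProduct.inl : _ →* Semi m).range := by
      rw [SemidirectProduct.range_inl_eq_ker_rightHom]
      exact (Subgroup.map_eq_bot_iff _).1 h2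
    have h4 := eq_bot_of_le_commutator
      (le_commutator_comap SemidirectProduct.inl_injective h3 h1)
    rw [← Subgroup.map_comap_eq_self hr, ← Subgroup.map_comap_eq_self h3, h4]
    simp

end Perfect

variable {m : ℕ}

theorem braidSeq_S : BraidSeq m (S : ℕ → BG m) where
  braid _ hi := braid hi
  comm _ _ hi _ := comm hi

theorem commutator_le_ker_of_eq {H : Type*} [Group H] (f : BG m →* H)
    (h : ∀ i, i < m → f (S i) = f (S 0)) : commutator (BG m) ≤ f.ker := by
  have hz : ∀ b, f b ∈ Subgroup.zpowers (f (S 0)) := fun b => by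
    have := mem_of_S (L := (Subgroup.zpowers (f (S 0))).comap f) (fun i hi => by
      rw [Subgroup.mem_comap, h i hi]; exact Subgroup.mem_zpowers _) b
    exact this
  rw [commutator_def, Subgroup.commutator_le]
  intro a _ b _
  rw [MonoidHom.mem_ker, map_commutatorElement, commutatorElement_eq_one_iff_commute]
  obtain ⟨k, hk⟩ := hz a
  obtain ⟨l, hl⟩ := hz b
  simp only at hk hl
  rw [← hk, ← hl]
  exact (Commute.refl _).zpow_zpow _ _

theorem commutator_perfect (hm : 4 ≤ m) :
    commutator (BG m) ≤ ⁅commutator (BG m), commutator (BG m)⁆ := by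
  set D := commutator (BG m) with hD
  let q := QuotientGroup.mk' ⁅D, D⁆
  have hker : q.ker = ⁅D, D⁆ := QuotientGroup.ker_mk' _
  have hDm : ∀ i, i < m → S i * (S 0)⁻¹ ∈ D := fun i hi => by
    have h2 : (1 : BG m →* BG m).ker = ⊤ := by ext; simp
    obtain ⟨c, hc⟩ := isConj_iff.1 (braidSeq_S.isConj i hi)
    rw [← hc, ← commutatorElement_def]
    exact Subgroup.commutator_mem_commutator (Subgroup.mem_top _) (Subgroup.mem_top _)
  have hs := braidSeq_S.map q
  have h0 : Commute (q (S 2)) (q (S 3)) := by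
    have hc : Commute (q (S 2 * (S 0)⁻¹)) (q (S 3 * (S 0)⁻¹)) := by
      rw [← commutatorElement_eq_one_iff_commute, ← map_commutatorElement, ← MonoidHom.mem_ker, hker]
      exact Subgroup.commutator_mem_commutator (hDm 2 (by omega)) (hDm 3 (by omega))
    have c2 : Commute (q (S 0)) (q (S 2)) := (comm (m := m) (i := 0) (j := 2) le_rfl).map q
    have c3 : Commute (q (S 0)) (q (S 3)) := (comm (m := m) (i := 0) (j := 3) (by omega)).map q
    rw [map_mul, map_mul, map_inv] at hc
    have e2 : Commute (q (S 0)) (q (S 2) * (q (S 0))⁻¹) := c2.mul_right (Commute.refl _).inv_right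
    have e3 : Commute (q (S 0)) (q (S 3) * (q (S 0))⁻¹) := c3.mul_right (Commute.refl _).inv_right
    have h23 := (hc.mul_right e2.symm).mul_left (e3.mul_right (Commute.refl _))
    simpa using h23
  have h23 := BraidSeq.eq_of_commute_of_braid (hs.braid 2 (by omega)) h0
  have := commutator_le_ker_of_eq q (hs.eq_zero_of_eq_succ (i := 2) (by omega) h23)
  rwa [hker] at this

/-- The permutation induced on the strands by a braid modulo the center. -/
def permBar (hm : 2 ≤ m) : BG m ⧸ Subgroup.center (BG m) →* Equiv.Perm (Fin (m + 1)) :=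
  QuotientGroup.lift _ perm fun _ hb => isPure_of_mem_center hm hb

@[simp] theorem permBar_mk (hm : 2 ≤ m) (b : BG m) :
    permBar hm (QuotientGroup.mk b) = perm b := rfl

theorem S_zero_ne (hm : 2 ≤ m) : (QuotientGroup.mk (S 0) : BG m ⧸ Subgroup.center (BG m)) ≠
    QuotientGroup.mk (S 1) := by
  intro h
  have := congrArg (permBar hm) h
  rw [permBar_mk, permBar_mk, perm_S (by omega), perm_S (by omega)] at this
  have h2 := congrArg (fun s : Equiv.Perm (Fin (m + 1)) => s (str 0)) this
  simp only [Equiv.swap_apply_left] at h2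
  rw [Equiv.swap_apply_of_ne_of_ne (str_ne (by omega) (by omega) (by omega))
    (str_ne (by omega) (by omega) (by omega))] at h2
  exact str_ne (by omega) (by omega) (by omega) h2

theorem commutator_le_of_le_sup_center {G : Type*} [Group G] {W : Subgroup G}
    (h : W ≤ ⁅W, W⁆ ⊔ Subgroup.center G) : ⁅W, W⁆ ≤ ⁅⁅W, W⁆, ⁅W, W⁆⁆ := by
  refine Subgroup.commutator_le.2 fun a ha b hb => ?_
  obtain ⟨a', ha', z, hz, rfl⟩ := Subgroup.mem_sup_of_normal_right.1 (h ha)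
  obtain ⟨b', hb', w, hw, rfl⟩ := Subgroup.mem_sup_of_normal_right.1 (h hb)
  rw [commutatorElement_mul_central (Subgroup.mem_center_iff.1 hz) (Subgroup.mem_center_iff.1 hw)]
  exact Subgroup.commutator_mem_commutator ha' hb'

theorem eq_bot_of_le_commutator_of_isPure {E : Subgroup (BG m ⧸ Subgroup.center (BG m))}
    (hE : E ≤ ⁅E, E⁆) (hpure : ∀ x : BG m, QuotientGroup.mk x ∈ E → IsPure x) : E = ⊥ := by
  have hq : Function.Surjective (QuotientGroup.mk' (Subgroup.center (BG m))) :=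
    QuotientGroup.mk'_surjective _
  have hker : (QuotientGroup.mk' (Subgroup.center (BG m))).ker = Subgroup.center (BG m) :=
    QuotientGroup.ker_mk' _
  replace hpure : ∀ x : BG m, QuotientGroup.mk' (Subgroup.center (BG m)) x ∈ E → IsPure x := hpure
  generalize QuotientGroup.mk' (Subgroup.center (BG m)) = q at *
  have hqW : (E.comap q).map q = E := Subgroup.map_comap_eq_self_of_surjective hq _
  replace hpure : ∀ x ∈ E.comap q, IsPure x := hpure
  generalize hW : E.comap q = W at *
  have hWV : W ≤ ⁅W, W⁆ ⊔ Subgroup.center (BG m) := by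
    intro x hx
    have h1 : q x ∈ (⁅W, W⁆).map q := by
      rw [Subgroup.map_commutator, hqW]
      rw [← hW] at hx
      exact hE hx
    obtain ⟨y, hy, hyx⟩ := h1
    have : y⁻¹ * x ∈ Subgroup.center (BG m) := by
      rw [← hker, MonoidHom.mem_ker, map_mul, map_inv, hyx, inv_mul_cancel]
    rw [← mul_inv_cancel_left y x]
    exact mul_mem (Subgroup.mem_sup_left hy) (Subgroup.mem_sup_right this)
  have hV := commutator_le_of_le_sup_center hWV
  have hbot := eq_bot_of_isPure_of_le_commutator
    (fun x hx => hpure x (Subgroup.commutator_le_self W hx)) hV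
  rw [hbot, bot_sup_eq] at hWV
  rw [← hqW, Subgroup.map_eq_bot_iff, hker]
  exact hWV

theorem permBar_ne_of_injective (hm : 4 ≤ m)
    {ρ : BG m ⧸ Subgroup.center (BG m) →* BG m ⧸ Subgroup.center (BG m)}
    (hρ : Function.Injective ρ) :
    permBar (by omega) (ρ (QuotientGroup.mk (S 0))) ≠ permBar (by omega) (ρ (QuotientGroup.mk (S 1))) := by
  intro he
  have hm2 : 2 ≤ m := by omega
  have hs := braidSeq_S.map
    ((permBar hm2).comp (ρ.comp (QuotientGroup.mk' (Subgroup.center (BG m)))))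
  have hD := commutator_le_ker_of_eq _ (hs.eq_zero_of_eq_succ (i := 0) (by omega) he)
  have h01 : S 0 * (S 1)⁻¹ ∈ commutator (BG m) := by
    obtain ⟨c, hc⟩ := isConj_iff.1 (braidSeq_S.isConj 1 (show 1 < m by omega))
    rw [← inv_mem_iff, mul_inv_rev, inv_inv, ← hc, ← commutatorElement_def]
    exact Subgroup.commutator_mem_commutator (Subgroup.mem_top _) (Subgroup.mem_top _)
  have hbot := eq_bot_of_le_commutator_of_isPure
    (le_commutator_map (ρ.comp (QuotientGroup.mk' (Subgroup.center (BG m))))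
      (commutator_perfect hm)) (by
    rintro x ⟨d, hd, hx⟩
    have h1 := hD hd
    rw [IsPure, ← permBar_mk hm2, ← hx]
    exact h1)
  rw [Subgroup.map_eq_bot_iff] at hbot
  have h2 := hbot h01
  have h3 : ρ (QuotientGroup.mk (S 0 * (S 1)⁻¹)) = ρ 1 := by rw [map_one]; exact h2
  have h4 := hρ h3
  rw [QuotientGroup.mk_mul, QuotientGroup.mk_inv, mul_inv_eq_one] at h4
  exact S_zero_ne hm2 h4

end BG

end

section

open scoped commutatorElement

namespace BG

variable {m : ℕ}

/-- The projection of the braid group to its quotient by the center. -/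
def qk : BG m →* BG m ⧸ Subgroup.center (BG m) := QuotientGroup.mk' _

theorem qk_surjective : Function.Surjective (qk (m := m)) := QuotientGroup.mk'_surjective _

theorem qk_eq_one {a : BG m} : qk a = 1 ↔ a ∈ Subgroup.center (BG m) :=
  QuotientGroup.eq_one_iff a

theorem exists_mul_central_of_qk_eq {a b : BG m} (h : qk a = qk b) :
    ∃ z ∈ Subgroup.center (BG m), a = z * b :=
  ⟨a * b⁻¹, by rw [← qk_eq_one, map_mul, map_inv, h, mul_inv_cancel], by group⟩

theorem perm_congr (hm : 2 ≤ m) {a b : BG m} (h : qk a = qk b) : perm a = perm b := by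
  obtain ⟨z, hz, rfl⟩ := exists_mul_central_of_qk_eq h
  rw [map_mul, isPure_of_mem_center hm hz, one_mul]

theorem chi_congr (hm : 2 ≤ m) {a b : BG m} (h : qk a = qk b) :
    ∃ c, ∀ j k, j ≠ k → chi a j k = chi b j k + c := by
  obtain ⟨z, hz, rfl⟩ := exists_mul_central_of_qk_eq h
  obtain ⟨c, hc⟩ := chi_const_of_mem_center hm hz
  refine ⟨c, fun j k hjk => ?_⟩
  rw [chi_mul, hc _ _ ((perm b).injective.ne hjk)]

theorem chi_of_commute (hm : 2 ≤ m) {t h : BG m} (ht : IsPure t) (hc : Commute (qk h) (qk t))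
    {j k : Fin (m + 1)} (hjk : j ≠ k) : chi t (perm h j) (perm h k) = chi t j k := by
  obtain ⟨c, hc⟩ := chi_congr hm (a := h * t * h⁻¹) (b := t) (by
    rw [map_mul, map_mul, map_inv, hc.eq, mul_inv_cancel_right])
  have step : ∀ {j k : Fin (m + 1)}, j ≠ k → chi t (perm h j) (perm h k) + c = chi t j k := by
    intro j k hjk
    rw [← hc _ _ ((perm h).injective.ne hjk), chi_conj ht]
    simp
  have iter : ∀ n : ℕ, chi t ((perm h ^ n) j) ((perm h ^ n) k) + n * c = chi t j k := by
    intro n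
    induction n with
    | zero => simp
    | succ n ih =>
      rw [← ih, ← step ((perm h ^ n).injective.ne hjk), pow_succ']
      push_cast [Equiv.Perm.mul_apply]
      ring
  have h1 := iter (orderOf (perm h))
  have h2 := orderOf_pos (perm h)
  rw [pow_orderOf_eq_one] at h1
  have hc0 : c = 0 := by
    rcases mul_eq_zero.1 (show (orderOf (perm h) : ℤ) * c = 0 by simpa using h1) with h | h
    · omega
    · exact h
  rw [← step hjk, hc0, add_zero]

theorem commute_of_qk {a b : BG m} (ha : IsPure a) (hb : IsPure b) (h : Commute (qk a) (qk b)) :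
    Commute a b := by
  refine commute_of_mem_center hb ha ?_
  rw [← qk_eq_one, map_commutatorElement, commutatorElement_eq_one_iff_commute]
  exact h

theorem chi_even_of_isPure {t : BG m} (ht : IsPure t) {j k : Fin (m + 1)} (h : j ≠ k) :
    Even (chi t j k) := by
  rw [chi_parity t j k h, ht.perm_apply, ht.perm_apply]

theorem chi_sq_of_swap {y : BG m} {j k : Fin (m + 1)} (h1 : perm y j = k) (h2 : perm y k = j)
    (h : j ≠ k) : chi (y * y) j k % 4 = 2 := by
  rw [chi_mul, h1, h2, chi_symm y k j]
  have h3 := chi_parity y j k h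
  rw [h1, h2] at h3
  have h4 : ¬ Even (chi y j k) := by
    rw [h3]
    rcases lt_or_gt_of_ne h with h | h
    · exact fun h' => absurd (h'.1 h) (not_lt_of_gt h)
    · exact fun h' => absurd (h'.2 h) (not_lt_of_gt h)
  rw [Int.even_iff] at h4
  omega

theorem chi_sq_of_fixed {y : BG m} {j k : Fin (m + 1)} (h1 : perm y j = j) (h2 : perm y k = k)
    (h : j ≠ k) : chi (y * y) j k % 4 = 0 := by
  rw [chi_mul, h1, h2]
  have h3 := chi_parity y j k h
  rw [h1, h2] at h3
  have h4 : Even (chi y j k) := h3.2 Iff.rfl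
  rw [Int.even_iff] at h4
  omega

end BG

/-- The configuration of three commuting fixed point free involutions of six points. -/
theorem exists_config_of_involutions {s0 s2 s4 : Equiv.Perm (Fin 6)}
    (i0 : ∀ x, s0 (s0 x) = x) (i2 : ∀ x, s2 (s2 x) = x) (i4 : ∀ x, s4 (s4 x) = x)
    (f0 : ∀ x, s0 x ≠ x) (f2 : ∀ x, s2 x ≠ x) (f4 : ∀ x, s4 x ≠ x)
    (c02 : ∀ x, s0 (s2 x) = s2 (s0 x)) (c04 : ∀ x, s0 (s4 x) = s4 (s0 x))
    (c24 : ∀ x, s2 (s4 x) = s4 (s2 x)) (n02 : s0 ≠ s2) (n04 : s0 ≠ s4) (n24 : s2 ≠ s4) :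
    ∃ a b c, a ≠ b ∧ c ≠ s0 c ∧ s0 a = b ∧ s2 a = b ∧ s4 a = b ∧ s0 (s2 c) ≠ c ∧ s4 c = s0 (s2 c) ∧
      ∀ x, x = a ∨ x = b ∨ x = c ∨ x = s0 c ∨ x = s2 c ∨ x = s0 (s2 c) := by
  obtain ⟨c, hc⟩ : ∃ c, s0 c ≠ s2 c := by
    by_contra! h; exact n02 (Equiv.ext h)
  have hf : s0 (s2 c) ≠ c := fun h => hc (by rw [← i0 (s2 c), h])
  have hcard : ((({c, s0 c, s2 c, s0 (s2 c)} : Finset (Fin 6)))ᶜ).card = 2 := by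
    rw [Finset.card_compl, Finset.card_insert_of_notMem, Finset.card_insert_of_notMem,
      Finset.card_insert_of_notMem, Finset.card_singleton]
    · rfl
    · simpa using (f0 _).symm
    · simp only [Finset.mem_insert, Finset.mem_singleton, not_or]
      exact ⟨hc, fun h => f2 c (s0.injective h).symm⟩
    · simp only [Finset.mem_insert, Finset.mem_singleton, not_or]
      exact ⟨(f0 c).symm, (f2 c).symm, hf.symm⟩
  obtain ⟨a, b, hab, hE⟩ := Finset.card_eq_two.1 hcard
  have hmem : ∀ x, (x ≠ c ∧ x ≠ s0 c ∧ x ≠ s2 c ∧ x ≠ s0 (s2 c)) ↔ x = a ∨ x = b := by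
    intro x
    have := Finset.ext_iff.1 hE x
    simpa only [Finset.mem_compl, Finset.mem_insert, Finset.mem_singleton, not_or] using this
  have ha := (hmem a).2 (Or.inl rfl)
  have key : ∀ s : Equiv.Perm (Fin 6), s a ≠ a → s a ≠ c → s a ≠ s0 c → s a ≠ s2 c →
      s a ≠ s0 (s2 c) → s a = b := fun s h1 h2 h3 h4 h5 =>
    ((hmem (s a)).1 ⟨h2, h3, h4, h5⟩).resolve_left h1
  have e : ∀ s : Equiv.Perm (Fin 6), (∀ x, s (s x) = x) → ∀ x y, s x = y → x = s y :=
    fun s hs x y h => by rw [← h, hs]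
  have h0 : s0 a = b := by
    refine key s0 (f0 a) (fun h => ?_) (fun h => ?_) (fun h => ?_) fun h => ?_
    · exact ha.2.1 (e s0 i0 _ _ h)
    · exact ha.1 (s0.injective h)
    · exact ha.2.2.2 (e s0 i0 _ _ h)
    · exact ha.2.2.1 (s0.injective h)
  have h2 : s2 a = b := by
    refine key s2 (f2 a) (fun h => ?_) (fun h => ?_) (fun h => ?_) fun h => ?_
    · exact ha.2.2.1 (e s2 i2 _ _ h)
    · exact ha.2.2.2 (by rw [c02]; exact e s2 i2 _ _ h)
    · exact ha.1 (s2.injective h)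
    · exact ha.2.1 (by rw [e s2 i2 _ _ h, c02, i2])
  have hfix : s0 (s2 (s4 a)) = s4 a := by
    rw [c24, h2, c04, ← h0, i0]
  have hne : ∀ x, s0 (s2 x) = x → x ≠ c ∧ x ≠ s0 c ∧ x ≠ s2 c ∧ x ≠ s0 (s2 c) := by
    intro x hx
    refine ⟨?_, ?_, ?_, ?_⟩ <;> rintro rfl
    · exact hf hx
    · rw [← c02, i0] at hx
      exact hc hx.symm
    · rw [i2] at hx
      exact hc hx
    · rw [← c02 (s2 c), i2, i0] at hx
      exact hf hx.symm
  have h4 : s4 a = b := by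
    obtain ⟨g1, g2, g3, g4⟩ := hne _ hfix
    exact key s4 (f4 a) g1 g2 g3 g4
  have hall : ∀ x, x = a ∨ x = b ∨ x = c ∨ x = s0 c ∨ x = s2 c ∨ x = s0 (s2 c) := by
    intro x
    by_cases h : x = c ∨ x = s0 c ∨ x = s2 c ∨ x = s0 (s2 c)
    · exact Or.inr (Or.inr h)
    · simp only [not_or] at h
      exact ((hmem x).1 h).imp_right Or.inl
  have hb : ∀ s : Equiv.Perm (Fin 6), (∀ x, s (s x) = x) → s a = b → s b = a := by
    intro s hs h; rw [← h, hs]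
  refine ⟨a, b, c, hab, (f0 c).symm, h0, h2, h4, hf, ?_, hall⟩
  rcases hall (s4 c) with h | h | h | h | h | h
  · have := e s4 i4 _ _ h
    rw [h4] at this
    have hb' := (hmem b).2 (Or.inr rfl)
    exact absurd this.symm hb'.1
  · have := e s4 i4 _ _ h
    rw [hb s4 i4 h4] at this
    exact absurd this.symm ha.1
  · exact absurd h (f4 c)
  · refine absurd (Equiv.ext fun x => ?_) n04
    rcases hall x with rfl | rfl | rfl | rfl | rfl | rfl
    · rw [h0, h4]
    · rw [hb s0 i0 h0, hb s4 i4 h4]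
    · exact h.symm
    · rw [← c04, h]
    · rw [← c24, h, c02]
    · rw [← c04, ← c24, h, c02]
  · refine absurd (Equiv.ext fun x => ?_) n24
    rcases hall x with rfl | rfl | rfl | rfl | rfl | rfl
    · rw [h2, h4]
    · rw [hb s2 i2 h2, hb s4 i4 h4]
    · exact h.symm
    · rw [← c04, h, c02]
    · rw [← c24, h]
    · rw [← c04, ← c24, h, ← c02]
  · exact h

namespace BG

theorem garside_conj (i : ℕ) (hi : i + 2 < m) : ∃ d : BG m, d * S i = S (i + 2) * d ∧
    ∀ j, j + 2 ≤ i → Commute d (S j) := by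
  refine ⟨S i * S (i + 1) * S (i + 2) * S i * S (i + 1) * S i, ?_, fun j hj => ?_⟩
  · have h1 := braid (m := m) (i := i) (by omega)
    have h2 := braid (m := m) (i := i + 1) hi
    have h3 := (comm (m := m) (i := i) (j := i + 2) le_rfl).eq
    have e : ∀ a b c : BG m, a * b * a = b * a * b → b * c * b = c * b * c → a * c = c * a →
        a * b * c * a * b * a * a = c * (a * b * c * a * b * a) := by
      intro a b c h1 h2 h3
      calc a * b * c * a * b * a * a = a * b * c * (a * b * a) * a := by group
        _ = a * (b * c * b) * a * b * a := by rw [h1]; group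
        _ = (a * c) * b * c * a * b * a := by rw [h2]; group
        _ = c * (a * b * c * a * b * a) := by rw [h3]; group
    exact e _ _ _ h1 h2 h3
  · have h (k : ℕ) : Commute (S (i + k) : BG m) (S j) := (comm (by omega)).symm
    exact (((((h 0).mul_left (h 1)).mul_left (h 2)).mul_left (h 0)).mul_left (h 1)).mul_left (h 0)

/-- There is no exotic action on six points. -/
theorem not_fixed_point_free {φ : BG 5 →* BG 5 ⧸ Subgroup.center (BG 5)}
    (h01 : permBar (by omega) (φ (S 0)) ≠ permBar (by omega) (φ (S 1)))
    (hinv : ∀ i < 5, ∀ x, permBar (by omega) (φ (S i)) (permBar (by omega) (φ (S i)) x) = x)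
    (hfree : ∀ i < 5, ∀ x, permBar (by omega) (φ (S i)) x ≠ x) : False := by
  have hs := (braidSeq_S (m := 5)).map ((permBar (by omega)).comp φ)
  have hn := hs.nondeg (by omega) h01
  obtain ⟨y0, h0⟩ := qk_surjective (m := 5) (φ (S 0))
  obtain ⟨y2, h2⟩ := qk_surjective (m := 5) (φ (S 2))
  obtain ⟨d, hd, hd0⟩ := garside_conj (m := 5) 2 (by omega)
  obtain ⟨D, hD⟩ := qk_surjective (m := 5) (φ d)
  replace hd0 := hd0 0 (by omega)
  obtain ⟨y4, hy4⟩ : ∃ y4, D * y2 * D⁻¹ = y4 := ⟨_, rfl⟩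
  have h4 : qk y4 = φ (S 4) := by
    rw [← hy4, map_mul, map_mul, map_inv, hD, h2, ← map_mul, ← map_inv, ← map_mul, hd,
      mul_inv_cancel_right]
  have hperm : ∀ {x y : BG 5}, qk y = φ x → permBar (by omega) (φ x) = perm y := fun h => by
    rw [← h]; exact permBar_mk (by omega) _
  have p0 := hperm h0
  have p2 := hperm h2
  have p4 := hperm h4
  have hcomm : ∀ {x y x' y' : BG 5}, qk x' = φ x → qk y' = φ y → Commute x y →
      Commute (qk x') (qk y') := by
    intro x y x' y' hx hy h
    rw [hx, hy]; exact h.map φ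
  have hpc : ∀ {x y : BG 5}, Commute (qk x) (qk y) → ∀ p, perm x (perm y p) = perm y (perm x p) := by
    intro x y h p
    have h1 : qk (x * y) = qk (y * x) := by rw [map_mul, map_mul, h.eq]
    have h2 := perm_congr (by omega) h1
    rw [map_mul, map_mul] at h2
    exact DFunLike.congr_fun h2 p
  have c02 := hcomm h0 h2 (comm (by omega))
  have c04 := hcomm h0 h4 (comm (by omega))
  have c24 := hcomm h2 h4 (comm (by omega))
  have cD := hcomm hD h0 hd0
  have n02 : perm y0 ≠ perm y2 := by
    have := hn.ne_add_two 0 (by omega)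
    simpa only [MonoidHom.comp_apply, p0, p2] using this
  have n24 : perm y2 ≠ perm y4 := by
    have := hn.ne_add_two 2 (by omega)
    simpa only [MonoidHom.comp_apply, p2, p4] using this
  have n04 : perm y0 ≠ perm y4 := by
    intro h
    have h1 := hn.ne_succ 0 (by omega)
    refine h1 (BraidSeq.eq_of_commute_of_braid (hn.braid 0 (by omega)) ?_)
    have h2 := hn.comm 1 4 (by omega) (by omega)
    simp only [MonoidHom.comp_apply] at h2 ⊢
    rw [zero_add, p0, h, ← p4, h2]
  have i0 := hinv 0 (by omega)
  have i2 := hinv 2 (by omega)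
  have i4 := hinv 4 (by omega)
  have f0 := hfree 0 (by omega)
  have f2 := hfree 2 (by omega)
  have f4 := hfree 4 (by omega)
  rw [p0] at i0 f0
  rw [p2] at i2 f2
  rw [p4] at i4 f4
  obtain ⟨a, b, c, hab, hc, ha0, ha2, ha4, hf, hc4, hall⟩ := exists_config_of_involutions i0 i2 i4
    f0 f2 f4 (hpc c02) (hpc c04) (hpc c24) n02 n04 n24
  have sq : ∀ {y : BG 5}, (∀ x, perm y (perm y x) = x) → IsPure (y * y) := fun h => by
    rw [IsPure, map_mul]; exact Equiv.ext h
  have swp : ∀ {y : BG 5}, (∀ x, perm y (perm y x) = x) → ∀ {p q}, perm y p = q → p ≠ q →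
      chi (y * y) p q % 4 = 2 := fun {y} h {p q} hpq hne =>
    chi_sq_of_swap hpq (by rw [← hpq, h]) hne
  have hDc : ∀ x, perm D (perm y2 x) = perm y4 (perm D x) := by
    intro x; rw [← hy4]; simp
  have hcd4 : chi (y4 * y4) c (perm y0 c) = chi (y2 * y2) c (perm y0 c) := by
    have e1 : chi (y4 * y4) (perm D c) (perm y0 (perm D c)) = chi (y2 * y2) c (perm y0 c) := by
      rw [← hpc cD, show y4 * y4 = D * (y2 * y2) * D⁻¹ by rw [← hy4]; group, chi_conj (sq i2)]
      simp
    rw [← e1]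
    have inv4 : ∀ {p q}, p ≠ q → chi (y4 * y4) (perm y4 p) (perm y4 q) = chi (y4 * y4) p q :=
      fun h => chi_of_commute (by omega) (sq i4) (by
        rw [map_mul]; exact (Commute.refl _).mul_right (Commute.refl _)) h
    have bad : perm y0 (perm D c) ≠ perm y4 (perm D c) := by
      rw [← hDc, ← hpc cD]
      intro h
      exact hf (by rw [← (perm D).injective h, i0])
    have hc4' : perm y4 (perm y0 c) = perm y2 c := by rw [← hpc c04, hc4, i0]
    rcases hall (perm D c) with h | h | h | h | h | h
    · rw [h, ha0, ha4] at bad; exact absurd rfl bad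
    · rw [h, ← ha0, i0, ha0, ← ha4, i4] at bad; exact absurd rfl bad
    · rw [h]
    · rw [h, i0, chi_symm]
    · rw [h, ← hc4, ← hc4', inv4 hc.symm, chi_symm]
    · rw [h, i0, ← hc4, ← hc4', inv4 hc]
  have hx : IsPure (y0 * y2 * y4 * (y0 * y2 * y4)) := by
    rw [IsPure, map_mul, map_mul, map_mul]
    refine Equiv.ext fun x => ?_
    simp only [Equiv.Perm.mul_apply, Equiv.Perm.one_apply]
    rw [← hpc c04, ← hpc c24, i4, ← hpc c02, i2, i0]
  obtain ⟨z, hz⟩ := chi_congr (m := 5) (by omega) (a := y0 * y2 * y4 * (y0 * y2 * y4))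
    (b := y0 * y0 * ((y2 * y2) * (y4 * y4))) (by
      simp only [map_mul, mul_assoc]
      rw [← mul_assoc (qk y4) (qk y0), ← c04.eq, mul_assoc, ← mul_assoc (qk y2) (qk y0), ← c02.eq,
        ← mul_assoc (qk y4) (qk y2), ← c24.eq]
      simp only [mul_assoc])
  have z1 := hz a b hab
  have z2 := hz c (perm y0 c) hc
  have hP : ∀ x, perm (y0 * y2 * y4) x = perm y0 (perm y2 (perm y4 x)) := fun x => by
    simp [Equiv.Perm.mul_apply]
  rw [chi_mul_pure _ ((sq i2).mul (sq i4)), chi_mul_pure _ (sq i4)] at z1 z2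
  rw [hcd4] at z2
  have w1 : chi (y0 * y2 * y4 * (y0 * y2 * y4)) a b % 4 = 2 :=
    chi_sq_of_swap (by rw [hP, ha4, ← ha2, i2, ha0, ha2]) (by
      rw [hP, ← ha4, i4, ha2, ← ha0, i0]) hab
  have hPc : perm (y0 * y2 * y4) c = c := by
    rw [hP, hc4, hpc c02, i0, i2]
  have w2 : chi (y0 * y2 * y4 * (y0 * y2 * y4)) c (perm y0 c) % 4 = 0 := by
    refine chi_sq_of_fixed hPc ?_ hc
    rw [hP, ← hpc c04, ← hpc c02, ← hP, hPc]
  have v1 := swp i0 ha0 hab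
  have v2 := swp i2 ha2 hab
  have v3 := swp i4 ha4 hab
  have v4 := swp i0 (p := c) rfl hc
  have v5 := chi_even_of_isPure (sq i2) hc
  rw [Int.even_iff] at v5
  omega

end BG

end

section

section Swaps

variable {X : Type*} [DecidableEq X]

theorem eq_of_commute_swap {a b d : X} (hb : a ≠ b) (hd : a ≠ d)
    (h : Equiv.swap a b * Equiv.swap a d = Equiv.swap a d * Equiv.swap a b) : b = d := by
  by_contra hbd
  have h1 := DFunLike.congr_fun h a
  rw [Equiv.Perm.mul_apply, Equiv.Perm.mul_apply, Equiv.swap_apply_left, Equiv.swap_apply_left,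
    Equiv.swap_apply_of_ne_of_ne hd.symm (Ne.symm hbd),
    Equiv.swap_apply_of_ne_of_ne hb.symm hbd] at h1
  exact hbd h1.symm

theorem disjoint_of_commute_swap {a b c d : X} (hab : a ≠ b) (hcd : c ≠ d)
    (h : Equiv.swap a b * Equiv.swap c d = Equiv.swap c d * Equiv.swap a b)
    (hne : Equiv.swap a b ≠ Equiv.swap c d) : a ≠ c ∧ a ≠ d ∧ b ≠ c ∧ b ≠ d := by
  refine ⟨?_, ?_, ?_, ?_⟩ <;> rintro rfl
  · rw [eq_of_commute_swap hab hcd h] at hne; exact hne rfl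
  · rw [Equiv.swap_comm c] at h hne
    rw [eq_of_commute_swap hab hcd.symm h] at hne; exact hne rfl
  · rw [Equiv.swap_comm a] at h hne
    rw [eq_of_commute_swap hab.symm hcd h] at hne; exact hne rfl
  · rw [Equiv.swap_comm a, Equiv.swap_comm c] at h hne
    rw [eq_of_commute_swap hab.symm hcd.symm h] at hne; exact hne rfl

/-- Two different swaps satisfying the braid relation share a point. -/
theorem exists_common_of_braid_swap {a b : X} {t : Equiv.Perm X} (ht : t.IsSwap)
    (h : Equiv.swap a b * t * Equiv.swap a b = t * Equiv.swap a b * t)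
    (hne : Equiv.swap a b ≠ t) : ∃ v, (t = Equiv.swap a v ∧ v ≠ a ∧ v ≠ b) ∨
      (t = Equiv.swap b v ∧ v ≠ a ∧ v ≠ b) := by
  obtain ⟨c, d, hcd, rfl⟩ := ht
  by_cases hall : a ≠ c ∧ a ≠ d ∧ b ≠ c ∧ b ≠ d
  · exact absurd (BraidSeq.eq_of_commute_of_braid h
      (swap_comm' hall.1 hall.2.1 hall.2.2.1 hall.2.2.2)) hne
  · have key : ∀ {x y u v : X}, u ≠ v → x = u → Equiv.swap x y ≠ Equiv.swap u v →
        Equiv.swap u v = Equiv.swap x v ∧ v ≠ x ∧ v ≠ y := by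
      rintro x y u v huv rfl h
      exact ⟨rfl, huv.symm, fun h' => h (by rw [h'])⟩
    by_cases h1 : a = c
    · obtain ⟨g1, g2, g3⟩ := key hcd h1 hne
      exact ⟨d, Or.inl ⟨g1, g2, g3⟩⟩
    by_cases h2 : a = d
    · rw [Equiv.swap_comm c] at hne ⊢
      obtain ⟨g1, g2, g3⟩ := key hcd.symm h2 hne
      exact ⟨c, Or.inl ⟨g1, g2, g3⟩⟩
    rw [Equiv.swap_comm a] at hne
    by_cases h3 : b = c
    · obtain ⟨g1, g2, g3⟩ := key hcd h3 hne
      exact ⟨d, Or.inr ⟨g1, g3, g2⟩⟩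
    by_cases h4 : b = d
    · rw [Equiv.swap_comm c] at hne ⊢
      obtain ⟨g1, g2, g3⟩ := key hcd.symm h4 hne
      exact ⟨c, Or.inr ⟨g1, g3, g2⟩⟩
    exact absurd ⟨h1, h2, h3, h4⟩ hall

theorem BraidSeq.Nondeg.exists_chain {m : ℕ} {s : ℕ → Equiv.Perm X} (h : BraidSeq.Nondeg m s)
    (hs : ∀ i < m, (s i).IsSwap) (hfar : ∀ i j, i + 2 ≤ j → j < m → s i ≠ s j) :
    ∀ k, 2 ≤ k → k ≤ m → ∃ q : ℕ → X, (∀ i < k, s i = Equiv.swap (q i) (q (i + 1))) ∧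
      ∀ i j, i < j → j ≤ k → q i ≠ q j := by
  intro k hk
  induction k, hk using Nat.le_induction with
  | base =>
    intro hm
    obtain ⟨a, b, hab, hs0⟩ := hs 0 (by omega)
    have hb := h.braid 0 (by omega)
    have hne := h.ne_succ 0 (by omega)
    rw [hs0] at hb hne
    have key : ∀ a b v, a ≠ b → s 0 = Equiv.swap a b → s (0 + 1) = Equiv.swap b v → v ≠ a → v ≠ b →
        ∃ q : ℕ → X, (∀ i < 2, s i = Equiv.swap (q i) (q (i + 1))) ∧
          ∀ i j, i < j → j ≤ 2 → q i ≠ q j := by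
      intro a b v hab h0 h1 hva hvb
      refine ⟨fun n => if n = 0 then a else if n = 1 then b else v, fun i hi => ?_,
        fun i j hij hj => ?_⟩
      · interval_cases i
        · simpa using h0
        · simpa using h1
      · interval_cases j <;> interval_cases i
        · simpa using hab
        · simpa using hva.symm
        · simpa using hvb.symm
    obtain ⟨v, ⟨h1, h2, h3⟩ | ⟨h1, h2, h3⟩⟩ := exists_common_of_braid_swap (hs 1 (by omega)) hb hne
    · exact key b a v hab.symm (by rw [hs0, Equiv.swap_comm]) h1 h3 h2
    · exact key a b v hab hs0 h1 h2 h3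
  | succ k hk ih =>
    intro hkm
    obtain ⟨q, hq, hinj⟩ := ih (by omega)
    obtain ⟨l, rfl⟩ : ∃ l, k = l + 1 := ⟨k - 1, by omega⟩
    have hb := h.braid l (by omega)
    have hne := h.ne_succ l (by omega)
    rw [hq l (by omega)] at hb hne
    obtain ⟨v, hv⟩ := exists_common_of_braid_swap (hs (l + 1) (by omega)) hb hne
    have hdis : ∀ c d, c ≠ d → s (l + 1) = Equiv.swap c d → ∀ i < l,
        q i ≠ c ∧ q i ≠ d ∧ q (i + 1) ≠ c ∧ q (i + 1) ≠ d := by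
      intro c d hcd hc i hi
      have h1 := h.comm i (l + 1) (by omega) (by omega)
      have h2 := hfar i (l + 1) (by omega) (by omega)
      rw [hc, hq i (by omega)] at h1 h2
      exact disjoint_of_commute_swap (hinj _ _ (by omega) (by omega)) hcd h1 h2
    obtain ⟨h1, h2, h3⟩ : s (l + 1) = Equiv.swap (q (l + 1)) v ∧ v ≠ q l ∧ v ≠ q (l + 1) := by
      rcases hv with ⟨h1, h2, h3⟩ | hv
      · have := (hdis _ _ h2.symm h1 (l - 1) (by omega)).2.2.1
        rw [show l - 1 + 1 = l by omega] at this
        exact absurd rfl this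
      · exact hv
    have hvq : ∀ i, i ≤ l + 1 → q i ≠ v := by
      intro i hi
      rcases Nat.lt_or_ge i l with hi' | hi'
      · exact (hdis _ _ h3.symm h1 i hi').2.1
      · obtain rfl | rfl : i = l ∨ i = l + 1 := by omega
        · exact h2.symm
        · exact h3.symm
    refine ⟨Function.update q (l + 2) v, fun i hi => ?_, fun i j hij hj => ?_⟩
    · rw [Function.update_of_ne (by omega)]
      obtain rfl | hi : i = l + 1 ∨ i < l + 1 := by omega
      · rw [Function.update_self, h1]
      · rw [Function.update_of_ne (by omega), hq i hi]
    · rw [Function.update_of_ne (by omega)]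
      obtain rfl | hj : j = l + 2 ∨ j ≤ l + 1 := by omega
      · rw [Function.update_self]; exact hvq i (by omega)
      · rw [Function.update_of_ne (by omega)]; exact hinj i j hij hj

end Swaps

namespace BG

variable {m : ℕ}

/-- After conjugation, an injective endomorphism induces the standard permutations. -/
theorem exists_standard (hm : 4 ≤ m)
    {ρ : BG m ⧸ Subgroup.center (BG m) →* BG m ⧸ Subgroup.center (BG m)}
    (hρ : Function.Injective ρ) : ∃ x : BG m, ∀ b y : BG m, qk y = qk x * ρ (qk b) * (qk x)⁻¹ →
      perm y = perm b := by
  have hm2 : 2 ≤ m := by omega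
  have h01 := permBar_ne_of_injective hm hρ
  have hn := ((braidSeq_S (m := m)).map ((permBar hm2).comp (ρ.comp qk))).nondeg hm h01
  have hconj : ∀ i < m, ∃ c, ((permBar hm2).comp (ρ.comp qk)) (S i) =
      c * ((permBar hm2).comp (ρ.comp qk)) (S 0) * c⁻¹ := fun i hi => by
    obtain ⟨c, hc⟩ := isConj_iff.1 (hn.isConj i hi)
    exact ⟨c, hc.symm⟩
  have hsw : ∀ i < m, (((permBar hm2).comp (ρ.comp qk)) (S i)).IsSwap := by
    rcases hn.isSwap_or hm with ⟨a, b, hab, h⟩ | ⟨rfl, h1, h2⟩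
    · intro i hi
      obtain ⟨c, hc⟩ := hconj i hi
      exact ⟨c a, c b, c.injective.ne hab, by rw [hc, h, Equiv.swap_apply_apply]⟩
    · refine absurd (not_fixed_point_free (φ := ρ.comp qk) h01 (fun i hi x => ?_)
        fun i hi x => ?_) id
      · obtain ⟨c, hc⟩ := hconj i hi
        simp only [MonoidHom.comp_apply] at hc h1 ⊢
        rw [← Equiv.Perm.mul_apply, hc, conj_mul, h1]
        simp
      · obtain ⟨c, hc⟩ := hconj i hi
        simp only [MonoidHom.comp_apply] at hc h2 ⊢
        rw [hc, Equiv.Perm.mul_apply, Equiv.Perm.mul_apply, Ne, ← Equiv.Perm.eq_inv_iff_eq]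
        exact h2 _
  have hfar : ∀ i j, i + 2 ≤ j → j < m → ((permBar hm2).comp (ρ.comp qk)) (S i) ≠
      ((permBar hm2).comp (ρ.comp qk)) (S j) := by
    intro i j hij hj h
    obtain rfl | hij := eq_or_lt_of_le hij
    · exact hn.ne_add_two i hj h
    · refine hn.ne_succ i (by omega) (BraidSeq.eq_of_commute_of_braid (hn.braid i (by omega)) ?_)
      have := hn.comm (i + 1) j (by omega) hj
      rw [h, this]
  obtain ⟨q, hq, hinj⟩ := hn.exists_chain hsw hfar m hm2 le_rfl
  have hbij : Function.Bijective fun j : Fin (m + 1) => q j := by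
    rw [← Finite.injective_iff_bijective]
    intro j k hjk
    by_contra hne
    rcases lt_or_gt_of_ne hne with h | h
    · exact hinj _ _ h (by omega) hjk
    · exact hinj _ _ h (by omega) hjk.symm
  obtain ⟨x, hx⟩ := perm_surjective (Equiv.ofBijective _ hbij)⁻¹
  have hxq : ∀ i, i ≤ m → perm x (q i) = str i := by
    intro i hi
    rw [hx, Equiv.Perm.inv_eq_iff_eq, Equiv.ofBijective_apply, val_str hi]
  have hhom : (MulAut.conj (perm x)).toMonoidHom.comp ((permBar hm2).comp (ρ.comp qk)) = perm := by
    refine hom_ext fun i hi => ?_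
    have := hq i hi
    rw [MonoidHom.comp_apply, this, perm_S hi, ← hxq i hi.le, ← hxq (i + 1) hi,
      Equiv.swap_apply_apply]
    rfl
  refine ⟨x, fun b y hy => ?_⟩
  have h1 : perm y = permBar hm2 (qk y) := (permBar_mk hm2 y).symm
  rw [← DFunLike.congr_fun hhom b, h1, hy, map_mul, map_mul, map_inv]
  rfl

end BG

end

section

open FreeGroup (of)

/-- A function of pairs invariant under the swaps of consecutive indices not moving `2` to `1`. -/
theorem eq_of_swap_invariant {m : ℕ} {Y : ℕ → ℕ → ℤ} (hs : ∀ i j, Y i j = Y j i)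
    (h0 : ∀ i, 2 ≤ i → i ≤ m → Y 0 i = Y 1 i)
    (h2 : ∀ l i, 2 ≤ l → l < m → i ≤ m → i ≠ l → i ≠ l + 1 → Y i l = Y i (l + 1)) :
    (∀ i j, i ≤ 1 → 2 ≤ j → j ≤ m → Y i j = Y 0 2) ∧
      ∀ i j, 2 ≤ i → i < j → j ≤ m → Y i j = Y 2 3 := by
  have h : ∀ i, 2 ≤ i → i ≤ m → Y 0 i = Y 0 2 := by
    intro i hi
    induction i, hi using Nat.le_induction with
    | base => intro _; rfl
    | succ l hl ih =>
      intro hm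
      rw [← h2 l 0 hl (by omega) (by omega) (by omega) (by omega), ih (by omega)]
  refine ⟨fun i j hi hj hm => ?_, fun i j hi => ?_⟩
  · obtain rfl | rfl : i = 0 ∨ i = 1 := by omega
    · exact h j hj hm
    · rw [← h0 j hj hm, h j hj hm]
  · induction i, hi using Nat.le_induction with
    | base =>
      intro hj
      induction j, hj using Nat.le_induction with
      | base => intro _; rfl
      | succ l hl ih =>
        intro hm
        rw [← h2 l 2 (by omega) (by omega) (by omega) (by omega) (by omega), ih (by omega)]
    | succ l hl ih =>
      intro hj hm
      rw [hs, ← h2 l j hl (by omega) (by omega) (by omega) (by omega), hs, ih (by omega) hm]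

namespace BG

variable {m : ℕ}

theorem chi_mul_eq_of_commute {g g' : BG (m + 1)} (hg : IsPure g) (hg' : IsPure g')
    (h : Commute g g') {j k : Fin (m + 1)} (hjk : j ≠ k) :
    (chi g j.castSucc (Fin.last _) - chi g j.castSucc k.castSucc) *
      (chi g' k.castSucc (Fin.last _) - chi g' j.castSucc k.castSucc) =
    (chi g' j.castSucc (Fin.last _) - chi g' j.castSucc k.castSucc) *
      (chi g k.castSucc (Fin.last _) - chi g j.castSucc k.castSucc) := by
  obtain ⟨f, b, rfl, hb, hb1, hf⟩ := hg.exists_kf_mul_up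
  obtain ⟨f', b', rfl, hb', hb1', hf'⟩ := hg'.exists_kf_mul_up
  have e : ∀ (f f' : FreeGroup (Fin (m + 1))) (b b' : BG m),
      kf f * up b * (kf f' * up b') = kf (f * artin b f') * up (b * b') := by
    intro f f' b b'
    rw [map_mul, map_mul, kf_artin]; group
  have h' := h.eq
  rw [e, e, (commute_of_kf_mul_up h).eq] at h'
  have h'' := kf_injective (mul_right_cancel h')
  have hc : ∀ {b : BG m}, IsPure b → ∃ c, FG.IsBC (artin b) c ∧
      2 * FG.ex j (c k) = - chi b j k ∧ 2 * FG.ex k (c j) = - chi b j k := by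
    intro b hb
    choose c hc hc' using artin_of b
    refine ⟨c, fun i => by rw [hc, hb.perm_apply], ?_, ?_⟩
    · have := hc' k j hjk
      rw [hb.perm_apply, hb.perm_apply, chi_symm b k j] at this
      rw [this]; ring
    · have := hc' j k hjk.symm
      rw [hb.perm_apply, hb.perm_apply] at this
      rw [this]; ring
  obtain ⟨c, hc0, hc1, hc2⟩ := hc hb
  obtain ⟨c', hc0', hc1', hc2'⟩ := hc hb'
  have hz := congrArg (fun w => (FG.heis j k w).z) h''
  simp only [map_mul, hc0.heis_apply hjk, hc0'.heis_apply hjk, FG.Heis.mul_z, FG.Heis.mul_x,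
    FG.Heis.mul_y, FG.heis_x, FG.heis_y] at hz
  rw [← hf, ← hf, ← hf', ← hf', ← hb1, ← hb1']
  have e1 : chi b j k = -2 * FG.ex j (c k) := by linarith
  have e2 : chi b' j k = -2 * FG.ex j (c' k) := by linarith
  have e3 : FG.ex k (c j) = FG.ex j (c k) := by linarith
  have e4 : FG.ex k (c' j) = FG.ex j (c' k) := by linarith
  rw [e3, e4] at hz
  rw [e1, e2]
  linear_combination 4 * hz

/-- The pure braids invariant under the permutations commuting with a swap. -/
theorem chi_of_invariant (hm : 3 ≤ m) {t : BG m}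
    (h : ∀ l < m, l = 0 ∨ 2 ≤ l → ∀ j k, j ≠ k → chi t (perm (S l) j) (perm (S l) k) = chi t j k)
    {j k : Fin (m + 1)} (hjk : j ≠ k) :
    chi t j k = if (j : ℕ) ≤ 1 then
        if (k : ℕ) ≤ 1 then chi t (str 0) (str 1) else chi t (str 0) (str 2)
      else if (k : ℕ) ≤ 1 then chi t (str 0) (str 2) else chi t (str 2) (str 3) := by
  obtain ⟨h1, h2⟩ := eq_of_swap_invariant (m := m) (Y := fun i j => chi t (str i) (str j))
    (fun i j => chi_symm _ _ _) (fun i hi him => by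
      have := h 0 (by omega) (Or.inl rfl) (str 0) (str i) (str_ne (by omega) him (by omega))
      rw [perm_S (by omega), Equiv.swap_apply_left, Equiv.swap_apply_of_ne_of_ne
        (str_ne him (by omega) (by omega)) (str_ne him (by omega) (by omega))] at this
      exact this.symm)
    fun l i hl hlm him h1 h2 => by
      have := h l (by omega) (Or.inr hl) (str i) (str l) (str_ne (by omega) (by omega) (by omega))
      rw [perm_S (by omega), Equiv.swap_apply_left, Equiv.swap_apply_of_ne_of_ne
        (str_ne him (by omega) (by omega)) (str_ne him (by omega) (by omega))] at this
      exact this.symm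
  have hj := str_val j
  have hk := str_val k
  have hjm : (j : ℕ) ≤ m := by omega
  have hkm : (k : ℕ) ≤ m := by omega
  have hne : (j : ℕ) ≠ k := fun h => hjk (Fin.ext h)
  generalize (j : ℕ) = a at *
  generalize (k : ℕ) = b at *
  subst hj hk
  split_ifs with ha hb hb
  · have : a = 0 ∧ b = 1 ∨ a = 1 ∧ b = 0 := by omega
    rcases this with ⟨rfl, rfl⟩ | ⟨rfl, rfl⟩
    · rfl
    · exact chi_symm _ _ _
  · exact h1 a b ha (by omega) hkm
  · rw [chi_symm]
    exact h1 b a hb (by omega) hjm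
  · rcases lt_or_gt_of_ne hne with h | h
    · exact h2 a b (by omega) h hkm
    · rw [chi_symm]
      exact h2 b a (by omega) h hjm

theorem S_conj {i : ℕ} (hi : i < m) : ∃ d : BG m, d * S 0 * d⁻¹ = S i := by
  obtain ⟨c, hc⟩ := isConj_iff.1 (braidSeq_S.isConj i hi)
  exact ⟨c, hc⟩

variable {φ : BG m →* BG m ⧸ Subgroup.center (BG m)}

theorem exists_chi_of_standard (hm : 4 ≤ m) (hφ : ∀ b y, qk y = φ b → perm y = perm b) :
    ∃ μ : ℤ, μ ≠ 0 ∧ ∀ h y : BG m, qk y = φ (h * S 0 ^ 2 * h⁻¹) → IsPure y ∧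
      ∃ c, ∀ j k, j ≠ k → chi y j k = c + μ * chi (h * S 0 ^ 2 * h⁻¹) j k := by
  choose L hL using fun b => qk_surjective (φ b)
  have hP : ∀ b, perm (L b) = perm b := fun b => hφ b _ (hL b)
  obtain ⟨t, ht⟩ : ∃ t, t = L (S 0) * L (S 0) := ⟨_, rfl⟩
  have htp : IsPure t := by
    rw [ht, IsPure, map_mul, hP, perm_S (by omega), Equiv.swap_mul_self]
  have htq : qk t = φ (S 0 ^ 2) := by rw [ht, map_mul, hL, map_pow, pow_two]
  have hinv : ∀ l < m, l = 0 ∨ 2 ≤ l → ∀ j k, j ≠ k →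
      chi t (perm (S l) j) (perm (S l) k) = chi t j k := by
    intro l hl hl' j k hjk
    have hc : Commute (S l : BG m) (S 0) := by
      rcases hl' with rfl | hl'
      · exact Commute.refl _
      · exact (comm (by omega)).symm
    rw [← hP]
    refine chi_of_commute (by omega) htp ?_ hjk
    rw [htq, hL]
    exact (hc.pow_right 2).map φ
  have hchi := fun j k h => chi_of_invariant (by omega) hinv (j := j) (k := k) h
  have n01 := str_ne (m := m) (i := 0) (j := 1) (by omega) (by omega) (by omega)
  have n23 := str_ne (m := m) (i := 2) (j := 3) (by omega) (by omega) (by omega)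
  have hα : chi t (str 0) (str 1) % 4 = 2 := by
    rw [ht]
    refine chi_sq_of_swap ?_ ?_ n01
    · rw [hP, perm_S (by omega), Equiv.swap_apply_left]
    · rw [hP, perm_S (by omega), Equiv.swap_apply_right]
  have hγ : chi t (str 2) (str 3) % 4 = 0 := by
    rw [ht]
    refine chi_sq_of_fixed ?_ ?_ n23 <;>
    · rw [hP, perm_S (by omega), Equiv.swap_apply_of_ne_of_ne] <;>
      exact str_ne (by omega) (by omega) (by omega)
  generalize chi t (str 0) (str 1) = α at *
  generalize chi t (str 2) (str 3) = γ at *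
  generalize chi t (str 0) (str 2) = β at *
  have hβ : β = γ := by
    obtain ⟨q, rfl⟩ : ∃ q, m = q + 1 := ⟨m - 1, by omega⟩
    obtain ⟨d, hd, -⟩ := garside_conj (m := q + 1) 0 (by omega)
    have hd' : d * S 0 ^ 2 * d⁻¹ = S 2 ^ 2 := by
      rw [← conj_pow, hd, zero_add, mul_inv_cancel_right]
    have hcr : ∀ j k, crossing (perm d (str 0)) (perm d (str 1)) j k =
        crossing (str 2) (str 3) j k := by
      intro j k
      have := chi_conj_S_sq (m := q + 1) (by omega) d (i := 0) j k
      rw [hd', chi_S_sq (by omega)] at this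
      linarith
    have hd23 := hcr (str 2) (str 3)
    have h1 : crossing (str 2 : Fin (q + 1 + 1)) (str 3) (str 2) (str 3) = 1 :=
      if_pos (Or.inl ⟨rfl, rfl⟩)
    rw [h1, crossing] at hd23
    have hD : ∀ i, i = 0 ∨ i = 4 ∨ 4 ≤ i → i ≤ q + 1 → ¬ ((perm d)⁻¹ (str i)).val ≤ 1 := by
      intro i hi hiq hle
      have h23 : str 2 = perm d (str 0) ∧ str 3 = perm d (str 1) ∨
          str 2 = perm d (str 1) ∧ str 3 = perm d (str 0) := by
        by_contra hcon
        rw [if_neg hcon] at hd23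
        exact zero_ne_one hd23
      have h01 : (perm d)⁻¹ (str i) = str 0 ∨ (perm d)⁻¹ (str i) = str 1 := by
        rw [eq_str (by omega), eq_str (by omega)]; omega
      rw [Equiv.Perm.inv_eq_iff_eq, Equiv.Perm.inv_eq_iff_eq] at h01
      have e2 := str_ne (m := q + 1) (i := i) (j := 2) hiq (by omega) (by omega)
      have e3 := str_ne (m := q + 1) (i := i) (j := 3) hiq (by omega) (by omega)
      rcases h23 with ⟨h2, h3⟩ | ⟨h2, h3⟩ <;> rcases h01 with h | h
      · exact e2 (h.trans h2.symm)
      · exact e3 (h.trans h3.symm)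
      · exact e3 (h.trans h3.symm)
      · exact e2 (h.trans h2.symm)
    have hD2 : ((perm d)⁻¹ (str 2)).val ≤ 1 := by
      have h23 : str 2 = perm d (str 0) ∨ str 2 = perm d (str 1) := by
        by_contra hcon
        rw [not_or] at hcon
        rw [if_neg (fun h => h.elim (fun h => hcon.1 h.1) fun h => hcon.2 h.1)] at hd23
        exact zero_ne_one hd23
      rcases h23 with h | h
      · rw [h, Equiv.Perm.inv_def, Equiv.symm_apply_apply, val_str (by omega)]; omega
      · rw [h, Equiv.Perm.inv_def, Equiv.symm_apply_apply, val_str (by omega)]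
    have hcomm : Commute t (L d * t * (L d)⁻¹) := by
      refine commute_of_qk htp (htp.conj _) ?_
      rw [map_mul, map_mul, map_inv, htq, hL, ← map_inv, ← map_mul, ← map_mul, hd']
      exact (((comm (m := q + 1) (i := 0) (j := 2) (by omega)).pow_left 2).pow_right 2).map φ
    have hcs0 := str_castSucc (m := q) (i := 0) (by omega)
    have hcs2 := str_castSucc (m := q) (i := 2) (by omega)
    have hla : (Fin.last (q + 1)) = str (q + 1) := by rw [eq_str le_rfl]; rfl
    have hh := chi_mul_eq_of_commute htp (htp.conj (L d)) hcomm
      (str_ne (m := q) (i := 0) (j := 2) (by omega) (by omega) (by omega))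
    rw [← hcs0, ← hcs2, hla] at hh
    simp only [chi_conj htp, hP] at hh
    have m02 := str_ne (m := q + 1) (i := 0) (j := 2) (by omega) (by omega) (by omega)
    have m0l := str_ne (m := q + 1) (i := 0) (j := q + 1) (by omega) (by omega) (by omega)
    have m2l := str_ne (m := q + 1) (i := 2) (j := q + 1) (by omega) (by omega) (by omega)
    rw [hchi _ _ m0l, hchi _ _ m02, hchi _ _ m2l, hchi _ _ ((perm d)⁻¹.injective.ne m2l),
      hchi _ _ ((perm d)⁻¹.injective.ne m02), hchi _ _ ((perm d)⁻¹.injective.ne m0l),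
      val_str (by omega), val_str (by omega), val_str (by omega)] at hh
    simp only [hD 0 (by omega) (by omega), hD (q + 1) (by omega) (by omega), hD2,
      show ¬ q + 1 ≤ 1 by omega, show ¬ 2 ≤ 1 by omega, zero_le, if_true, if_false] at hh
    have : (γ - β) * (γ - β) = 0 := by linarith
    rcases mul_eq_zero.1 this with h | h <;> linarith
  subst hβ
  obtain ⟨μ, hμ⟩ : ∃ μ, α - β = 2 * μ := ⟨(α - β) / 2, by omega⟩
  have hchi' : ∀ j k, j ≠ k → chi t j k = β + μ * chi (S 0 ^ 2) j k := by
    intro j k hjk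
    have hne : (j : ℕ) ≠ k := fun h => hjk (Fin.ext h)
    rw [hchi j k hjk, chi_S_sq (by omega), crossing]
    simp only [eq_str (m := m) (i := 0) (by omega), eq_str (m := m) (i := 0 + 1) (by omega)]
    split_ifs <;> omega
  refine ⟨μ, by omega, fun h y hy => ?_⟩
  have hq : qk y = qk (L h * t * (L h)⁻¹) := by
    rw [hy, map_mul, map_mul, map_mul, map_mul, map_inv, map_inv, hL, htq]
  obtain ⟨c, hc⟩ := chi_congr (by omega) hq
  refine ⟨?_, β + c, fun j k hjk => ?_⟩
  · rw [IsPure, perm_congr (by omega) hq]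
    exact htp.conj _
  · rw [hc j k hjk, chi_conj htp, hP, hchi' _ _ ((perm h)⁻¹.injective.ne hjk),
      chi_conj (isPure_S_sq 0)]
    ring

end BG

end

section

open FreeGroup (of)

theorem commute_of_braid {Γ : Type*} [Group Γ] {a b : Γ} (h : a * b * a = b * a * b) :
    Commute (a ^ 2 * (b * a ^ 2 * b⁻¹) * b ^ 2) b := by
  have k : b * a * a * b * a * a = a * a * b * a * a * b := by
    calc b * a * a * b * a * a = b * a * (a * b * a) * a := by group
      _ = b * a * (b * a * b) * a := by rw [h]
      _ = (b * a * b) * (a * b * a) := by group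
      _ = (a * b * a) * (b * a * b) := by rw [h]
      _ = a * (b * a * b) * a * b := by group
      _ = a * (a * b * a) * a * b := by rw [h]
      _ = _ := by group
  calc a ^ 2 * (b * a ^ 2 * b⁻¹) * b ^ 2 * b = a * a * b * a * a * b * b := by
        simp only [pow_two]; group
    _ = _ := by rw [← k]; simp only [pow_two]; group

namespace BG

variable {m r : ℕ}

theorem commute_up_up (x : BG r) : Commute (up (up x)) (S (r + 1) : BG (r + 2)) := by
  induction x using induction with
  | h0 => simp
  | h1 i h =>
    rw [up_S h, up_S (by omega)]
    exact comm (by omega)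
  | hmul a b ha hb => rw [map_mul, map_mul]; exact ha.mul_left hb
  | hinv a ha => rw [map_inv, map_inv]; exact ha.inv_left

variable {φ : BG (r + 2) →* BG (r + 2) ⧸ Subgroup.center (BG (r + 2))}

theorem exists_chi_crossing (hr : 2 ≤ r) {μ : ℤ}
    (hμ : ∀ h y : BG (r + 2), qk y = φ (h * S 0 ^ 2 * h⁻¹) → IsPure y ∧
      ∃ c, ∀ j k, j ≠ k → chi y j k = c + μ * chi (h * S 0 ^ 2 * h⁻¹) j k)
    {i j : Fin (r + 1)} (hij : i ≠ j) :
    ∃ g, IsPure g ∧ Commute (qk g) (φ (S (r + 1))) ∧ ∃ c, ∀ p q, p ≠ q → chi g p q =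
      c + 2 * μ * crossing i.castSucc.castSucc j.castSucc.castSucc p q := by
  obtain ⟨h, hi, hj⟩ := exists_perm_str (by omega) hij
  obtain ⟨g, hg⟩ := qk_surjective (φ (up (up h) * S 0 ^ 2 * (up (up h))⁻¹))
  obtain ⟨hp, c, hc⟩ := hμ _ _ hg
  refine ⟨g, hp, ?_, c, fun p q hpq => ?_⟩
  · rw [hg]
    exact (((commute_up_up h).mul_left ((comm (by omega)).pow_left 2)).mul_left
      (commute_up_up h).inv_left).map φ
  · rw [hc p q hpq, chi_conj_S_sq (by omega), str_castSucc (by omega), str_castSucc (by omega),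
      str_castSucc (by omega), str_castSucc (by omega), perm_up, perm_up, perm_up, perm_up, hi, hj]
    ring

theorem exists_chi_triple (hr : 2 ≤ r) {μ : ℤ}
    (hμ : ∀ h y : BG (r + 2), qk y = φ (h * S 0 ^ 2 * h⁻¹) → IsPure y ∧
      ∃ c, ∀ j k, j ≠ k → chi y j k = c + μ * chi (h * S 0 ^ 2 * h⁻¹) j k) :
    ∃ g, IsPure g ∧ Commute (qk g) (φ (S (r + 1))) ∧
      chi g (str r) (str (r + 2)) = chi g (str 0) (str (r + 2)) + 2 * μ := by
  obtain ⟨d, hd⟩ := S_conj (m := r + 2) (i := r) (by omega)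
  obtain ⟨e, he⟩ := S_conj (m := r + 2) (i := r + 1) (by omega)
  have hd2 : d * S 0 ^ 2 * d⁻¹ = S r ^ 2 := by rw [← conj_pow, hd]
  have he2 : e * S 0 ^ 2 * e⁻¹ = S (r + 1) ^ 2 := by rw [← conj_pow, he]
  have hf2 : (S (r + 1) * d) * S 0 ^ 2 * (S (r + 1) * d)⁻¹ =
      S (r + 1) * S r ^ 2 * (S (r + 1))⁻¹ := by rw [← hd2]; group
  obtain ⟨x, hx⟩ := qk_surjective (φ (d * S 0 ^ 2 * d⁻¹))
  obtain ⟨y, hy⟩ := qk_surjective (φ ((S (r + 1) * d) * S 0 ^ 2 * (S (r + 1) * d)⁻¹))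
  obtain ⟨z, hz⟩ := qk_surjective (φ (e * S 0 ^ 2 * e⁻¹))
  obtain ⟨hxp, c, hc⟩ := hμ _ _ hx
  obtain ⟨hyp, c', hc'⟩ := hμ _ _ hy
  obtain ⟨hzp, c'', hc''⟩ := hμ _ _ hz
  rw [hd2] at hc hx
  rw [hf2] at hc' hy
  rw [he2] at hc'' hz
  refine ⟨x * y * z, (hxp.mul hyp).mul hzp, ?_, ?_⟩
  · rw [map_mul, map_mul, hx, hy, hz, ← map_mul, ← map_mul]
    refine Commute.map ?_ φ
    have h := braid (m := r + 2) (i := r) (by omega)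
    generalize (S r : BG (r + 2)) = a at *
    generalize (S (r + 1) : BG (r + 2)) = b at *
    exact commute_of_braid h
  · have hnd : ∀ {i : ℕ}, i ≤ r → (str i : Fin (r + 2 + 1)) ≠ str (r + 2) := fun h =>
      str_ne (by omega) le_rfl (by omega)
    rw [chi_mul_pure _ hzp, chi_mul_pure _ hyp, chi_mul_pure _ hzp, chi_mul_pure _ hyp,
      hc _ _ (hnd le_rfl), hc' _ _ (hnd le_rfl), hc'' _ _ (hnd le_rfl), hc _ _ (hnd (zero_le)),
      hc' _ _ (hnd zero_le), hc'' _ _ (hnd zero_le), chi_S_sq (by omega), chi_S_sq (by omega),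
      chi_conj_S_sq (by omega), chi_S_sq (by omega), chi_S_sq (by omega), chi_conj_S_sq (by omega),
      perm_S (by omega), Equiv.swap_apply_left, Equiv.swap_apply_of_ne_of_ne
        (str_ne (by omega) (by omega) (by omega)) (str_ne (by omega) (by omega) (by omega))]
    simp only [crossing, str_inj (m := r + 2) (show r ≤ r + 2 by omega) (show r + 1 ≤ r + 2 by omega),
      str_inj (m := r + 2) (show r ≤ r + 2 by omega) (show r + 1 + 1 ≤ r + 2 by omega),
      str_inj (m := r + 2) (show r + 2 ≤ r + 2 by omega) (show r + 1 ≤ r + 2 by omega),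
      str_inj (m := r + 2) (show r + 2 ≤ r + 2 by omega) (show r ≤ r + 2 by omega),
      str_inj (m := r + 2) (show 0 ≤ r + 2 by omega) (show r ≤ r + 2 by omega),
      str_inj (m := r + 2) (show 0 ≤ r + 2 by omega) (show r + 1 ≤ r + 2 by omega),
      str_inj (m := r + 2) (show 0 ≤ r + 2 by omega) (show r + 1 + 1 ≤ r + 2 by omega)]
    simp [show (0 : ℕ) ≠ r by omega]
    ring

end BG

end

section

open FreeGroup (of)

namespace BG

theorem exists_zpow_of_standard {r : ℕ} (hr : 2 ≤ r)
    {φ : BG (r + 2) →* BG (r + 2) ⧸ Subgroup.center (BG (r + 2))}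
    (hφ : ∀ b y, qk y = φ b → perm y = perm b) :
    ∃ (n k : ℤ) (d : BG (r + 2)), n ≠ 0 ∧ k ≠ 0 ∧
      φ ((S (r + 1) ^ 2) ^ n) = qk (d * (S (r + 1) ^ 2) ^ k * d⁻¹) := by
  obtain ⟨μ, hμ0, hμ⟩ := exists_chi_of_standard (by omega) hφ
  obtain ⟨e, he⟩ := S_conj (m := r + 2) (i := r + 1) (by omega)
  have he2 : e * S 0 ^ 2 * e⁻¹ = S (r + 1) ^ 2 := by rw [← conj_pow, he]
  obtain ⟨w0, hw0⟩ := qk_surjective (φ (S (r + 1) ^ 2))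
  obtain ⟨hw0p, c0, hc0⟩ := hμ e w0 (by rw [hw0, he2])
  rw [he2] at hc0
  obtain ⟨z, hz, n, hn, hzn⟩ := exists_mem_center (m := r + 2) (by omega)
  have hzp := isPure_of_mem_center (by omega) hz
  obtain ⟨w, hw⟩ : ∃ w, w = w0 ^ n * z ^ (-c0) := ⟨_, rfl⟩
  have hwp : IsPure w := by rw [hw]; exact (hw0p.zpow n).mul (hzp.zpow _)
  have hwq : qk w = φ ((S (r + 1) ^ 2) ^ n) := by
    rw [hw, map_mul, map_zpow, map_zpow, hw0, qk_eq_one.2 hz, one_zpow, mul_one, map_zpow]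
  have hwchi : ∀ j k, j ≠ k → chi w j k = n * μ * chi (S (r + 1) ^ 2) j k := by
    intro j k hjk
    rw [hw, chi_mul_pure _ (hzp.zpow _), chi_zpow_pure hw0p, chi_zpow_pure hzp, hzn j k hjk,
      hc0 j k hjk]
    ring
  have hcomm : ∀ g, IsPure g → Commute (qk g) (φ (S (r + 1))) → Commute g w := by
    intro g hg h
    refine commute_of_qk hg hwp ?_
    rw [hwq, map_zpow, map_pow]
    exact (h.pow_right 2).zpow_right n
  obtain ⟨f, b, hfb, hbp, hbchi, -⟩ := hwp.exists_kf_mul_up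
  have hlast : (Fin.last (r + 1 + 1)) = str (r + 1 + 1) := by rw [eq_str le_rfl]; rfl
  have hb : b = 1 := by
    refine eq_one_of_commute _ b hbp (fun j k => ?_) fun i j hij hi hj => ?_
    · by_cases hjk : j = k
      · rw [hjk, chi_self]
      · rw [hbchi, hwchi _ _ ((Fin.castSucc_injective _).ne hjk), chi_S_sq (by omega), ← hlast,
          crossing, if_neg]
        · simp
        · rintro (⟨-, h⟩ | ⟨h, -⟩)
          · exact (Fin.castSucc_lt_last _).ne h
          · exact (Fin.castSucc_lt_last _).ne h
    · obtain ⟨i, rfl⟩ := Fin.exists_castSucc_eq.2 hi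
      obtain ⟨j, rfl⟩ := Fin.exists_castSucc_eq.2 hj
      obtain ⟨g, hg, hgc, c, hc⟩ := exists_chi_crossing hr hμ (i := i) (j := j)
        fun h => hij (by rw [h])
      obtain ⟨f', b', hfb', hb'p, hb'chi, -⟩ := hg.exists_kf_mul_up
      have := hcomm g hg hgc
      rw [hfb, hfb'] at this
      refine ⟨b', c, 2 * μ, hb'p, commute_of_kf_mul_up this, by omega, fun p q hpq => ?_⟩
      rw [hb'chi, hc _ _ ((Fin.castSucc_injective _).ne hpq)]
      simp only [crossing, Fin.castSucc_inj]
  rw [hb, map_one, mul_one] at hfb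
  have hcl : ∀ j : Fin (r + 1 + 1), j.castSucc ≠ Fin.last (r + 1 + 1) := fun j =>
    (Fin.castSucc_lt_last _).ne
  have hcs : ∀ {i j : Fin (r + 1)}, i ≠ j → i.castSucc.castSucc ≠ j.castSucc.castSucc :=
    fun h h' => h (Fin.castSucc_injective _ (Fin.castSucc_injective _ h'))
  rw [hfb] at hcomm
  obtain ⟨d, k, hdk⟩ := exists_conj_zpow (f := f) (fun j => by
      rw [← hfb, hwchi _ _ (hcl _), chi_S_sq (by omega), ← hlast, crossing, if_neg]
      · simp
      · rintro (⟨h, -⟩ | ⟨h, -⟩)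
        · rw [eq_str (by omega)] at h
          simp only [Fin.val_castSucc] at h
          omega
        · exact hcl _ h)
    (fun i j hij => by
      obtain ⟨g, hg, hgc, c, hc⟩ := exists_chi_crossing hr hμ hij
      refine ⟨g, hg, hcomm g hg hgc, ?_, ?_⟩
      · rw [hc _ _ (hcl _), hc _ _ (hcl _), crossing, crossing, if_neg, if_neg] <;>
        · rintro (⟨-, h⟩ | ⟨-, h⟩)
          · exact hcl _ h.symm
          · exact hcl _ h.symm
      · rw [hc _ _ (hcl _), hc _ _ (hcs hij), crossing, crossing, if_neg, if_pos (Or.inl ⟨rfl, rfl⟩)]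
        · omega
        · rintro (⟨-, h⟩ | ⟨-, h⟩)
          · exact hcl _ h.symm
          · exact hcl _ h.symm)
    (by
      obtain ⟨g, hg, hgc, hc⟩ := exists_chi_triple hr hμ
      refine ⟨str r, str 0, str_ne (by omega) (by omega) (by omega), g, hg, hcomm g hg hgc, ?_⟩
      rw [← str_castSucc (by omega), ← str_castSucc (by omega), ← str_castSucc (by omega),
        ← str_castSucc (by omega)]
      intro h
      rw [hlast] at h
      exact hμ0 (by linarith [hc.symm.trans h]))
  refine ⟨n, k, d, hn, ?_, by rw [← hwq, hfb, hdk]⟩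
  rintro rfl
  rw [zpow_zero, mul_one, mul_inv_cancel] at hdk
  have h1 := hwchi (str (r + 1)) (str (r + 1 + 1)) (str_ne (by omega) (by omega) (by omega))
  rw [hfb, hdk, chi_one, chi_S_sq (by omega), crossing, if_pos (Or.inl ⟨rfl, rfl⟩)] at h1
  exact mul_ne_zero hn hμ0 (by linarith)

/-- Some positive power of the image of the half twist is sent to a nonzero power of a twist. -/
theorem exists_pow_of_injective {m : ℕ} (hm : 4 ≤ m)
    {ρ : BG m ⧸ Subgroup.center (BG m) →* BG m ⧸ Subgroup.center (BG m)}
    (hρ : Function.Injective ρ) : ∃ (n k : ℤ) (c : BG m ⧸ Subgroup.center (BG m)), n ≠ 0 ∧ k ≠ 0 ∧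
      ρ (qk (S 0) ^ n) = c * qk (S 0) ^ (2 * k) * c⁻¹ := by
  obtain ⟨x, hx⟩ := exists_standard hm hρ
  obtain ⟨r, rfl⟩ : ∃ r, m = r + 2 := ⟨m - 2, by omega⟩
  obtain ⟨n, k, d, hn, hk, h⟩ := exists_zpow_of_standard (r := r) (by omega)
    (φ := (MulAut.conj (qk x)).toMonoidHom.comp (ρ.comp qk)) hx
  obtain ⟨e, he⟩ := S_conj (m := r + 2) (i := r + 1) (by omega)
  refine ⟨2 * n, k, (ρ (qk e))⁻¹ * (qk x)⁻¹ * qk d * qk e, by omega, hk, ?_⟩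
  have h2 : qk x * ρ (qk (S (r + 1)) ^ (2 * n)) * (qk x)⁻¹ =
      qk d * qk (S (r + 1)) ^ (2 * k) * (qk d)⁻¹ := by
    replace h : qk x * ρ (qk ((S (r + 1) ^ 2) ^ n)) * (qk x)⁻¹ = _ := h
    rw [zpow_mul, zpow_mul]
    simp only [map_mul, map_inv, map_zpow, map_pow] at h ⊢
    exact h
  have he' : qk (S (r + 1)) = qk e * qk (S 0) * (qk e)⁻¹ := by
    rw [← he, map_mul, map_mul, map_inv]
  rw [he', conj_zpow, conj_zpow, map_mul, map_mul, map_inv] at h2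
  generalize ρ (qk (S 0) ^ (2 * n)) = u at *
  generalize qk (S 0 : BG (r + 2)) ^ (2 * k) = v at *
  generalize ρ (qk e) = a at *
  have : u = (a⁻¹ * (qk x)⁻¹) * (qk x * (a * u * a⁻¹) * (qk x)⁻¹) * (qk x * a) := by group
  rw [this, h2]
  group

end BG

end

section

open FreeGroup (of lift)
open scoped commutatorElement

/-- The free group of rank two. -/
abbrev F2 : Type := FreeGroup (Fin 2)

namespace F2

/-- The endomorphism of the free group of rank two with given values on the generators. -/
def hom {H : Type*} [Group H] (x y : H) : F2 →* H := lift ![x, y]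

@[simp] theorem hom_zero {H : Type*} [Group H] (x y : H) : hom x y (of 0) = x := by simp [hom]
@[simp] theorem hom_one {H : Type*} [Group H] (x y : H) : hom x y (of 1) = y := by simp [hom]

theorem hom_ext {H : Type*} [Group H] {f g : F2 →* H} (h0 : f (of 0) = g (of 0))
    (h1 : f (of 1) = g (of 1)) : f = g := by
  ext i; fin_cases i <;> assumption

theorem aut_ext {f g : MulAut F2} (h0 : f (of 0) = g (of 0)) (h1 : f (of 1) = g (of 1)) :
    f = g := by
  apply mulAut_ext; intro i; fin_cases i <;> assumption

/-- An automorphism from mutually inverse values on the generators. -/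
def aut (x y x' y' : F2) (h0 : hom x' y' x = of 0) (h1 : hom x' y' y = of 1)
    (h0' : hom x y x' = of 0) (h1' : hom x y y' = of 1) : MulAut F2 :=
  MonoidHom.toMulEquiv (hom x y) (hom x' y') (hom_ext (by simpa using h0) (by simpa using h1))
    (hom_ext (by simpa using h0') (by simpa using h1'))

theorem aut_zero (x y x' y' : F2) (h0 h1 h0' h1') : aut x y x' y' h0 h1 h0' h1' (of 0) = x :=
  hom_zero _ _
theorem aut_one (x y x' y' : F2) (h0 h1 h0' h1') : aut x y x' y' h0 h1 h0' h1' (of 1) = y :=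
  hom_one _ _

/-- The action of the three generators of the braid group on four strands on the free group. -/
def tw : ℕ → MulAut F2
  | 0 => aut (of 0) (of 1 * of 0) (of 0) (of 1 * (of 0)⁻¹) (by simp) (by simp) (by simp) (by simp)
  | 1 => aut (of 0 * (of 1)⁻¹) (of 1) (of 0 * of 1) (of 1) (by simp) (by simp) (by simp) (by simp)
  | _ => aut (of 0) (of 0 * of 1) (of 0) ((of 0)⁻¹ * of 1) (by simp) (by simp) (by simp) (by simp)

@[simp] theorem tw_zero_zero : tw 0 (of 0) = of 0 := by rw [tw, aut_zero]
@[simp] theorem tw_zero_one : tw 0 (of 1) = of 1 * of 0 := by rw [tw, aut_one]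
@[simp] theorem tw_one_zero : tw 1 (of 0) = of 0 * (of 1)⁻¹ := by rw [tw, aut_zero]
@[simp] theorem tw_one_one : tw 1 (of 1) = of 1 := by rw [tw, aut_one]
@[simp] theorem tw_two_zero : tw 2 (of 0) = of 0 := by simp only [tw, aut_zero]
@[simp] theorem tw_two_one : tw 2 (of 1) = of 0 * of 1 := by simp only [tw, aut_one]

theorem aut_conj (f : MulAut F2) (w : F2) : f * MulAut.conj w * f⁻¹ = MulAut.conj (f w) := by
  ext x
  simp [MulAut.mul_apply, MulAut.conj_apply]

theorem tw_braid_zero : tw 0 * tw 1 * tw 0 = tw 1 * tw 0 * tw 1 := by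
  apply aut_ext <;> simp [mul_assoc]

theorem tw_braid_one : tw 1 * tw 2 * tw 1 = tw 2 * tw 1 * tw 2 := by
  apply aut_ext <;> simp [mul_assoc]

theorem tw_comm : tw 0 * tw 2 = tw 2 * tw 0 := by
  apply aut_ext <;> simp [mul_assoc]

theorem eq_one_of_commute {w : F2} (h0 : Commute w (of 0)) (h1 : Commute w (of 1)) : w = 1 := by
  obtain ⟨m, hm⟩ := FG.exists_zpow_of_commute_of h0
  obtain ⟨n, hn⟩ := FG.exists_zpow_of_commute_of h1
  have h := congrArg (FG.ex (0 : Fin 2)) (hm.symm.trans hn)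
  simp at h
  rw [hm, h, zpow_zero]

theorem conj_injective : Function.Injective (MulAut.conj : F2 →* MulAut F2) := by
  rw [injective_iff_map_eq_one]
  intro w hw
  have h : ∀ x, Commute w x := fun x => by
    have := DFunLike.congr_fun hw x
    rw [MulAut.conj_apply, MulAut.one_apply, mul_inv_eq_iff_eq_mul] at this
    exact this
  exact eq_one_of_commute (h _) (h _)

end F2

section Relations
variable {G : Type*} [Group G] {x y z : G}

theorem conj_commutator_of_braid (h : x * y * x = y * x * y) (h' : y * z * y = z * y * z)
    (hc : x * z = z * x) :
    x * (y * (z * x⁻¹)⁻¹ * y⁻¹ * (z * x⁻¹)) * x⁻¹ =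
        y * (z * x⁻¹)⁻¹ * y⁻¹ * (z * x⁻¹) * (z * x⁻¹) ∧
    y * (y * (z * x⁻¹)⁻¹ * y⁻¹ * (z * x⁻¹)) * y⁻¹ = y * (z * x⁻¹)⁻¹ * y⁻¹ * (z * x⁻¹) ∧
    z * (y * (z * x⁻¹)⁻¹ * y⁻¹ * (z * x⁻¹)) * z⁻¹ =
        z * x⁻¹ * (y * (z * x⁻¹)⁻¹ * y⁻¹ * (z * x⁻¹)) := by
  have e1 : y * z⁻¹ * y⁻¹ = z⁻¹ * y⁻¹ * z := by
    calc y * z⁻¹ * y⁻¹ = z⁻¹ * y⁻¹ * (y * z * y) * z⁻¹ * y⁻¹ := by group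
      _ = _ := by rw [h']; group
  have e2 : z⁻¹ * y * z = y * z * y⁻¹ := by
    calc z⁻¹ * y * z = z⁻¹ * (y * z * y) * y⁻¹ := by group
      _ = _ := by rw [h']; group
  have e3 : x * y⁻¹ * x⁻¹ = y⁻¹ * x⁻¹ * y := by
    calc x * y⁻¹ * x⁻¹ = y⁻¹ * x⁻¹ * (x * y * x) * y⁻¹ * x⁻¹ := by group
      _ = _ := by rw [h]; group
  have hc' : x⁻¹ * z = z * x⁻¹ := by
    calc x⁻¹ * z = x⁻¹ * (z * x) * x⁻¹ := by group
      _ = _ := by rw [← hc]; group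
  have hc'' : x * z⁻¹ = z⁻¹ * x := by
    calc x * z⁻¹ = z⁻¹ * (z * x) * z⁻¹ := by group
      _ = _ := by rw [← hc]; group
  refine ⟨?_, ?_, ?_⟩
  · calc x * (y * (z * x⁻¹)⁻¹ * y⁻¹ * (z * x⁻¹)) * x⁻¹
        = (x * y * x) * z⁻¹ * y⁻¹ * (z * x⁻¹) * x⁻¹ := by group
      _ = y * x * (y * z⁻¹ * y⁻¹) * (z * x⁻¹) * x⁻¹ := by rw [h]; group
      _ = y * x * z⁻¹ * y⁻¹ * z * (z * x⁻¹) * x⁻¹ := by rw [e1]; group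
      _ = y * x * z⁻¹ * y⁻¹ * z * (x⁻¹ * z) * x⁻¹ := by rw [hc']
      _ = _ := by group
  · have hW : (z * x⁻¹)⁻¹ * y * (z * x⁻¹) = x * y * z * y⁻¹ * x⁻¹ := by
      calc (z * x⁻¹)⁻¹ * y * (z * x⁻¹) = x * (z⁻¹ * y * z) * x⁻¹ := by group
        _ = _ := by rw [e2]; group
    have hWc : y * (x * y * z * y⁻¹ * x⁻¹) * y⁻¹ = x * y * z * y⁻¹ * x⁻¹ := by
      calc y * (x * y * z * y⁻¹ * x⁻¹) * y⁻¹ = (y * x * y) * z * y⁻¹ * x⁻¹ * y⁻¹ := by group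
        _ = x * y * (x * z) * y⁻¹ * x⁻¹ * y⁻¹ := by rw [← h]; group
        _ = x * y * z * (x * y⁻¹ * x⁻¹) * y⁻¹ := by rw [hc]; group
        _ = _ := by rw [e3]; group
    calc y * (y * (z * x⁻¹)⁻¹ * y⁻¹ * (z * x⁻¹)) * y⁻¹
        = y * (y * ((z * x⁻¹)⁻¹ * y * (z * x⁻¹)) * y⁻¹)⁻¹ := by group
      _ = y * ((z * x⁻¹)⁻¹ * y * (z * x⁻¹))⁻¹ := by rw [hW, hWc]
      _ = _ := by group
  · have e6 : x⁻¹ * y * x = y * x * y⁻¹ := by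
      calc x⁻¹ * y * x = x⁻¹ * (y * x * y) * y⁻¹ := by group
        _ = _ := by rw [← h]; group
    have e7 : y⁻¹ * z⁻¹ * y⁻¹ = z⁻¹ * y⁻¹ * z⁻¹ := by
      calc y⁻¹ * z⁻¹ * y⁻¹ = (y * z * y)⁻¹ := by group
        _ = _ := by rw [h']; group
    calc z * (y * (z * x⁻¹)⁻¹ * y⁻¹ * (z * x⁻¹)) * z⁻¹
        = z * y * x * z⁻¹ * y⁻¹ * (z * x⁻¹) * z⁻¹ := by group
      _ = z * y * x * (z⁻¹ * y⁻¹ * z⁻¹) * (z * x⁻¹) := by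
        rw [mul_assoc _ (z * x⁻¹), show z * x⁻¹ * z⁻¹ = x⁻¹ by rw [← hc', mul_inv_cancel_right]]
        group
      _ = z * (y * x * y⁻¹) * z⁻¹ * y⁻¹ * (z * x⁻¹) := by rw [← e7]; group
      _ = _ := by rw [← e6]; group

end Relations


namespace BG

/-- The action of the braid group on four strands on the free group of rank two. -/
def theta : BG 3 →* MulAut F2 :=
  lift F2.tw
    (by
      intro i hi
      obtain rfl | rfl : i = 0 ∨ i = 1 := by omega
      · exact F2.tw_braid_zero
      · exact F2.tw_braid_one)
    (by
      intro i j hij hj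
      obtain ⟨rfl, rfl⟩ : i = 0 ∧ j = 2 := by omega
      exact F2.tw_comm)

theorem theta_S {i : ℕ} (h : i < 3) : theta (S i) = F2.tw i := lift_S _ _ _ h

/-- The free normal subgroup of the braid group on four strands. -/
def iota : F2 →* BG 3 :=
  F2.hom (S 2 * (S 0)⁻¹) (S 1 * (S 2 * (S 0)⁻¹)⁻¹ * (S 1)⁻¹ * (S 2 * (S 0)⁻¹))

theorem iota_zero : iota (of 0) = S 2 * (S 0)⁻¹ := F2.hom_zero _ _

theorem iota_one : iota (of 1) = S 1 * (iota (of 0))⁻¹ * (S 1)⁻¹ * iota (of 0) := by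
  rw [iota_zero]; exact F2.hom_one _ _

theorem S_zero_comm_two : (S 0 * S 2 : BG 3) = S 2 * S 0 := (comm (by omega)).eq

theorem iota_tw {i : ℕ} (hi : i < 3) (w : F2) :
    iota (F2.tw i w) = S i * iota w * (S i)⁻¹ := by
  suffices h : iota.comp (F2.tw i).toMonoidHom = (MulAut.conj (S i)).toMonoidHom.comp iota from
    DFunLike.congr_fun h w
  obtain ⟨h1, h2, h3⟩ := conj_commutator_of_braid (x := (S 0 : BG 3)) (y := S 1) (z := S 2)
    (braid (by omega)) (braid (by omega)) S_zero_comm_two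
  have hc := S_zero_comm_two
  rw [← iota_zero, ← iota_one] at h1 h2 h3
  apply F2.hom_ext
  · change iota (F2.tw i (of 0)) = S i * iota (of 0) * (S i)⁻¹
    obtain rfl | rfl | rfl : i = 0 ∨ i = 1 ∨ i = 2 := by omega
    · rw [F2.tw_zero_zero, iota_zero, ← mul_assoc, hc]; group
    · rw [F2.tw_one_zero, map_mul, map_inv, iota_one]; group
    · rw [F2.tw_two_zero, iota_zero, mul_assoc, mul_assoc, ← mul_inv_rev, ← hc]; group
  · change iota (F2.tw i (of 1)) = S i * iota (of 1) * (S i)⁻¹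
    obtain rfl | rfl | rfl : i = 0 ∨ i = 1 ∨ i = 2 := by omega
    · rw [F2.tw_zero_one, map_mul, h1]
    · rw [F2.tw_one_one, h2]
    · rw [F2.tw_two_one, map_mul, h3]

theorem iota_theta (g : BG 3) : ∀ w, iota (theta g w) = g * iota w * g⁻¹ := by
  refine induction (p := fun g => ∀ w, iota (theta g w) = g * iota w * g⁻¹) ?_ ?_ ?_ ?_ g
  · intro w; simp
  · intro i hi w; rw [theta_S hi, iota_tw hi]
  · intro a b ha hb w
    rw [map_mul, MulAut.mul_apply, ha, hb]; group
  · intro a ha w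
    have := ha (theta a⁻¹ w)
    rw [← MulAut.mul_apply, ← map_mul, mul_inv_cancel, map_one, MulAut.one_apply] at this
    rw [this]; group

theorem theta_iota (w : F2) : theta (iota w) = MulAut.conj w := by
  suffices h : theta.comp iota = MulAut.conj from DFunLike.congr_fun h w
  have h0 : theta (iota (of 0)) = MulAut.conj (of 0) := by
    rw [iota_zero, map_mul, map_inv, theta_S (by omega), theta_S (by omega), mul_inv_eq_iff_eq_mul]
    apply F2.aut_ext <;> simp [mul_assoc]
  apply F2.hom_ext
  · exact h0
  · change theta (iota (of 1)) = _
    rw [iota_one]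
    simp only [map_mul, map_inv, h0, theta_S (show 1 < 3 by omega)]
    rw [← map_inv, F2.aut_conj, ← map_mul]
    simp

end BG

end

section

open FreeGroup (of)
open FG (ex)

namespace F2

/-- The matrix of the map induced on the abelianization by an endomorphism. -/
def abm (f : F2 →* F2) : Matrix (Fin 2) (Fin 2) ℤ :=
  !![ex 0 (f (of 0)), ex 0 (f (of 1)); ex 1 (f (of 0)), ex 1 (f (of 1))]

theorem ex_abm (f : F2 →* F2) (j : Fin 2) (w : F2) :
    ex j (f w) = abm f j 0 * ex 0 w + abm f j 1 * ex 1 w := by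
  induction w using FreeGroup.induction_on with
  | C1 => simp
  | of i => fin_cases i <;> fin_cases j <;> simp [abm]
  | inv_of i h => rw [map_inv, FG.ex_inv, h, FG.ex_inv, FG.ex_inv]; ring
  | mul u v hu hv => rw [map_mul, FG.ex_mul, hu, hv, FG.ex_mul, FG.ex_mul]; ring

theorem abm_comp (f g : F2 →* F2) : abm (f.comp g) = abm f * abm g := by
  ext i j
  fin_cases i <;> fin_cases j <;>
    simp [abm, Matrix.mul_apply, Fin.sum_univ_two, ex_abm f _ (g _)]

/-- The action of the automorphism group on the abelianization. -/
def mat : MulAut F2 →* Matrix (Fin 2) (Fin 2) ℤ where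
  toFun a := abm a.toMonoidHom
  map_one' := by ext i j; fin_cases i <;> fin_cases j <;> simp [abm]
  map_mul' a b := abm_comp a.toMonoidHom b.toMonoidHom

theorem ex_mat (a : MulAut F2) (j : Fin 2) (w : F2) :
    ex j (a w) = mat a j 0 * ex 0 w + mat a j 1 * ex 1 w := ex_abm a.toMonoidHom j w

theorem mat_tw_zero : mat (tw 0) = !![1, 1; 0, 1] := by
  ext i j; fin_cases i <;> fin_cases j <;> simp [mat, abm]

theorem mat_tw_one : mat (tw 1) = !![1, 0; -1, 1] := by
  ext i j; fin_cases i <;> fin_cases j <;> simp [mat, abm]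

theorem mat_tw_two : mat (tw 2) = !![1, 1; 0, 1] := by
  ext i j; fin_cases i <;> fin_cases j <;> simp [mat, abm]

theorem mat_conj (w : F2) : mat (MulAut.conj w) = 1 := by
  ext i j; fin_cases i <;> fin_cases j <;> simp [mat, abm]

end F2

/-- The quotient of the braid group on four strands by its center. -/
abbrev G4 : Type := BG 3 ⧸ Subgroup.center (BG 3)

namespace G4
open BG F2

/-- The image of a standard generator. -/
def s (i : ℕ) : G4 := qk (S i)

theorem induction {p : G4 → Prop} (h0 : p 1) (h1 : ∀ i, i < 3 → p (s i))
    (hmul : ∀ a b, p a → p b → p (a * b)) (hinv : ∀ a, p a → p a⁻¹) (g : G4) : p g := by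
  obtain ⟨b, rfl⟩ := qk_surjective g
  refine BG.induction (p := fun b => p (qk b)) (by simpa using h0) h1
    (fun a b ha hb => by rw [map_mul]; exact hmul _ _ ha hb)
    (fun a ha => by rw [map_inv]; exact hinv _ ha) b

theorem s_braid {i : ℕ} (h : i + 1 < 3) : s i * s (i + 1) * s i = s (i + 1) * s i * s (i + 1) := by
  simp only [s, ← map_mul, braid h]

theorem s_comm : s 0 * s 2 = s 2 * s 0 := by simp only [s, ← map_mul, S_zero_comm_two]

theorem s_prod_pow : (s 0 * s 1 * s 2) ^ 4 = 1 := by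
  have h := cst_zero_pow_mem_center (m := 2)
  rw [cst_of_lt (by omega), cst_of_lt (by omega), cst_of_lt (by omega)] at h
  replace h : (S 0 * (S 1 * (S 2 * cst (2 + 1))) : BG 3) ^ 4 ∈ Subgroup.center (BG 3) := h
  rw [cst_last, mul_one, ← mul_assoc] at h
  rw [s, s, s, ← map_mul, ← map_mul, ← map_pow]
  exact qk_eq_one.2 h

theorem s_conj {i : ℕ} (hi : i < 3) : ∃ d, d * s 0 * d⁻¹ = s i := by
  obtain ⟨d, hd⟩ := S_conj (m := 3) hi
  exact ⟨qk d, by rw [s, s, ← map_inv, ← map_mul, ← map_mul, hd]⟩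

theorem theta_of_mem_center {z : BG 3} (hz : z ∈ Subgroup.center (BG 3)) : BG.theta z = 1 := by
  ext w
  apply F2.conj_injective
  rw [← theta_iota, iota_theta, ← Subgroup.mem_center_iff.1 hz, mul_inv_cancel_right, theta_iota,
    MulAut.one_apply]

/-- The action on the free group of rank two. -/
def theta : G4 →* MulAut F2 := QuotientGroup.lift _ BG.theta fun _ hz => theta_of_mem_center hz

theorem theta_qk (g : BG 3) : theta (qk g) = BG.theta g := rfl

theorem theta_s {i : ℕ} (h : i < 3) : theta (s i) = tw i := theta_S h

/-- The free normal subgroup of rank two. -/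
def iota : F2 →* G4 := qk.comp BG.iota

theorem iota_theta (g : G4) (w : F2) : iota (theta g w) = g * iota w * g⁻¹ := by
  obtain ⟨b, rfl⟩ := qk_surjective g
  rw [theta_qk, iota, MonoidHom.comp_apply, BG.iota_theta, map_mul, map_mul, map_inv]
  rfl

theorem theta_iota (w : F2) : theta (iota w) = MulAut.conj w := BG.theta_iota w

theorem iota_injective : Function.Injective iota := fun u v h =>
  F2.conj_injective (by rw [← theta_iota, ← theta_iota, h])

theorem iota_zero : iota (of 0) = s 2 * (s 0)⁻¹ := by
  rw [iota, MonoidHom.comp_apply, BG.iota_zero, map_mul, map_inv]; rfl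

/-- The action on the abelianization of the free group of rank two. -/
def lam : G4 →* Matrix (Fin 2) (Fin 2) ℤ := mat.comp theta

theorem ex_theta (g : G4) (j : Fin 2) (w : F2) :
    ex j (theta g w) = lam g j 0 * ex 0 w + lam g j 1 * ex 1 w := ex_mat _ _ _

theorem lam_iota (w : F2) : lam (iota w) = 1 := by
  rw [lam, MonoidHom.comp_apply, theta_iota, mat_conj]

theorem lam_s_zero : lam (s 0) = !![1, 1; 0, 1] := by
  rw [lam, MonoidHom.comp_apply, theta_s (by omega), mat_tw_zero]
theorem lam_s_one : lam (s 1) = !![1, 0; -1, 1] := by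
  rw [lam, MonoidHom.comp_apply, theta_s (by omega), mat_tw_one]
theorem lam_s_two : lam (s 2) = !![1, 1; 0, 1] := by
  rw [lam, MonoidHom.comp_apply, theta_s (by omega), mat_tw_two]

theorem lam_mul_lam_inv (g : G4) : lam g * lam g⁻¹ = 1 := by rw [← map_mul, mul_inv_cancel, map_one]
theorem lam_inv_mul_lam (g : G4) : lam g⁻¹ * lam g = 1 := by rw [← map_mul, inv_mul_cancel, map_one]

theorem lam_det (g : G4) : (lam g).det = 1 := by
  refine induction (p := fun g => (lam g).det = 1) (by simp) ?_ ?_ ?_ g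
  · intro i hi
    obtain rfl | rfl | rfl : i = 0 ∨ i = 1 ∨ i = 2 := by omega
    · rw [lam_s_zero]; simp
    · rw [lam_s_one]; simp
    · rw [lam_s_two]; simp
  · intro a b ha hb
    rw [map_mul, Matrix.det_mul, ha, hb, one_mul]
  · intro a ha
    have := congrArg Matrix.det (lam_inv_mul_lam a)
    rwa [Matrix.det_mul, ha, mul_one, Matrix.det_one] at this

theorem lam_s_zero_zpow (k : ℤ) : lam (s 0 ^ k) = !![1, k; 0, 1] := by
  have h1 : ∀ n : ℕ, lam (s 0 ^ n) = !![1, (n : ℤ); 0, 1] := by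
    intro n
    induction n with
    | zero => simp [Matrix.one_fin_two]
    | succ n ih => rw [pow_succ, map_mul, ih, lam_s_zero]; simp; ring
  obtain ⟨n, rfl | rfl⟩ := k.eq_nat_or_neg
  · rw [zpow_natCast, h1]
  · have h2 := lam_mul_lam_inv (s 0 ^ n)
    rw [zpow_neg, zpow_natCast]
    have h3 : !![1, -(n : ℤ); 0, 1] * lam (s 0 ^ n) = 1 := by
      rw [h1]; simp [Matrix.one_fin_two]
    calc lam (s 0 ^ n)⁻¹ = !![1, -(n : ℤ); 0, 1] * lam (s 0 ^ n) * lam (s 0 ^ n)⁻¹ := by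
          rw [h3, one_mul]
      _ = _ := by rw [mul_assoc, h2, mul_one]

end G4

end

section

open FreeGroup (of)
open FG (ex)

namespace F2

/-- Nonzero integral vectors. -/
abbrev Vec : Type := {v : ℤ × ℤ // v ≠ 0}

theorem vec_ne {v : ℤ × ℤ} : v ≠ 0 ↔ v.1 ≠ 0 ∨ v.2 ≠ 0 := by
  rw [Ne, Prod.ext_iff, not_and_or]; rfl

/-- The two parabolic transformations of the nonzero vectors. -/
def par : Fin 2 → Equiv.Perm Vec :=
  ![{ toFun := fun v => ⟨(v.1.1 + 2 * v.1.2, v.1.2), by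
        have := vec_ne.1 v.2; rw [vec_ne]; simp only; omega⟩
      invFun := fun v => ⟨(v.1.1 - 2 * v.1.2, v.1.2), by
        have := vec_ne.1 v.2; rw [vec_ne]; simp only; omega⟩
      left_inv := fun v => by ext <;> simp
      right_inv := fun v => by ext <;> simp },
    { toFun := fun v => ⟨(v.1.1, v.1.2 - 2 * v.1.1), by
        have := vec_ne.1 v.2; rw [vec_ne]; simp only; omega⟩
      invFun := fun v => ⟨(v.1.1, v.1.2 + 2 * v.1.1), by
        have := vec_ne.1 v.2; rw [vec_ne]; simp only; omega⟩
      left_inv := fun v => by ext <;> simp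
      right_inv := fun v => by ext <;> simp }]

theorem par_zero (v : Vec) : (par 0 v).1 = (v.1.1 + 2 * v.1.2, v.1.2) := rfl
theorem par_one (v : Vec) : (par 1 v).1 = (v.1.1, v.1.2 - 2 * v.1.1) := rfl
theorem par_zero_inv (v : Vec) : ((par 0)⁻¹ v).1 = (v.1.1 - 2 * v.1.2, v.1.2) := rfl
theorem par_one_inv (v : Vec) : ((par 1)⁻¹ v).1 = (v.1.1, v.1.2 + 2 * v.1.1) := rfl

theorem lift_par_injective : Function.Injective (FreeGroup.lift par) := by
  refine FreeGroup.injective_lift_of_ping_pong (a := par) (α := Vec)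
    (X := ![{v | v.1.2 = 0 ∨ (0 < v.1.2 ∧ v.1.2 ≤ v.1.1) ∨ (v.1.2 < 0 ∧ v.1.1 ≤ v.1.2)},
      {v | (0 < v.1.1 ∧ v.1.2 ≤ -v.1.1) ∨ (v.1.1 < 0 ∧ -v.1.1 ≤ v.1.2)}])
    (Y := ![{v | (0 < v.1.2 ∧ v.1.1 < -v.1.2) ∨ (v.1.2 < 0 ∧ -v.1.2 < v.1.1)},
      {v | v.1.1 = 0 ∨ (0 < v.1.1 ∧ v.1.1 < v.1.2) ∨ (v.1.1 < 0 ∧ v.1.2 < v.1.1)}])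
    ?_ ?_ ?_ ?_ ?_ ?_
  · intro i
    fin_cases i
    · exact ⟨⟨(1, 0), by simp⟩, Or.inl rfl⟩
    · exact ⟨⟨(1, -1), by simp⟩, Or.inl (by simp)⟩
  · intro i j hij
    fin_cases i <;> fin_cases j <;> first | exact absurd rfl hij | skip
    all_goals
      rw [Function.onFun, Set.disjoint_left]
      intro v h1 h2
      have := vec_ne.1 v.2
      simp at h1 h2
      omega
  · intro i j hij
    fin_cases i <;> fin_cases j <;> first | exact absurd rfl hij | skip
    all_goals
      rw [Function.onFun, Set.disjoint_left]
      intro v h1 h2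
      have := vec_ne.1 v.2
      simp at h1 h2
      omega
  · intro i j
    fin_cases i <;> fin_cases j
    all_goals
      rw [Set.disjoint_left]
      intro v h1 h2
      have := vec_ne.1 v.2
      simp at h1 h2
      omega
  · intro i
    fin_cases i
    all_goals
      rintro _ ⟨v, h1, rfl⟩
      have := vec_ne.1 v.2
      simp at h1 ⊢
      simp [par_zero, par_one]
      omega
  · intro i
    fin_cases i
    all_goals
      rintro _ ⟨v, h1, rfl⟩
      have := vec_ne.1 v.2
      have e0 := par_zero_inv v
      have e1 := par_one_inv v
      simp at h1 e0 e1 ⊢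
      simp [e0, e1]
      omega

/-- A representation by matrices with Sanov's values on the generators is faithful. -/
theorem eq_one_of_sanov {L : F2 →* Matrix (Fin 2) (Fin 2) ℤ} (h0 : L (of 0) = !![1, 2; 0, 1])
    (h1 : L (of 1) = !![1, 0; -2, 1]) {f : F2} (hf : L f = 1) : f = 1 := by
  apply lift_par_injective
  rw [map_one]
  have key : ∀ (f : F2) (v : Vec), (FreeGroup.lift par f v).1 =
      (L f 0 0 * v.1.1 + L f 0 1 * v.1.2, L f 1 0 * v.1.1 + L f 1 1 * v.1.2) := by
    intro f
    have hpos : ∀ (i : Fin 2) (v : Vec), (FreeGroup.lift par (of i) v).1 =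
      (L (of i) 0 0 * v.1.1 + L (of i) 0 1 * v.1.2, L (of i) 1 0 * v.1.1 + L (of i) 1 1 * v.1.2) := by
      intro i v
      rw [FreeGroup.lift_apply_of]
      fin_cases i
      · simp [h0, par_zero]
      · simp [h1, par_one]; ring
    induction f using FreeGroup.induction_on with
    | C1 => intro v; simp
    | of i => exact hpos i
    | inv_of i _ =>
      intro v
      have h2 := hpos i (FreeGroup.lift par (of i)⁻¹ v)
      have h3 : L (of i)⁻¹ * L (of i) = 1 := by rw [← map_mul, inv_mul_cancel, map_one]
      rw [← Equiv.Perm.mul_apply, ← map_mul, mul_inv_cancel, map_one, Equiv.Perm.one_apply] at h2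
      rw [h2]
      have e := fun a b => congrFun (congrFun h3 a) b
      simp only [Matrix.mul_apply, Fin.sum_univ_two, Matrix.one_apply] at e
      have e1 := e 0 0; have e2 := e 0 1; have e3 := e 1 0; have e4 := e 1 1
      simp only [if_true, Fin.isValue, zero_ne_one, one_ne_zero, if_false] at e1 e2 e3 e4
      ext
      · simp only
        linear_combination (-(FreeGroup.lift par (of i)⁻¹ v).1.1) * e1 -
          (FreeGroup.lift par (of i)⁻¹ v).1.2 * e2
      · simp only
        linear_combination (-(FreeGroup.lift par (of i)⁻¹ v).1.1) * e3 -
          (FreeGroup.lift par (of i)⁻¹ v).1.2 * e4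
    | mul u w hu hw =>
      intro v
      rw [map_mul, Equiv.Perm.mul_apply, hu, hw, map_mul]
      simp only [Matrix.mul_apply, Fin.sum_univ_two]
      ext <;> (simp only; ring)
  ext v <;> rw [key, hf] <;> simp

theorem eq_one_of_sanov_neg {L : F2 →* Matrix (Fin 2) (Fin 2) ℤ} (h0 : L (of 0) = !![1, 2; 0, 1])
    (h1 : L (of 1) = !![1, 0; -2, 1]) {f : F2} (hf : L f = -1) : False := by
  have h2 : f ^ 2 = 1 := eq_one_of_sanov h0 h1 (by rw [map_pow, hf]; simp)
  have h3 : f = 1 := by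
    have := zpow_left_injective (n := 2) (by norm_num) (a₁ := f) (a₂ := 1) (by simpa using h2)
    exact this
  rw [h3, map_one] at hf
  have := congrFun (congrFun hf 0) 0
  simp at this

end F2

end

section

open FreeGroup (of)
open FG (ex)

namespace G4
open BG F2

/-- The representation of the symmetric group on three letters by matrices modulo two. -/
def modTwo : Equiv.Perm (Fin 3) →* Matrix (Fin 2) (Fin 2) (ZMod 2) where
  toFun s := !![if s 2 = 0 then 0 else 1, if s 0 = 0 then 0 else 1;
    if s 2 = 2 then 0 else 1, if s 0 = 2 then 0 else 1]
  map_one' := by decide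
  map_mul' := by decide

theorem modTwo_eq_one : ∀ s, modTwo s = 1 → s = 1 := by
  change ∀ s : Equiv.Perm (Fin 3), !![if s 2 = 0 then (0 : ZMod 2) else 1, if s 0 = 0 then 0 else 1;
    if s 2 = 2 then 0 else 1, if s 0 = 2 then 0 else 1] = 1 → s = 1
  decide

/-- The action of the braid group on three strands on the abelianization. -/
def lamUp : BG 2 →* Matrix (Fin 2) (Fin 2) ℤ := lam.comp (qk.comp up)

theorem lamUp_S_zero : lamUp (S 0) = !![1, 1; 0, 1] := by
  rw [← lam_s_zero, s, ← up_S (m := 2) (by omega)]; rfl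

theorem lamUp_S_one : lamUp (S 1) = !![1, 0; -1, 1] := by
  rw [← lam_s_one, s, ← up_S (m := 2) (by omega)]; rfl

theorem modTwo_perm (h : BG 2) :
    (Int.castRingHom (ZMod 2)).mapMatrix (lamUp h) = modTwo (perm h) := by
  refine BG.induction (p := fun h => (Int.castRingHom (ZMod 2)).mapMatrix (lamUp h) = modTwo (perm h))
    (by simp) ?_ ?_ ?_ h
  · intro i hi
    obtain rfl | rfl : i = 0 ∨ i = 1 := by omega
    · rw [lamUp_S_zero, perm_S (by omega)]; decide
    · rw [lamUp_S_one, perm_S (by omega)]; decide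
  · intro a b ha hb
    rw [map_mul, map_mul, map_mul, map_mul, ha, hb]
  · intro a ha
    have h1 : (Int.castRingHom (ZMod 2)).mapMatrix (lamUp a⁻¹) * modTwo (perm a) = 1 := by
      rw [← ha, ← map_mul, ← map_mul, inv_mul_cancel, map_one, map_one]
    have h2 : modTwo (perm a) * modTwo (perm a⁻¹) = 1 := by
      rw [← map_mul, ← map_mul, mul_inv_cancel, map_one, map_one]
    calc _ = (Int.castRingHom (ZMod 2)).mapMatrix (lamUp a⁻¹)
          * (modTwo (perm a) * modTwo (perm a⁻¹)) := by rw [h2, mul_one]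
      _ = _ := by rw [← mul_assoc, h1, one_mul]

theorem isPure_of_lamUp {h : BG 2} (hh : lamUp h = 1) : IsPure h := by
  have := modTwo_perm h
  rw [hh, map_one] at this
  exact modTwo_eq_one _ this.symm

theorem exists_zpow_S_zero (b : BG 1) : ∃ n : ℤ, b = S 0 ^ n := by
  refine BG.induction (p := fun b => ∃ n : ℤ, b = S 0 ^ n) ⟨0, by simp⟩ ?_ ?_ ?_ b
  · intro i hi
    obtain rfl : i = 0 := by omega
    exact ⟨1, by simp⟩
  · rintro a b ⟨n, rfl⟩ ⟨k, rfl⟩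
    exact ⟨n + k, by rw [zpow_add]⟩
  · rintro a ⟨n, rfl⟩
    exact ⟨-n, by rw [zpow_neg]⟩

theorem exists_zpow_of_isPure {b : BG 1} (hb : IsPure b) : ∃ n : ℤ, b = (S 0 ^ 2) ^ n := by
  obtain ⟨n, rfl⟩ := exists_zpow_S_zero b
  obtain ⟨k, rfl | rfl⟩ := n.even_or_odd'
  · exact ⟨k, by rw [← zpow_natCast, ← zpow_mul]; rfl⟩
  · exfalso
    have h1 : IsPure (S 0 : BG 1) := by
      have := ((isPure_S_sq (m := 1) 0).zpow (-k)).mul hb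
      rw [← zpow_natCast, ← zpow_mul, ← zpow_add] at this
      convert this using 1
      rw [show ((2 : ℕ) : ℤ) * -k + (2 * k + 1) = 1 by push_cast; ring, zpow_one]
    rw [IsPure, perm_S (by omega), Equiv.swap_eq_one_iff] at h1
    exact str_ne (m := 1) (by omega) (by omega) (by omega) h1

theorem full_twist_mem_center : ((S 0 * S 1) ^ 3 : BG 2) ∈ Subgroup.center (BG 2) := by
  have h := cst_zero_pow_mem_center (m := 1)
  rw [cst_of_lt (by omega), cst_of_lt (by omega)] at h
  replace h : (S 0 * (S 1 * cst (1 + 1)) : BG 2) ^ 3 ∈ Subgroup.center (BG 2) := h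
  rwa [cst_last, mul_one] at h

theorem S_zero_sq_eq : (S 0 ^ 2 : BG 2) = kf ((of 0)⁻¹ * (of 1)⁻¹) * (S 0 * S 1) ^ 3 := by
  have hc := Subgroup.mem_center_iff.1 full_twist_mem_center (A 1 : BG 2)⁻¹
  have h0 : kf (of 0 : FreeGroup (Fin 2)) = A 0 := kf_str (m := 1) (i := 0) (by omega)
  have h1 : kf (of 1 : FreeGroup (Fin 2)) = A 1 := kf_str (m := 1) (i := 1) (by omega)
  rw [map_mul, map_inv, map_inv, h0, h1, mul_assoc, hc]
  have h2 : (A 0 : BG 2) = S 0 * A (0 + 1) * (S 0)⁻¹ := A_of_lt (by omega)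
  have h3 : (A 1 : BG 2) = S 1 ^ 2 := A_last
  rw [h2, zero_add, h3]
  have hb : (S 0 * S 1 * S 0 : BG 2) = S 1 * S 0 * S 1 := braid (m := 2) (i := 0) (by omega)
  have : ((S 0 * S 1) ^ 3 : BG 2) = S 0 * S 1 ^ 2 * S 0 * S 1 ^ 2 := by
    calc _ = S 0 * S 1 * (S 0 * S 1 * S 0) * S 1 := by simp only [pow_succ, pow_zero, one_mul, mul_assoc]
      _ = _ := by rw [hb]; simp only [pow_succ, pow_zero, one_mul, mul_assoc]
  rw [this]
  simp only [pow_succ, pow_zero, one_mul]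
  group

theorem lamUp_full_twist : lamUp ((S 0 * S 1) ^ 3) = -1 := by
  rw [map_pow, map_mul, lamUp_S_zero, lamUp_S_one]; decide

theorem lamUp_full_twist_sq_zpow (k : ℤ) : lamUp (((S 0 * S 1) ^ 3) ^ (2 * k)) = 1 := by
  have h : (((S 0 * S 1) ^ 3) ^ (2 : ℤ) : BG 2) ∈ lamUp.ker := by
    rw [MonoidHom.mem_ker, zpow_two, map_mul, lamUp_full_twist]; simp
  rw [zpow_mul]
  exact lamUp.ker.zpow_mem h k

/-- The action of the free group, conjugated so that the generators act by standard matrices. -/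
def lamFree : F2 →* Matrix (Fin 2) (Fin 2) ℤ :=
  lamUp.comp ((MulAut.conj (S 1 : BG 2)).toMonoidHom.comp (kf (m := 1)))

theorem lamFree_apply (f : F2) : lamFree f = lamUp (S 1) * lamUp (kf f) * lamUp (S 1)⁻¹ := by
  rw [← map_mul, ← map_mul]; rfl

theorem lamFree_zero : lamFree (of 0) = !![1, 2; 0, 1] := by
  have h0 : kf (of 0 : FreeGroup (Fin 2)) = A 0 := kf_str (m := 1) (i := 0) (by omega)
  have h2 : (A 0 : BG 2) = S 0 * A (0 + 1) * (S 0)⁻¹ := A_of_lt (by omega)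
  have h3 : (A 1 : BG 2) = S 1 ^ 2 := A_last
  have hb : (S 0 * S 1 * S 0 : BG 2) = S 1 * S 0 * S 1 := braid (m := 2) (i := 0) (by omega)
  have hb' : (S 1 * S 0 * S 1 * (S 1 * S 0)⁻¹ : BG 2) = S 0 := by rw [← hb]; group
  have : (S 1 * A 0 * (S 1)⁻¹ : BG 2) = S 0 * S 0 := by
    calc _ = S 1 * S 0 * S 1 * (S 1 * S 0)⁻¹ * (S 1 * S 0 * S 1 * (S 1 * S 0)⁻¹) := by
          rw [h2, zero_add, h3, pow_two]; group
      _ = _ := by rw [hb']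
  rw [lamFree_apply, ← map_mul, ← map_mul, h0, this, map_mul, lamUp_S_zero]
  decide

theorem lamFree_one : lamFree (of 1) = !![1, 0; -2, 1] := by
  have h1 : kf (of 1 : FreeGroup (Fin 2)) = A 1 := kf_str (m := 1) (i := 1) (by omega)
  have h3 : (A 1 : BG 2) = S 1 ^ 2 := A_last
  have : (S 1 * A 1 * (S 1)⁻¹ : BG 2) = S 1 * S 1 := by
    rw [h3, pow_two, ← mul_assoc, mul_inv_cancel_right]
  rw [lamFree_apply, ← map_mul, ← map_mul, h1, this, map_mul, lamUp_S_one]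
  decide

theorem eq_zpow_of_lamUp {h : BG 2} (hh : lamUp h = 1) : ∃ k : ℤ, h = ((S 0 * S 1) ^ 3) ^ (2 * k) := by
  obtain ⟨f, k, rfl⟩ : ∃ f k, h = kf f * ((S 0 * S 1) ^ 3) ^ (k : ℤ) := by
    obtain ⟨f, b, rfl, hb, -⟩ := (isPure_of_lamUp hh).exists_kf_mul_up
    obtain ⟨n, rfl⟩ := exists_zpow_of_isPure hb
    refine ⟨f * ((of 0)⁻¹ * (of 1)⁻¹) ^ n, n, ?_⟩
    have hc : Commute (kf ((of 0)⁻¹ * (of 1)⁻¹) : BG 2) ((S 0 * S 1) ^ 3) :=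
      Subgroup.mem_center_iff.1 full_twist_mem_center _
    rw [map_zpow, map_pow, up_S (by omega), S_zero_sq_eq, hc.mul_zpow, map_mul kf f, map_zpow kf, mul_assoc]
  obtain ⟨l, rfl | rfl⟩ := k.even_or_odd'
  · refine ⟨l, ?_⟩
    rw [map_mul, lamUp_full_twist_sq_zpow, mul_one] at hh
    have hf : lamFree f = 1 := by
      rw [lamFree_apply, hh, mul_one, ← map_mul, mul_inv_cancel, map_one]
    rw [eq_one_of_sanov lamFree_zero lamFree_one hf, map_one, one_mul]
  · exfalso
    rw [zpow_add, zpow_one, map_mul, map_mul, lamUp_full_twist_sq_zpow, one_mul, lamUp_full_twist,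
      mul_neg, mul_one, neg_eq_iff_eq_neg] at hh
    refine eq_one_of_sanov_neg lamFree_zero lamFree_one (f := f) ?_
    rw [lamFree_apply, hh, mul_neg, mul_one, neg_mul, ← map_mul, mul_inv_cancel, map_one]

instance range_iota_normal : iota.range.Normal where
  conj_mem := by
    rintro _ ⟨w, rfl⟩ g
    exact ⟨theta g w, iota_theta g w⟩

theorem mem_range_sup_iff {H : Subgroup G4} (g : G4) : g ∈ iota.range ⊔ H ↔
    ∃ w, ∃ h ∈ H, iota w * h = g := by
  rw [Subgroup.mem_sup_of_normal_left]
  exact ⟨fun ⟨_, ⟨w, rfl⟩, h, hh, e⟩ => ⟨w, h, hh, e⟩, fun ⟨w, h, hh, e⟩ => ⟨_, ⟨w, rfl⟩, h, hh, e⟩⟩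

theorem exists_iota_mul_up (g : G4) : ∃ w, ∃ h : BG 2, iota w * qk (up h) = g := by
  have : g ∈ iota.range ⊔ (qk.comp (up (m := 2))).range := by
    have h0 : s 0 ∈ iota.range ⊔ (qk.comp (up (m := 2))).range := by
      refine Subgroup.mem_sup_right ⟨S 0, ?_⟩
      rw [MonoidHom.comp_apply, up_S (by omega)]; rfl
    have h1 : s 1 ∈ iota.range ⊔ (qk.comp (up (m := 2))).range := by
      refine Subgroup.mem_sup_right ⟨S 1, ?_⟩
      rw [MonoidHom.comp_apply, up_S (by omega)]; rfl
    refine induction (p := (· ∈ iota.range ⊔ (qk.comp (up (m := 2))).range)) (one_mem _) ?_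
      (fun _ _ => mul_mem) (fun _ => inv_mem) g
    intro i hi
    obtain rfl | rfl | rfl : i = 0 ∨ i = 1 ∨ i = 2 := by omega
    · exact h0
    · exact h1
    · have := mul_mem (Subgroup.mem_sup_left (T := (qk.comp (up (m := 2))).range)
        (⟨of 0, rfl⟩ : iota (of 0) ∈ iota.range)) h0
      rwa [iota_zero, inv_mul_cancel_right] at this
  obtain ⟨w, _, ⟨h, rfl⟩, e⟩ := (mem_range_sup_iff g).1 this
  exact ⟨w, h, e⟩

theorem qk_up_full_twist : qk (up ((S 0 * S 1) ^ 3)) ^ 2 ∈ iota.range := by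
  have h1 : qk (up (S 0 * S 1 : BG 2)) = s 0 * s 1 := by
    rw [map_mul, map_mul, up_S (by omega), up_S (by omega)]; rfl
  rw [map_pow, map_pow, h1]
  refine (QuotientGroup.eq_one_iff (N := iota.range) _).1 ?_
  have h2 : ((s 2 : G4) : G4 ⧸ iota.range) = (s 0 : G4) := by
    rw [QuotientGroup.eq]
    have : (s 2)⁻¹ * s 0 = (s 0)⁻¹ * (iota (of 0))⁻¹ * ((s 0)⁻¹)⁻¹ := by rw [iota_zero]; group
    rw [this]
    exact range_iota_normal.conj_mem _ (inv_mem ⟨_, rfl⟩) _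
  have h3 := congrArg (QuotientGroup.mk (s := iota.range)) s_prod_pow
  have h4 := congrArg (QuotientGroup.mk (s := iota.range)) (s_braid (i := 0) (by omega))
  simp only [zero_add, QuotientGroup.mk_mul, QuotientGroup.mk_pow, h2, QuotientGroup.mk_one] at h3 h4 ⊢
  generalize ((s 0 : G4) : G4 ⧸ iota.range) = a at *
  generalize ((s 1 : G4) : G4 ⧸ iota.range) = b at *
  have h5 : (a * b) ^ 3 = (a * b * a) ^ 2 := by
    calc (a * b) ^ 3 = a * b * a * (b * a * b) := by simp only [pow_succ, pow_zero, one_mul, mul_assoc]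
      _ = _ := by rw [← h4, pow_two]
  rw [h5, ← pow_mul]
  exact h3

theorem exists_iota_of_lam {g : G4} (hg : lam g = 1) : ∃ w, iota w = g := by
  obtain ⟨w, h, rfl⟩ := exists_iota_mul_up g
  rw [map_mul, lam_iota, one_mul] at hg
  obtain ⟨k, rfl⟩ := eq_zpow_of_lamUp hg
  have : qk (up (((S 0 * S 1 : BG 2) ^ 3) ^ (2 * k))) ∈ iota.range := by
    rw [zpow_mul, map_zpow, map_zpow]
    refine zpow_mem ?_ _
    exact qk_up_full_twist
  exact iota.range.mul_mem ⟨w, rfl⟩ this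

end G4

end

section

open FreeGroup (of)
open FG (ex)

/-- A periodic solution of a hyperbolic linear recurrence vanishes. -/
theorem eq_zero_of_recurrence {f : ℕ → ℤ} {T : ℤ} (hT : 3 ≤ T)
    (hf : ∀ n, f (n + 2) = T * f (n + 1) - f n) {k : ℕ} (hk : 0 < k) (hp : ∀ n, f (n + k) = f n)
    (n : ℕ) : f n = 0 := by
  have hp' : Function.Periodic f k := hp
  obtain ⟨a, -, ha⟩ := Finset.exists_max_image (Finset.range k) (fun n => |f n|) ⟨0, by simpa⟩
  have hmax : ∀ n, |f n| ≤ |f a| := fun n => by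
    rw [← hp'.map_mod_nat n]
    exact ha _ (Finset.mem_range.2 (Nat.mod_lt _ hk))
  have h1 : f (a + k + 1) = T * f a - f (a + k - 1) := by
    have := hf (a + k - 1)
    rw [show a + k - 1 + 2 = a + k + 1 by omega, show a + k - 1 + 1 = a + k by omega, hp] at this
    exact this
  have h2 := hmax (a + k + 1)
  have h3 := hmax (a + k - 1)
  have h4 : f a = 0 := by
    by_contra h
    have h5 : T * |f a| ≤ 2 * |f a| := by
      calc T * |f a| = |T * f a| := by rw [abs_mul, abs_of_nonneg (by omega : 0 ≤ T)]
        _ = |f (a + k + 1) + f (a + k - 1)| := by rw [h1]; ring_nf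
        _ ≤ |f (a + k + 1)| + |f (a + k - 1)| := abs_add_le _ _
        _ ≤ _ := by linarith
    have := abs_pos.2 h
    nlinarith
  have := hmax n
  rw [h4, abs_zero] at this
  exact abs_nonpos_iff.1 this

/-- A hyperbolic integral affine transformation of the plane has at most one periodic point. -/
theorem eq_of_mem_periodicPts {s : ℤ × ℤ → ℤ × ℤ} {M : Matrix (Fin 2) (Fin 2) ℤ} (hd : M.det = 1)
    (ht : 3 ≤ M.trace)
    (hs : ∀ u v, (s u).1 - (s v).1 = M 0 0 * (u.1 - v.1) + M 0 1 * (u.2 - v.2) ∧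
      (s u).2 - (s v).2 = M 1 0 * (u.1 - v.1) + M 1 1 * (u.2 - v.2)) {x y : ℤ × ℤ}
    (hx : x ∈ Function.periodicPts s) (hy : y ∈ Function.periodicPts s) : x = y := by
  obtain ⟨k, hk, hkx⟩ := hx
  obtain ⟨l, hl, hly⟩ := hy
  have hkl : 0 < k * l := Nat.mul_pos hk hl
  rw [Matrix.det_fin_two] at hd
  rw [Matrix.trace_fin_two] at ht
  have hper : ∀ n, s^[n + k * l] x = s^[n] x ∧ s^[n + k * l] y = s^[n] y := fun n => by
    rw [Function.iterate_add_apply, Function.iterate_add_apply, (hkx.mul_const l).eq,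
      (hly.const_mul k).eq]
    exact ⟨rfl, rfl⟩
  have hrec : ∀ n, _ := fun n => hs (s^[n] x) (s^[n] y)
  have hrec' : ∀ n, _ := fun n => hs (s^[n + 1] x) (s^[n + 1] y)
  simp only [← Function.iterate_succ_apply' s] at hrec hrec'
  have e1 := eq_zero_of_recurrence (f := fun n => (s^[n] x).1 - (s^[n] y).1) ht (fun n => by
    linear_combination (hrec' n).1 - M 1 1 * (hrec n).1 + M 0 1 * (hrec n).2 -
      ((s^[n] x).1 - (s^[n] y).1) * hd) hkl (fun n => by rw [(hper n).1, (hper n).2]) 0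
  have e2 := eq_zero_of_recurrence (f := fun n => (s^[n] x).2 - (s^[n] y).2) ht (fun n => by
    linear_combination (hrec' n).2 - M 0 0 * (hrec n).2 + M 1 0 * (hrec n).1 -
      ((s^[n] x).2 - (s^[n] y).2) * hd) hkl (fun n => by rw [(hper n).1, (hper n).2]) 0
  exact Prod.ext (sub_eq_zero.1 e1) (sub_eq_zero.1 e2)

theorem pow_eq_one_of_braid {H : Type*} [Group H] {a b c : H} (h1 : a * b * a = b * a * b)
    (h2 : b * c * b = c * b * c) (h3 : a * c = c * a) (h : (a * b * c) ^ 4 = 1)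
    (hab : a * b = b * a) : a ^ 12 = 1 := by
  have e1 : a = b := by
    rw [hab, mul_assoc, mul_assoc] at h1
    exact mul_left_cancel (mul_left_cancel h1)
  subst e1
  have e2 : c = a := by
    rw [h3, mul_assoc c a c, h3, mul_assoc] at h2
    simpa using h2.symm
  subst e2
  rw [← pow_two, ← pow_succ, ← pow_mul] at h
  exact h

theorem trace_eq_one_of_braid {A B : Matrix (Fin 2) (Fin 2) ℤ} (ha : A.det = 1) (hb : B.det = 1)
    (hab : A * B * A = B * A * B) (ht : A.trace = B.trace) (hne : A ≠ B) : (A * B).trace = 1 := by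
  have key : ((A * B).trace - 1) • (A - B) = A * B * A - B * A * B := by
    rw [Matrix.det_fin_two] at ha hb
    rw [Matrix.trace_fin_two, Matrix.trace_fin_two] at ht
    ext i j
    fin_cases i <;> fin_cases j <;>
      simp only [Matrix.trace_fin_two, Matrix.mul_apply, Fin.sum_univ_two, Matrix.smul_apply,
        Matrix.sub_apply, smul_eq_mul, Fin.zero_eta, Fin.mk_one] <;> grind
  rw [hab, sub_self, smul_eq_zero] at key
  rcases key with h | h
  · omega
  · exact absurd (sub_eq_zero.1 h) hne

theorem eq_of_commute_of_trace {A B C : Matrix (Fin 2) (Fin 2) ℤ} (hAC : A * C = C * A)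
    (ht : A.trace = B.trace) (ht' : C.trace = B.trace) (h : (A * B).trace = 1)
    (h' : (C * B).trace = 1) : A = C := by
  have e00 := congrFun (congrFun hAC 0) 0
  have e01 := congrFun (congrFun hAC 0) 1
  have e10 := congrFun (congrFun hAC 1) 0
  simp only [Matrix.trace_fin_two, Matrix.mul_apply, Fin.sum_univ_two] at *
  have hT : 2 - (B 0 0 + B 1 1) ^ 2 ≠ 0 := fun h0 => by
    have h1 : (B 0 0 + B 1 1) ^ 2 = 2 := by omega
    have h2 : |B 0 0 + B 1 1| < 2 := abs_lt_of_sq_lt_sq (by rw [h1]; norm_num) (by norm_num)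
    obtain ⟨h3, h4⟩ := abs_lt.1 h2
    generalize B 0 0 + B 1 1 = t at *
    interval_cases t <;> omega
  have k1 : A 0 1 = C 0 1 := mul_left_cancel₀ hT (by grind)
  have k2 : A 1 0 = C 1 0 := mul_left_cancel₀ hT (by grind)
  have k3 : A 0 0 - A 1 1 = C 0 0 - C 1 1 := mul_left_cancel₀ hT (by grind)
  ext i j
  fin_cases i <;> fin_cases j <;> simp only [Fin.zero_eta, Fin.mk_one] <;> omega

namespace G4
open BG F2

theorem eq_zero_of_zpow_eq {a b : ℤ} (h : s 0 ^ a = s 2 ^ b) : a = 0 ∧ b = 0 := by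
  have h1 : qk ((S 0 ^ 2) ^ a) = qk ((S 2 ^ 2 : BG 3) ^ b) := by
    have h2 : qk (S 0) ^ a = qk (S 2 : BG 3) ^ b := h
    rw [map_zpow, map_zpow, map_pow, map_pow, ← zpow_natCast, ← zpow_natCast, ← zpow_mul, ← zpow_mul,
      mul_comm, mul_comm _ b, zpow_mul, zpow_mul, h2]
  obtain ⟨c, hc⟩ := chi_congr (by omega) h1
  have e1 := hc 0 1 (by decide)
  have e2 := hc 0 2 (by decide)
  have e3 := hc 2 3 (by decide)
  rw [chi_zpow_pure (isPure_S_sq _), chi_zpow_pure (isPure_S_sq _), chi_S_sq (by omega),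
    chi_S_sq (by omega)] at e1 e2 e3
  have f0 : (str 0 : Fin 4) = 0 := rfl
  have f1 : (str (0 + 1) : Fin 4) = 1 := rfl
  have f2 : (str 2 : Fin 4) = 2 := rfl
  have f3 : (str (2 + 1) : Fin 4) = 3 := rfl
  rw [f0, f1, f2, f3] at e1 e2 e3
  simp [crossing] at e1 e2 e3
  omega

theorem commute_iota {u v : F2} (h : Commute (iota u) (iota v)) : Commute u v :=
  iota_injective (by rw [map_mul, map_mul]; exact h)

theorem lam_conj_eq_one {g : G4} (hg : lam g = 1) (d : G4) : lam (d * g * d⁻¹) = 1 := by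
  rw [map_mul, map_mul, hg, mul_one, lam_mul_lam_inv]

variable {ρ : G4 →* G4}

theorem lam_zpow_ne_one (hρ : Function.Injective ρ) {k : ℤ} (hk : k ≠ 0) :
    lam (ρ (s 0 ^ k)) ≠ 1 := by
  intro h0
  have h2 : lam (ρ (s 2 ^ k)) = 1 := by
    obtain ⟨d, hd⟩ := s_conj (i := 2) (by omega)
    rw [← hd, conj_zpow, map_mul ρ, map_mul ρ, map_inv ρ]
    exact lam_conj_eq_one h0 _
  obtain ⟨u, hu⟩ := exists_iota_of_lam h0
  obtain ⟨v, hv⟩ := exists_iota_of_lam h2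
  have hc : Commute (s 0 ^ k) (s 2 ^ k) :=
    (show Commute (s 0) (s 2) from s_comm).zpow_zpow k k
  obtain ⟨z, a, b, rfl, rfl⟩ := FG.exists_zpow_of_commute (commute_iota (u := u) (v := v) (by
    rw [hu, hv]; exact hc.map ρ))
  have h3 : s 0 ^ (k * b) = s 2 ^ (k * a) := by
    apply hρ
    rw [zpow_mul, zpow_mul, map_zpow, ← hu, map_zpow ρ, ← hv, ← map_zpow, ← map_zpow, ← zpow_mul,
      ← zpow_mul, mul_comm]
  obtain ⟨-, h4⟩ := eq_zero_of_zpow_eq h3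
  have ha : a = 0 := by simpa [hk] using h4
  rw [ha, zpow_zero, map_one, ← map_one ρ] at hu
  have := eq_zero_of_zpow_eq (a := k) (b := 0) (by rw [zpow_zero]; exact (hρ hu).symm)
  exact hk this.1

theorem mul_self_eq_trace {M : Matrix (Fin 2) (Fin 2) ℤ} (h : M.det = 1) :
    M * M = M.trace • M - 1 := by
  rw [Matrix.det_fin_two] at h
  ext i j
  fin_cases i <;> fin_cases j <;>
    simp only [Matrix.trace_fin_two, Matrix.mul_apply, Fin.sum_univ_two, Matrix.smul_apply,
      Matrix.sub_apply, smul_eq_mul, Matrix.one_apply, Fin.zero_eta, Fin.mk_one] <;> grind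

theorem pow_twelve_eq_one {M : Matrix (Fin 2) (Fin 2) ℤ} (h : M.det = 1) (ht : |M.trace| ≤ 1) :
    M ^ 12 = 1 := by
  have h1 := mul_self_eq_trace h
  obtain ⟨h2, h3⟩ := abs_le.1 ht
  generalize M.trace = t at *
  interval_cases t
  · have h4 : M ^ 3 = 1 := by
      rw [pow_succ, pow_two, h1, sub_mul, one_mul, smul_mul_assoc, h1]; simp
    rw [show 12 = 3 * 4 from rfl, pow_mul, h4, one_pow]
  · have h4 : M ^ 2 = -1 := by rw [pow_two, h1]; simp
    rw [show 12 = 2 * 6 from rfl, pow_mul, h4, Even.neg_one_pow (by decide)]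
  · have h4 : M ^ 3 = -1 := by
      rw [pow_succ, pow_two, h1, sub_mul, one_mul, smul_mul_assoc, h1]; simp
    rw [show 12 = 3 * 4 from rfl, pow_mul, h4, Even.neg_one_pow (by decide)]

theorem lam_inv (g : G4) : lam g⁻¹ = (lam g).trace • 1 - lam g := by
  have h1 : ((lam g).trace • 1 - lam g) * lam g = 1 := by
    rw [sub_mul, mul_self_eq_trace (lam_det g), smul_mul_assoc, one_mul, sub_sub_cancel]
  calc lam g⁻¹ = ((lam g).trace • 1 - lam g) * lam g * lam g⁻¹ := by rw [h1, one_mul]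
    _ = _ := by rw [mul_assoc, lam_mul_lam_inv, mul_one]

theorem trace_lam_conj (d g : G4) : (lam (d * g * d⁻¹)).trace = (lam g).trace := by
  rw [map_mul, map_mul, Matrix.trace_mul_comm, ← mul_assoc, lam_inv_mul_lam, one_mul]

theorem trace_lam_s {i : ℕ} (hi : i < 3) : (lam (ρ (s i))).trace = (lam (ρ (s 0))).trace := by
  obtain ⟨d, hd⟩ := s_conj hi
  rw [← hd, map_mul ρ, map_mul ρ, map_inv ρ, trace_lam_conj]

theorem lam_s_zero_ne_lam_s_one (hρ : Function.Injective ρ)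
    (hc : lam (ρ (s 0)) * lam (ρ (s 1)) = lam (ρ (s 1)) * lam (ρ (s 0))) : False := by
  have h := pow_eq_one_of_braid (a := lam.toHomUnits (ρ (s 0))) (b := lam.toHomUnits (ρ (s 1)))
    (c := lam.toHomUnits (ρ (s 2))) (by simp only [← map_mul, s_braid (i := 0) (by omega)])
    (by simp only [← map_mul, s_braid (i := 1) (by omega)]) (by simp only [← map_mul, s_comm])
    (by simp only [← map_mul, ← map_pow, s_prod_pow, map_one]) (Units.ext hc)
  refine lam_zpow_ne_one hρ (k := 12) (by norm_num) ?_
  rw [← map_pow, ← map_pow] at h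
  exact congrArg Units.val h

theorem lam_restrict (hρ : Function.Injective ρ) : lam (ρ (s 2)) = lam (ρ (s 0)) ∧
    3 ≤ (lam (ρ (s 0 * (s 1)⁻¹))).trace := by
  have hb1 : lam (ρ (s 0)) * lam (ρ (s 1)) * lam (ρ (s 0))
      = lam (ρ (s 1)) * lam (ρ (s 0)) * lam (ρ (s 1)) := by
    simp only [← map_mul, s_braid (i := 0) (by omega)]
  have hb2 : lam (ρ (s 2)) * lam (ρ (s 1)) * lam (ρ (s 2))
      = lam (ρ (s 1)) * lam (ρ (s 2)) * lam (ρ (s 1)) := by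
    simp only [← map_mul, s_braid (i := 1) (by omega)]
  have hcomm : lam (ρ (s 0)) * lam (ρ (s 2)) = lam (ρ (s 2)) * lam (ρ (s 0)) := by
    simp only [← map_mul, s_comm]
  have hx := trace_eq_one_of_braid (lam_det _) (lam_det _) hb1 (trace_lam_s (by omega)).symm
    (fun h => lam_s_zero_ne_lam_s_one hρ (by rw [h]))
  have hx' := trace_eq_one_of_braid (lam_det _) (lam_det _) hb2
    ((trace_lam_s (by omega)).trans (trace_lam_s (by omega)).symm)
    (fun h => lam_s_zero_ne_lam_s_one hρ (by rw [← h, hcomm]))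
  refine ⟨(eq_of_commute_of_trace hcomm (trace_lam_s (by omega)).symm
    ((trace_lam_s (by omega)).trans (trace_lam_s (by omega)).symm) hx hx').symm, ?_⟩
  have ht : 1 < |(lam (ρ (s 0))).trace| := by
    by_contra h
    have h2 := pow_twelve_eq_one (lam_det _) (not_lt.1 h)
    refine lam_zpow_ne_one hρ (k := 12) (by norm_num) ?_
    rw [← map_pow, ← map_pow] at h2
    exact h2
  have h2 : (lam (ρ (s 0 * (s 1)⁻¹))).trace = (lam (ρ (s 0))).trace ^ 2 - 1 := by
    rw [map_mul ρ, map_mul lam, map_inv ρ, lam_inv, mul_sub, Matrix.trace_sub, hx,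
      trace_lam_s (by omega), mul_smul_comm, mul_one, Matrix.trace_smul, smul_eq_mul, pow_two]
  rw [h2]
  have := sq_abs (lam (ρ (s 0))).trace
  nlinarith

theorem exists_restrict (hρ : Function.Injective ρ) : ∃ r : F2 →* F2, ∀ x, iota (r x) = ρ (iota x) := by
  have h0 : lam (ρ (iota (of 0))) = 1 := by
    rw [iota_zero, map_mul ρ, map_inv ρ, map_mul lam, (lam_restrict hρ).1, lam_mul_lam_inv]
  have hall : ∀ i : Fin 2, ∃ w, iota w = ρ (iota (of i)) := by
    intro i
    apply exists_iota_of_lam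
    fin_cases i
    · exact h0
    · have h1 : (of 1 : F2) = (theta (s 1) (of 0))⁻¹ * of 0 := by
        rw [theta_s (by omega), tw_one_zero]; group
      change lam (ρ (iota (of 1))) = 1
      rw [h1, map_mul iota, map_inv iota, iota_theta, map_mul ρ, map_inv ρ, map_mul ρ, map_mul ρ,
        map_inv ρ, map_mul lam, h0, mul_one]
      have h2 := lam_conj_eq_one h0 (ρ (s 1))
      have h3 := lam_inv_mul_lam (ρ (s 1) * ρ (iota (of 0)) * (ρ (s 1))⁻¹)
      rwa [h2, mul_one] at h3
  choose f hf using hall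
  refine ⟨FreeGroup.lift f, fun x => ?_⟩
  have : iota.comp (FreeGroup.lift f) = ρ.comp iota := FreeGroup.ext_hom _ _ fun i => by simp [hf]
  exact DFunLike.congr_fun this x

end G4

end

section

open FreeGroup (of)
open FG (ex)

namespace F2

/-- The boundary commutator. -/
def bd : F2 := (of 0)⁻¹ * of 1 * of 0 * (of 1)⁻¹

/-- Coset representatives of the commutator subgroup. -/
def rep (v : ℤ × ℤ) : F2 := of 0 ^ v.1 * of 1 ^ v.2

/-- The free group on the conjugates of the boundary commutator. -/
abbrev Y : Type := FreeGroup (ℤ × ℤ)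

/-- The inclusion of the commutator subgroup. -/
def J : Y →* F2 := FreeGroup.lift fun v => (rep v)⁻¹ * bd * rep v

theorem J_of (v : ℤ × ℤ) : J (of v) = (rep v)⁻¹ * bd * rep v := by simp [J]

theorem ex_bd (j : Fin 2) : ex j bd = 0 := by
  rw [bd]; simp only [FG.ex_mul, FG.ex_inv]; ring

theorem ex_J (j : Fin 2) (u : Y) : ex j (J u) = 0 := by
  induction u using FreeGroup.induction_on with
  | C1 => simp
  | of v => rw [J_of]; simp only [FG.ex_mul, FG.ex_inv, ex_bd]; ring
  | inv_of v h => rw [map_inv, FG.ex_inv, h, neg_zero]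
  | mul u v hu hv => rw [map_mul, FG.ex_mul, hu, hv, add_zero]

theorem ex_rep_zero (v : ℤ × ℤ) : ex 0 (rep v) = v.1 := by simp [rep, FG.ex_mul]
theorem ex_rep_one (v : ℤ × ℤ) : ex 1 (rep v) = v.2 := by simp [rep, FG.ex_mul]

/-- One step of the recursion for the cocycle. -/
def step (j : ℤ) : Equiv.Perm (ℤ × Y) where
  toFun x := (x.1 + 1, of (x.1, j + 1) * x.2)
  invFun x := (x.1 - 1, (of (x.1 - 1, j + 1))⁻¹ * x.2)
  left_inv x := by simp
  right_inv x := by simp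

theorem step_zpow_fst (i j : ℤ) : ((step j ^ i) (0, 1)).1 = i := by
  induction i with
  | zero => rfl
  | succ i ih => rw [add_comm, zpow_add, zpow_one, Equiv.Perm.mul_apply, add_comm]; exact congrArg (· + 1) ih
  | pred i ih =>
    rw [sub_eq_add_neg, add_comm, zpow_add, zpow_neg_one, Equiv.Perm.mul_apply, add_comm]
    exact congrArg (· - 1) ih

/-- The cocycle of the coset representatives. -/
def coc (v : ℤ × ℤ) : Y := ((step v.2 ^ v.1) (0, 1)).2

theorem coc_zero (j : ℤ) : coc (0, j) = 1 := rfl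

theorem coc_add_one (i j : ℤ) : coc (i + 1, j) = of (i, j + 1) * coc (i, j) := by
  rw [coc, coc, add_comm, zpow_add, zpow_one, Equiv.Perm.mul_apply]
  change of (((step j ^ i) (0, 1)).1, j + 1) * _ = _
  rw [step_zpow_fst]

theorem rep_mul_J_coc (v : ℤ × ℤ) : rep (v.1, v.2 + 1) * J (coc v) = of 1 * rep v := by
  obtain ⟨i, j⟩ := v
  have hs : ∀ i, rep (i, j + 1) * J (coc (i, j)) = of 1 * rep (i, j) ↔
      rep (i + 1, j + 1) * J (coc (i + 1, j)) = of 1 * rep (i + 1, j) := by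
    intro i
    rw [coc_add_one, map_mul, J_of]
    have h1 : rep (i + 1, j + 1) * ((rep (i, j + 1))⁻¹ * bd * rep (i, j + 1) * J (coc (i, j))) =
      of 0 * bd * (rep (i, j + 1) * J (coc (i, j))) := by
      rw [show rep (i + 1, j + 1) = of 0 * rep (i, j + 1) by
        simp only [rep]; rw [add_comm i, zpow_one_add, mul_assoc]]
      group
    rw [h1]
    have h2 : of 1 * rep (i + 1, j) = of 0 * bd * (of 1 * rep (i, j)) := by
      simp only [rep, bd]; group
    rw [h2, mul_right_inj]
  induction i with
  | zero => rw [coc_zero, map_one]; simp only [rep]; group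
  | succ i ih => exact (hs _).1 ih
  | pred i ih => exact (hs _).2 (by rw [sub_add_cancel]; exact ih)

/-- The two generators of the action on pairs. -/
def actGen : Fin 2 → Equiv.Perm ((ℤ × ℤ) × Y) :=
  ![{ toFun := fun x => ((x.1.1 + 1, x.1.2), x.2)
      invFun := fun x => ((x.1.1 - 1, x.1.2), x.2)
      left_inv := fun x => by simp
      right_inv := fun x => by simp },
    { toFun := fun x => ((x.1.1, x.1.2 + 1), coc x.1 * x.2)
      invFun := fun x => ((x.1.1, x.1.2 - 1), (coc (x.1.1, x.1.2 - 1))⁻¹ * x.2)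
      left_inv := fun x => by simp
      right_inv := fun x => by simp }]

theorem actGen_zero (v : ℤ × ℤ) (n : Y) : actGen 0 (v, n) = ((v.1 + 1, v.2), n) := rfl
theorem actGen_one (v : ℤ × ℤ) (n : Y) : actGen 1 (v, n) = ((v.1, v.2 + 1), coc v * n) := rfl

/-- The regular action in coordinates. -/
def act : F2 →* Equiv.Perm ((ℤ × ℤ) × Y) := FreeGroup.lift actGen

theorem act_of (i : Fin 2) : act (of i) = actGen i := by simp [act]

theorem rep_mul_J_act (x : F2) : ∀ v n, rep (act x (v, n)).1 * J (act x (v, n)).2 =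
    x * (rep v * J n) := by
  have hg : ∀ i v n, rep (actGen i (v, n)).1 * J (actGen i (v, n)).2 = of i * (rep v * J n) := by
    intro i v n
    fin_cases i
    · change rep (v.1 + 1, v.2) * J n = of 0 * (rep v * J n)
      simp only [rep]; rw [add_comm, zpow_one_add]; group
    · change rep (v.1, v.2 + 1) * J (coc v * n) = of 1 * (rep v * J n)
      rw [map_mul, ← mul_assoc, rep_mul_J_coc, mul_assoc]
  induction x using FreeGroup.induction_on with
  | C1 => simp
  | of i => intro v n; rw [act_of, hg]
  | inv_of i _ =>
    intro v n
    have := hg i (act (of i)⁻¹ (v, n)).1 (act (of i)⁻¹ (v, n)).2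
    rw [map_inv, act_of, Prod.mk.eta, Equiv.Perm.inv_def, Equiv.apply_symm_apply] at this
    rw [this, map_inv, act_of, Equiv.Perm.inv_def, inv_mul_cancel_left]
  | mul a b ha hb =>
    intro v n
    rw [map_mul, Equiv.Perm.mul_apply, ← Prod.mk.eta (p := act b (v, n)), ha, hb, mul_assoc]

theorem exists_rep_mul_J (x : F2) : ∃ n, x = rep (ex 0 x, ex 1 x) * J n := by
  have h := rep_mul_J_act x 0 1
  have h0 := congrArg (ex 0) h
  have h1 := congrArg (ex 1) h
  have hr : rep 0 = 1 := by simp [rep]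
  rw [map_one, mul_one, hr, mul_one] at h
  rw [h] at h0 h1
  rw [← h, FG.ex_mul, ex_J, ex_rep_zero, add_zero, map_one, hr, mul_one, mul_one, h] at h0
  rw [← h, FG.ex_mul, ex_J, ex_rep_one, add_zero, map_one, hr, mul_one, mul_one, h] at h1
  refine ⟨(act x (0, 1)).2, ?_⟩
  rw [← h0, ← h1]
  exact h.symm

theorem exists_J {x : F2} (h0 : ex 0 x = 0) (h1 : ex 1 x = 0) : ∃ n, J n = x := by
  obtain ⟨n, hn⟩ := exists_rep_mul_J x
  rw [h0, h1] at hn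
  exact ⟨n, by rw [hn]; simp [rep]⟩

theorem act_zero_zpow (i : ℤ) (v : ℤ × ℤ) (n : Y) :
    act (of 0 ^ i) (v, n) = ((v.1 + i, v.2), n) := by
  induction i generalizing v with
  | zero => simp
  | succ i ih =>
    rw [zpow_add, zpow_one, map_mul, Equiv.Perm.mul_apply, act_of, actGen_zero, ih]
    ext <;> simp; ring
  | pred i ih =>
    have := ih (v.1 - 1, v.2)
    rw [zpow_sub, zpow_one, map_mul, Equiv.Perm.mul_apply, map_inv, act_of]
    change act _ ((v.1 - 1, v.2), n) = _
    rw [ih]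
    ext <;> simp; ring

theorem act_one_zpow (j k : ℤ) (n : Y) : act (of 1 ^ j) ((0, k), n) = ((0, k + j), n) := by
  induction j generalizing k with
  | zero => simp
  | succ i ih =>
    rw [zpow_add, zpow_one, map_mul, Equiv.Perm.mul_apply, act_of, actGen_one, coc_zero, one_mul, ih]
    ext <;> simp; ring
  | pred i ih =>
    have := ih (k - 1)
    rw [zpow_sub, zpow_one, map_mul, Equiv.Perm.mul_apply, map_inv, act_of]
    change act _ ((0, k - 1), (coc (0, k - 1))⁻¹ * n) = _
    rw [coc_zero, inv_one, one_mul, ih]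
    ext <;> simp; ring

theorem act_rep (v : ℤ × ℤ) (n : Y) : act (rep v) (0, n) = (v, n) := by
  rw [rep, map_mul, Equiv.Perm.mul_apply]
  change act _ (act _ ((0, 0), n)) = _
  rw [act_one_zpow, act_zero_zpow, zero_add, zero_add]

theorem act_bd (v : ℤ × ℤ) (n : Y) : act bd (v, n) = (v, of v * n) := by
  obtain ⟨i, j⟩ := v
  rw [bd, map_mul, map_mul, map_mul, map_inv, map_inv, act_of, act_of]
  change ((i + 1 - 1, j - 1 + 1), coc (i + 1, j - 1) * ((coc (i, j - 1))⁻¹ * n)) = _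
  rw [coc_add_one, sub_add_cancel, add_sub_cancel_right]
  congr 1; group

theorem act_J (u : Y) : ∀ n, act (J u) (0, n) = (0, u * n) := by
  induction u using FreeGroup.induction_on with
  | C1 => simp
  | of v =>
    intro n
    rw [J_of, map_mul, map_mul, Equiv.Perm.mul_apply, Equiv.Perm.mul_apply, act_rep, act_bd, map_inv,
      Equiv.Perm.inv_eq_iff_eq, act_rep]
  | inv_of v h =>
    intro n
    rw [map_inv, map_inv, Equiv.Perm.inv_eq_iff_eq, h, mul_inv_cancel_left]
  | mul u w hu hw => intro n; rw [map_mul, map_mul, Equiv.Perm.mul_apply, hw, hu, mul_assoc]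

theorem J_injective : Function.Injective J := fun u u' h => by
  have h1 := act_J u 1
  rw [h, act_J, mul_one, mul_one] at h1
  exact (Prod.ext_iff.1 h1).2.symm

end F2

end

section

open FreeGroup (of)
open FG (ex)

theorem FG.Compat.ex_apply {α : Type*} [DecidableEq α] {a : MulAut (FreeGroup α)}
    {s : Equiv.Perm α} (h : FG.Compat a s) (j : α) (w : FreeGroup α) : ex (s j) (a w) = ex j w := by
  induction w using FreeGroup.induction_on with
  | C1 => simp
  | of i =>
    obtain ⟨c, hc⟩ := h i
    rw [hc]
    simp only [ex_mul, ex_inv, ex_of, s.injective.eq_iff]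
    ring
  | inv_of i h => rw [map_inv, ex_inv, h, ex_inv]
  | mul u v hu hv => rw [map_mul, ex_mul, hu, hv, ex_mul]

namespace F2

theorem bd_eq_J : bd = J (of 0) := by rw [J_of]; simp [rep]

theorem bd_ne_one : bd ≠ 1 := fun h => by
  rw [bd_eq_J, ← map_one J] at h
  exact FreeGroup.of_ne_one _ (J_injective h)

theorem exists_lift_hom (f : MulAut F2) : ∃ g : Y →* Y, ∀ u, J (g u) = f (J u) := by
  have : ∀ v, ∃ n, J n = f (J (of v)) := fun v =>
    exists_J (by simp [ex_mat, ex_J]) (by simp [ex_mat, ex_J])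
  choose n hn using this
  refine ⟨FreeGroup.lift n, fun u => ?_⟩
  have : J.comp (FreeGroup.lift n) = f.toMonoidHom.comp J :=
    FreeGroup.ext_hom _ _ fun i => by simp [hn]
  exact DFunLike.congr_fun this u

theorem exists_lift_aut (f : MulAut F2) : ∃ a : MulAut Y, ∀ u, J (a u) = f (J u) := by
  obtain ⟨g, hg⟩ := exists_lift_hom f
  obtain ⟨g', hg'⟩ := exists_lift_hom f⁻¹
  refine ⟨MonoidHom.toMulEquiv g g' ?_ ?_, hg⟩
  · ext1 i
    apply J_injective
    simp [hg, hg']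
  · ext1 i
    apply J_injective
    simp [hg, hg']

/-- An affine permutation of the plane. -/
def affine (M : Matrix (Fin 2) (Fin 2) ℤ) (hM : M.det = 1) (t : ℤ × ℤ) : Equiv.Perm (ℤ × ℤ) where
  toFun v := (M 0 0 * v.1 + M 0 1 * v.2 + t.1, M 1 0 * v.1 + M 1 1 * v.2 + t.2)
  invFun v := (M 1 1 * (v.1 - t.1) - M 0 1 * (v.2 - t.2), M 0 0 * (v.2 - t.2) - M 1 0 * (v.1 - t.1))
  left_inv v := by
    rw [Matrix.det_fin_two] at hM
    ext <;> dsimp only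
    · linear_combination v.1 * hM
    · linear_combination v.2 * hM
  right_inv v := by
    rw [Matrix.det_fin_two] at hM
    ext <;> dsimp only
    · linear_combination (v.1 - t.1) * hM
    · linear_combination (v.2 - t.2) * hM

theorem compat_affine {f : MulAut F2} (hf : (mat f).det = 1) {n : F2} (hn : f bd = n * bd * n⁻¹)
    {a : MulAut Y} (ha : ∀ u, J (a u) = f (J u)) :
    FG.Compat a (affine (mat f) hf (-ex 0 n, -ex 1 n)) := by
  intro v
  obtain ⟨c, hc⟩ := exists_rep_mul_J (n⁻¹ * f (rep v))
  have hv : (ex 0 (n⁻¹ * f (rep v)), ex 1 (n⁻¹ * f (rep v))) =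
      affine (mat f) hf (-ex 0 n, -ex 1 n) v := by
    simp only [FG.ex_mul, FG.ex_inv, ex_mat, ex_rep_zero, ex_rep_one]
    ext <;> simp only [affine, Equiv.coe_fn_mk] <;> ring
  rw [hv] at hc
  refine ⟨c⁻¹, J_injective ?_⟩
  rw [ha, J_of, map_mul, map_mul, map_inv, hn, map_mul, map_mul, map_inv, map_inv J, map_inv J, inv_inv, J_of]
  have h1 : f (rep v) = n * (rep (affine (mat f) hf (-ex 0 n, -ex 1 n) v) * J c) := by
    rw [← hc, mul_inv_cancel_left]
  rw [h1]
  group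

theorem exists_zpow_of_commute_bd {w : F2} (h : Commute w bd) : ∃ j : ℤ, w = bd ^ j := by
  obtain ⟨z, a, b, rfl, hb⟩ := FG.exists_zpow_of_commute h
  have hb0 : b ≠ 0 := by
    rintro rfl
    exact bd_ne_one (by rw [hb, zpow_zero])
  have hz : ∀ i, ex i z = 0 := fun i => by
    have := ex_bd i
    rw [hb, FG.ex_zpow] at this
    exact (mul_eq_zero.1 this).resolve_left hb0
  obtain ⟨u, rfl⟩ := exists_J (hz 0) (hz 1)
  rw [bd_eq_J, ← map_zpow] at hb
  have hu : Commute u (of 0) := by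
    rw [J_injective hb]; exact (Commute.refl u).zpow_right b
  obtain ⟨k, rfl⟩ := FG.exists_zpow_of_commute_of hu
  exact ⟨k * a, by rw [bd_eq_J, map_zpow, zpow_mul]⟩

end F2

namespace G4
open BG F2

theorem theta_s_zero_bd : theta (s 0) bd = bd := by
  rw [theta_s (by omega), bd]; simp; group

theorem theta_s_one_bd : theta (s 1) bd = of 1 * bd * (of 1)⁻¹ := by
  rw [theta_s (by omega), bd]; simp; group

theorem theta_s_two_bd : theta (s 2) bd = of 0 * bd * (of 0)⁻¹ := by
  rw [theta_s (by omega), bd]; simp; group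

theorem exists_theta_bd (g : G4) : ∃ n, theta g bd = n * bd * n⁻¹ := by
  refine induction (p := fun g => ∃ n, theta g bd = n * bd * n⁻¹) ⟨1, by simp⟩ ?_ ?_ ?_ g
  · intro i hi
    obtain rfl | rfl | rfl : i = 0 ∨ i = 1 ∨ i = 2 := by omega
    · exact ⟨1, by rw [theta_s_zero_bd]; group⟩
    · exact ⟨_, theta_s_one_bd⟩
    · exact ⟨_, theta_s_two_bd⟩
  · rintro a b ⟨u, hu⟩ ⟨v, hv⟩
    refine ⟨theta a v * u, ?_⟩
    rw [map_mul, MulAut.mul_apply, hv, map_mul, map_mul, map_inv, hu]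
    group
  · rintro a ⟨u, hu⟩
    refine ⟨(theta a⁻¹ u)⁻¹, ?_⟩
    have h := congrArg (theta a⁻¹) hu
    rw [← MulAut.mul_apply, ← map_mul, inv_mul_cancel, map_one, MulAut.one_apply, map_mul, map_mul,
      map_inv (theta a⁻¹)] at h
    nth_rw 2 [h]
    group

variable {ρ : G4 →* G4} {r : F2 →* F2}

theorem theta_restrict (hr : ∀ x, iota (r x) = ρ (iota x)) (g : G4) (x : F2) :
    theta (ρ g) (r x) = r (theta g x) := by
  apply iota_injective
  rw [iota_theta, hr, hr, iota_theta, map_mul, map_mul, map_inv]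

theorem restrict_injective (hρ : Function.Injective ρ) (hr : ∀ x, iota (r x) = ρ (iota x)) :
    Function.Injective r := fun x y h =>
  iota_injective (hρ (by rw [← hr, ← hr, h]))

theorem exists_restrict_bd (hρ : Function.Injective ρ) (hr : ∀ x, iota (r x) = ρ (iota x)) :
    ∃ (k : ℤ) (n : F2), k ≠ 0 ∧ r bd = n * bd ^ k * n⁻¹ := by
  have h1 : theta (s 0 * (s 1)⁻¹) (of 0 * bd * (of 0)⁻¹) = of 0 * bd * (of 0)⁻¹ := by
    have e0 : theta (s 0) (of 0 * bd * (of 0)⁻¹) = of 0 * bd * (of 0)⁻¹ := by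
      rw [map_mul, map_mul, theta_s_zero_bd, map_inv, theta_s (by omega), tw_zero_zero]
    have e1 : theta (s 1) (of 0 * bd * (of 0)⁻¹) = of 0 * bd * (of 0)⁻¹ := by
      rw [map_mul, map_mul, theta_s_one_bd, map_inv, theta_s (by omega), tw_one_zero]; group
    have e2 : theta (s 1)⁻¹ (of 0 * bd * (of 0)⁻¹) = of 0 * bd * (of 0)⁻¹ := by
      rw [map_inv]; exact (MulEquiv.symm_apply_eq _).2 e1.symm
    rw [map_mul theta, MulAut.mul_apply, e2, e0]
  have h2 := theta_restrict hr (s 0 * (s 1)⁻¹) (of 0 * bd * (of 0)⁻¹)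
  rw [h1] at h2
  obtain ⟨u, hu⟩ : ∃ u, J u = r (of 0 * bd * (of 0)⁻¹) :=
    exists_J (by rw [ex_abm]; simp [ex_bd]) (by rw [ex_abm]; simp [ex_bd])
  obtain ⟨a, ha⟩ := exists_lift_aut (theta (ρ (s 0 * (s 1)⁻¹)))
  obtain ⟨n, hn⟩ := exists_theta_bd (ρ (s 0 * (s 1)⁻¹))
  have hc := compat_affine (lam_det _) hn ha
  have hau : a u = u := J_injective (by rw [ha, hu, h2])
  have hne : u ≠ 1 := by
    rintro rfl
    rw [map_one, ← map_one r] at hu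
    have := restrict_injective hρ hr hu
    exact bd_ne_one (by simpa using this.symm)
  obtain h | ⟨v, c, k, -, rfl⟩ := FG.eq_conj_zpow_of_fixed u (fun i j hij => ⟨a, _, hc, hau, fun h =>
    hij (eq_of_mem_periodicPts (lam_det _) (lam_restrict hρ).2 (fun u v => by
      simp only [affine, Equiv.coe_fn_mk]
      constructor
      · change _ = mat _ 0 0 * _ + mat _ 0 1 * _; ring
      · change _ = mat _ 1 0 * _ + mat _ 1 1 * _; ring) h.1 h.2)⟩)
  · exact absurd h hne
  · refine ⟨k, (r (of 0))⁻¹ * J c * (rep v)⁻¹, ?_, ?_⟩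
    · rintro rfl
      exact hne (by simp)
    · rw [map_mul r, map_mul r, map_inv r, map_mul J, map_mul J, map_zpow, J_of] at hu
      have e : ((rep v)⁻¹ * bd * rep v) ^ k = (rep v)⁻¹ * bd ^ k * rep v := by
        have := conj_zpow (i := k) (a := (rep v)⁻¹) (b := bd)
        rwa [inv_inv] at this
      rw [e, map_inv] at hu
      calc r bd = (r (of 0))⁻¹ * (r (of 0) * r bd * (r (of 0))⁻¹) * r (of 0) := by group
        _ = _ := by rw [← hu]; group

end G4

end

section

open FreeGroup (of)
open FG (ex)

theorem FG.Heis.zpow_z {p : FG.Heis} (hx : p.x = 0) (hy : p.y = 0) (k : ℤ) : (p ^ k).z = k * p.z := by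
  have h : ∀ k : ℤ, p ^ k = ⟨0, 0, k * p.z⟩ := fun k => by
    induction k with
    | zero => ext <;> simp
    | succ n ih => rw [zpow_add_one, ih]; ext <;> simp [hx, hy]; ring
    | pred n ih => rw [zpow_sub_one, ih]; ext <;> simp [hx, hy]; ring
  rw [h]

namespace G4
open BG F2

theorem ex_theta_s_zero_zpow (k : ℤ) (x : F2) :
    ex 0 (theta (s 0 ^ k) x) = ex 0 x + k * ex 1 x ∧ ex 1 (theta (s 0 ^ k) x) = ex 1 x := by
  rw [ex_theta, ex_theta, lam_s_zero_zpow]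
  simp

theorem ex_theta_s_one (x : F2) :
    ex 0 (theta (s 1) x) = ex 0 x ∧ ex 1 (theta (s 1) x) = ex 1 x - ex 0 x := by
  rw [ex_theta, ex_theta, lam_s_one]
  simp
  ring

theorem ex_theta_s_one_inv (x : F2) :
    ex 0 (theta (s 1)⁻¹ x) = ex 0 x ∧ ex 1 (theta (s 1)⁻¹ x) = ex 1 x + ex 0 x := by
  have h := ex_theta_s_one (theta (s 1)⁻¹ x)
  rw [← MulAut.mul_apply, ← map_mul, mul_inv_cancel, map_one, MulAut.one_apply] at h
  omega

theorem exists_ex_one_eq_zero (x : F2) : ∃ g : G4, ex 1 (theta g x) = 0 := by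
  induction hN : (ex 0 x).natAbs + (ex 1 x).natAbs using Nat.strong_induction_on generalizing x with
  | _ N ih =>
  have reduce : ∀ g : G4, (ex 0 (theta g x)).natAbs + (ex 1 (theta g x)).natAbs < N →
      ∃ g : G4, ex 1 (theta g x) = 0 := fun g hg => by
    obtain ⟨g', h⟩ := ih _ hg _ rfl
    exact ⟨g' * g, by rwa [map_mul, MulAut.mul_apply]⟩
  have h0 := ex_theta_s_zero_zpow 1 x
  have h0' := ex_theta_s_zero_zpow (-1) x
  have h1 := ex_theta_s_one x
  have h1' := ex_theta_s_one_inv x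
  by_cases hb : ex 1 x = 0
  · exact ⟨1, by simpa using hb⟩
  by_cases ha : ex 0 x = 0
  · refine ⟨s 1 * s 0 ^ (1 : ℤ), ?_⟩
    rw [map_mul, MulAut.mul_apply, (ex_theta_s_one _).2]
    omega
  by_cases hab : (ex 1 x).natAbs ≤ (ex 0 x).natAbs
  · by_cases hs : (ex 0 x < 0) ↔ (ex 1 x < 0)
    · exact reduce (s 0 ^ (-1 : ℤ)) (by omega)
    · exact reduce (s 0 ^ (1 : ℤ)) (by omega)
  · by_cases hs : (ex 0 x < 0) ↔ (ex 1 x < 0)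
    · exact reduce (s 1) (by omega)
    · exact reduce (s 1)⁻¹ (by omega)

theorem theta_s_zero_zpow_fixed (m : ℤ) {x : F2} (h : theta (s 0) x = x) :
    theta (s 0 ^ m) x = x := by
  have : theta (s 0 ^ m) ∈ MulAction.stabilizer (MulAut F2) x := by
    rw [map_zpow]
    exact zpow_mem (show theta (s 0) ∈ MulAction.stabilizer (MulAut F2) x from h) m
  exact this

/-- An injective endomorphism normalized along the first generator and the boundary sends the half
twist to one of its powers. -/
theorem exists_eq_zpow_of_normalized {ρ : G4 →* G4} {r : F2 →* F2} (hρ : Function.Injective ρ)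
    (hr : ∀ x, iota (r x) = ρ (iota x)) {k : ℤ} (hk : k ≠ 0) (hb : r bd = bd ^ k)
    (h1 : ex 1 (r (of 0)) = 0) : ∃ m : ℤ, m ≠ 0 ∧ ρ (s 0) = s 0 ^ m := by
  set d := ex 0 (r (of 0)) with hd
  have hd0 : d ≠ 0 := by
    intro h0
    have hz := congrArg (fun w => (FG.heis 0 1 w).z) hb
    have hx := FG.heis_x 0 1 (r (of 0))
    have hy := FG.heis_y 0 1 (r (of 0))
    rw [← hd, h0] at hx
    rw [h1] at hy
    simp only [map_zpow] at hz
    rw [FG.Heis.zpow_z (by simp [ex_bd]) (by simp [ex_bd])] at hz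
    rw [bd, map_mul, map_mul, map_mul, map_inv, map_inv] at hz
    simp [hx, hy] at hz
    exact hk hz
  have hfix : theta (ρ (s 0)) (r (of 0)) = r (of 0) := by
    rw [theta_restrict hr, theta_s (by omega), tw_zero_zero]
  set A := lam (ρ (s 0)) with hA
  have hA0 : A 0 0 = 1 ∧ A 1 0 = 0 := by
    have e0 := congrArg (ex 0) hfix
    have e1 := congrArg (ex 1) hfix
    rw [ex_theta, h1, ← hd, ← hA] at e0 e1
    constructor
    · apply mul_right_cancel₀ hd0; linarith
    · apply mul_right_cancel₀ hd0; linarith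
  have hdet : A 1 1 = 1 := by
    have := lam_det (ρ (s 0))
    rw [Matrix.det_fin_two, ← hA, hA0.1, hA0.2] at this
    linarith
  have hAm : lam (ρ (s 0)) = lam (s 0 ^ A 0 1) := by
    rw [lam_s_zero_zpow, ← hA]
    ext i j
    fin_cases i <;> fin_cases j <;> simp [hA0, hdet]
  generalize A 0 1 = m at hAm
  refine ⟨m, ?_, ?_⟩
  · rintro rfl
    refine lam_zpow_ne_one hρ one_ne_zero ?_
    rw [zpow_one, hAm, zpow_zero, map_one]
  obtain ⟨w, hw⟩ := exists_iota_of_lam (g := ρ (s 0) * (s 0 ^ m)⁻¹) (by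
    rw [map_mul, hAm, lam_mul_lam_inv])
  have hρs : ρ (s 0) = iota w * s 0 ^ m := by rw [hw, inv_mul_cancel_right]
  have hbm : theta (s 0 ^ m) bd = bd := theta_s_zero_zpow_fixed m theta_s_zero_bd
  have happ : ∀ x, theta (ρ (s 0)) x = w * theta (s 0 ^ m) x * w⁻¹ := fun x => by
    rw [hρs, map_mul theta, MulAut.mul_apply, theta_iota, MulAut.conj_apply]
  have hwb : Commute w bd := by
    refine (FG.commute_of_zpow_commute hk ?_).symm
    have h := theta_restrict hr (s 0) bd
    rw [theta_s_zero_bd, hb, happ, map_zpow, hbm] at h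
    exact (mul_inv_eq_iff_eq_mul.1 h).symm
  obtain ⟨j, rfl⟩ := exists_zpow_of_commute_bd hwb
  suffices j = 0 by rw [hρs, this]; simp
  obtain ⟨u, hu⟩ := exists_rep_mul_J (r (of 0))
  rw [h1, ← hd] at hu
  obtain ⟨a, ha⟩ := exists_lift_aut (theta (s 0 ^ m))
  have hc := compat_affine (lam_det (s 0 ^ m)) (n := 1) (by rw [hbm]; simp) ha
  have hrep : theta (s 0 ^ m) (rep (d, 0)) = rep (d, 0) := by
    refine theta_s_zero_zpow_fixed m ?_
    simp [rep, theta_s]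
  have hu' : u = of (d, 0) ^ j * a u * (of 0 ^ j)⁻¹ := by
    apply J_injective
    have h2 := hfix
    rw [happ, hu, map_mul, hrep, ← ha] at h2
    rw [map_mul, map_mul, map_inv, map_zpow, map_zpow, ← bd_eq_J, J_of]
    have e : ((rep (d, 0))⁻¹ * bd * rep (d, 0)) ^ j = (rep (d, 0))⁻¹ * bd ^ j * rep (d, 0) := by
      have := conj_zpow (i := j) (a := (rep (d, 0))⁻¹) (b := bd)
      rwa [inv_inv] at this
    rw [e]
    calc J u = (rep (d, 0))⁻¹ * (rep (d, 0) * J u) := by group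
      _ = _ := by rw [← h2]; group
  have h3 := congrArg (ex 0) hu'
  have h4 := hc.ex_apply 0 u
  have h5 : affine (mat (theta (s 0 ^ m))) (lam_det (s 0 ^ m)) (-ex 0 (1 : F2), -ex 1 (1 : F2)) 0 = 0 := by
    simp [affine]
  rw [h5] at h4
  have h6 : ((d, 0) : ℤ × ℤ) ≠ 0 := fun h => hd0 (congrArg Prod.fst h)
  simp [h4, h6, FG.ex_of] at h3
  exact h3

theorem exists_pow_of_injective {ρ : G4 →* G4} (hρ : Function.Injective ρ) :
    ∃ (m : ℤ) (c : G4), m ≠ 0 ∧ ρ (s 0) = c * s 0 ^ m * c⁻¹ := by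
  obtain ⟨r, hr⟩ := exists_restrict hρ
  obtain ⟨k, n, hk, hb⟩ := exists_restrict_bd hρ hr
  obtain ⟨g₀, hg₀⟩ := exists_ex_one_eq_zero (r (of 0))
  obtain ⟨n', hn'⟩ := exists_theta_bd g₀
  let v : F2 := (theta g₀ n * n')⁻¹
  let g : G4 := iota v * g₀
  have hg : ∀ x, theta g x = v * theta g₀ x * v⁻¹ := fun x => by
    rw [map_mul theta, MulAut.mul_apply, theta_iota, MulAut.conj_apply]
  obtain ⟨m, hm, h⟩ := exists_eq_zpow_of_normalized
    (ρ := (MulAut.conj g).toMonoidHom.comp ρ) (r := (theta g).toMonoidHom.comp r)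
    ((MulAut.conj g).injective.comp hρ) (fun x => by
      simp [iota_theta, hr]) hk (by
      simp only [MonoidHom.comp_apply, MulEquiv.coe_toMonoidHom]
      rw [hg, hb, map_mul, map_mul, map_inv, map_zpow, hn', conj_zpow]
      simp only [v]
      group) (by
      simp only [MonoidHom.comp_apply, MulEquiv.coe_toMonoidHom]
      simp only [hg, FG.ex_mul, FG.ex_inv, hg₀]
      ring)
  refine ⟨m, g⁻¹, hm, ?_⟩
  rw [← h]
  simp [mul_assoc]

end G4

end

theorem BG.exists_halfTwist_zpow {m : ℕ} (hm : 3 ≤ m)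
    {ρ : BG m ⧸ Subgroup.center (BG m) →* BG m ⧸ Subgroup.center (BG m)}
    (hρ : Function.Injective ρ) : ∃ (n k : ℤ) (c : BG m ⧸ Subgroup.center (BG m)), n ≠ 0 ∧ k ≠ 0 ∧
      ρ (qk (S 0) ^ n) = c * qk (S 0) ^ (2 * k) * c⁻¹ := by
  rcases hm.eq_or_lt with rfl | hm
  · obtain ⟨k, c, hk, h⟩ := G4.exists_pow_of_injective hρ
    refine ⟨2, k, c, two_ne_zero, hk, ?_⟩
    change ρ (G4.s 0 ^ (2 : ℤ)) = c * G4.s 0 ^ (2 * k) * c⁻¹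
    rw [map_zpow, h, conj_zpow, ← zpow_mul, mul_comm]
  · exact exists_pow_of_injective hm hρ

/-- For `n ≥ 4`, any injective endomorphism `ρ` of `B_n/Z(B_n)` is almost
half-twist preserving: there is `k > 0` such that for every half-twist `b` (conjugate of
`σ̄_1`), `ρ (b^k)` is a nonzero power of a Dehn twist about a 2-curve (a conjugate of an
even nonzero power of `σ̄_1`). -/
theorem braidModCenter_almost_halfTwist_preserving (n : ℕ) (hn : 4 ≤ n)
    (ρ : BraidGroup n ⧸ Subgroup.center (BraidGroup n) →*
         BraidGroup n ⧸ Subgroup.center (BraidGroup n))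
    (hρ : Function.Injective ρ) :
    ∃ k : ℕ, 0 < k ∧
      ∀ b : BraidGroup n ⧸ Subgroup.center (BraidGroup n),
        IsConj (QuotientGroup.mk (braidσ n ⟨0, by omega⟩)) b →
        ∃ (m : ℤ) (c : BraidGroup n ⧸ Subgroup.center (BraidGroup n)),
          m ≠ 0 ∧
          ρ (b ^ k) =
            c * (QuotientGroup.mk (braidσ n ⟨0, by omega⟩) :
                  BraidGroup n ⧸ Subgroup.center (BraidGroup n)) ^ (2 * m) * c⁻¹ := by
  obtain ⟨p, q, d, hp, hq, h⟩ := BG.exists_halfTwist_zpow (m := n - 1) (by omega) hρ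
  have hS : (QuotientGroup.mk (braidσ n ⟨0, by omega⟩) :
      BraidGroup n ⧸ Subgroup.center (BraidGroup n)) = BG.qk (BG.S 0 : BG (n - 1)) := by
    rw [← BG.of_eq_S (m := n - 1) ⟨0, by omega⟩]; rfl
  rw [hS]
  obtain ⟨m, hm, h'⟩ : ∃ m : ℤ, m ≠ 0 ∧
      ρ (BG.qk (BG.S 0) ^ p.natAbs) = d * BG.qk (BG.S 0) ^ (2 * m) * d⁻¹ := by
    rcases Int.natAbs_eq p with e | e
    · exact ⟨q, hq, by rw [← zpow_natCast, ← e, h]⟩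
    · refine ⟨-q, neg_ne_zero.2 hq, ?_⟩
      have e' : (p.natAbs : ℤ) = -p := by omega
      rw [← zpow_natCast, e', zpow_neg, map_inv, h, mul_neg, zpow_neg]
      simp only [mul_inv_rev, inv_inv, mul_assoc]
  refine ⟨p.natAbs, Int.natAbs_pos.2 hp, fun b hb => ?_⟩
  obtain ⟨c, rfl⟩ := isConj_iff.1 hb
  refine ⟨m, ρ c * d, hm, ?_⟩
  rw [conj_pow, map_mul, map_mul, map_inv, h']
  simp only [mul_inv_rev, mul_assoc]
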